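/- arXiv:1911.08887 — 2 statements merged into one kernel-verified Lean document; each statement's English description precedes it below -/
import Mathlib

section
/- For every integer k ≥ 2 and every constant γ > 0 there exists n₀ ∈ ℕ such that for all n ≥ n₀ the following holds. Let G be an (n,k,γ)-graph, let x: E(G) → ℝ⁺ be an n^{−2/5}-almost-perfect fractional matching of G, and let W = (W_{−(k−2)}, W_{−(k−3)}, …) be the stationary x-walk on G. Then for each i ∈ ℕ and each vertex v of G, ℙ[W_i = v] = (1 ± n^{−1/3})·(1/n). -/
open scoped Classical

noncomputable section

variable {V : Type*} [Fintype V] [DecidableEq V]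

/-- An edge weighting extended by zero to non-edges. -/
def xw (E : Finset (Finset V)) (x : Finset V → ℝ) (e : Finset V) : ℝ :=
  if e ∈ E then x e else 0

/-- Unnormalised transition weight of an `x`-walk on the `k`-graph with edge set `E`:
the history `h` of the walk is stored most-recent-first, and the weight of moving to
`v` is `x` of the edge formed by the last `k−1` visited vertices together with `v`
(zero for non-edges); for the self-avoiding walk (`sa = true`) previously visited
vertices get weight zero. -/
def stepw (k : ℕ) (E : Finset (Finset V)) (x : Finset V → ℝ) (sa : Bool)
    (h : List V) (v : V) : ℝ :=
  if sa = true ∧ v ∈ h then 0 else xw E x (insert v (h.take (k-1)).toFinset)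

/-- Transition probability of the `x`-walk (zero if the walk has terminated). -/
def trp (k : ℕ) (E : Finset (Finset V)) (x : Finset V → ℝ) (sa : Bool)
    (h : List V) (v : V) : ℝ :=
  stepw k E x sa h v / ∑ w : V, stepw k E x sa h w

/-- The distribution of the history (most-recent-first) of the `x`-walk after `j`
steps, given the distribution `ν` of the initial history. -/
def walkDist (k : ℕ) (E : Finset (Finset V)) (x : Finset V → ℝ) (sa : Bool)
    (ν : List V → ℝ) : ℕ → List V → ℝ
  | 0, l => ν l
  | _+1, [] => 0
  | j+1, v :: t => walkDist k E x sa ν j t * trp k E x sa t v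

/-- The probability that the `x`-walk is at the vertex `v` at time `q`. -/
def headProb (k : ℕ) (E : Finset (Finset V)) (x : Finset V → ℝ) (sa : Bool)
    (ν : List V → ℝ) (q : ℕ) (v : V) : ℝ :=
  ∑ f : Fin (k - 1 + q) → V,
    if (List.ofFn f).head? = some v then walkDist k E x sa ν q (List.ofFn f) else 0

/-- The initial history (most-recent-first) determined by a starting
`(k−1)`-tuple `S`. -/
def startList {k : ℕ} (S : Fin (k-1) → V) : List V := (List.ofFn S).reverse

/-- The initial history distribution concentrated on the starting tuple `S`. -/
def startDist {k : ℕ} (S : Fin (k-1) → V) : List V → ℝ :=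
  fun l => if l = startList S then 1 else 0

/-- One-step transition probability of the simple `x`-walk viewed as a Markov chain on
ordered `(k−1)`-tuples: from the tuple `S` the chain moves to the tuple obtained by
shifting `S` one place and appending a new vertex `v`, with probability
`x(S ∪ {v}) / Σ_w x(S ∪ {w})` (where `x` is zero on non-edges). -/
def chainP (k : ℕ) (E : Finset (Finset V)) (x : Finset V → ℝ)
    (S T : Fin (k-1) → V) : ℝ :=
  ∑ v : V,
    (if T = (fun i : Fin (k-1) =>
        if h : (i : ℕ) + 1 < k - 1 then S ⟨(i : ℕ) + 1, h⟩ else v) then (1 : ℝ) else 0) *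
      (xw E x (insert v (Finset.image S Finset.univ)) /
        ∑ w : V, xw E x (insert w (Finset.image S Finset.univ)))

/-- `π` is a stationary distribution of the simple `x`-walk Markov chain on ordered
`(k−1)`-tuples of distinct vertices: it is a probability distribution supported on
injective tuples and satisfies `π P = π`. -/
def IsStationaryDist (k : ℕ) (E : Finset (Finset V)) (x : Finset V → ℝ)
    (π : (Fin (k-1) → V) → ℝ) : Prop :=
  (∀ S, 0 ≤ π S) ∧ (∀ S, ¬ Function.Injective S → π S = 0) ∧
    (∑ S : Fin (k-1) → V, π S = 1) ∧
    (∀ T : Fin (k-1) → V, ∑ S : Fin (k-1) → V, π S * chainP k E x S T = π T)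

/-- The initial history distribution (histories most-recent-first) induced by a
distribution `μ` on ordered starting `(k−1)`-tuples. -/
def tupleInit (k : ℕ) (μ : (Fin (k-1) → V) → ℝ) : List V → ℝ :=
  fun l => ∑ S : Fin (k-1) → V, if l = (List.ofFn S).reverse then μ S else 0

theorem reverse_ofFn_shift {α : Type*} {k : ℕ} (S : Fin (k-1) → α) (v : α) :
    (List.ofFn (fun i : Fin (k-1) =>
        if h : (i : ℕ) + 1 < k - 1 then S ⟨(i : ℕ) + 1, h⟩ else v)).reverse =
      (v :: (List.ofFn S).reverse).take (k-1) := by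
  apply List.ext_getElem
  · simp
  · intro i h1 h2
    have hi : i < k - 1 := by simpa using h1
    rcases i with _ | i
    · simp [show k - 1 - 1 + 1 = k - 1 by omega]
    · simp [show k - 1 - 1 - (i + 1) + 1 < k - 1 by omega]
      congr 2
      omega

theorem trp_take (k : ℕ) (E : Finset (Finset V)) (x : Finset V → ℝ) (l : List V) (v : V) :
    trp k E x false (l.take (k-1)) v = trp k E x false l v := by
  simp [trp, stepw, List.take_take]

theorem trp_reverse_ofFn (k : ℕ) (E : Finset (Finset V)) (x : Finset V → ℝ)
    (S : Fin (k-1) → V) (v : V) :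
    trp k E x false (List.ofFn S).reverse v =
      xw E x (insert v (Finset.image S Finset.univ)) /
        ∑ w : V, xw E x (insert w (Finset.image S Finset.univ)) := by
  have h : ((List.ofFn S).reverse.take (k-1)).toFinset = Finset.image S Finset.univ := by
    rw [List.take_of_length_le (by simp)]
    ext a
    simp [List.mem_ofFn]
  simp [trp, stepw, h]

/-- One step of the chain on tuples, tested against a function. -/
theorem sum_chainP_mul (k : ℕ) (E : Finset (Finset V)) (x : Finset V → ℝ)
    (S : Fin (k-1) → V) (Φ : (Fin (k-1) → V) → ℝ) :
    ∑ T, chainP k E x S T * Φ T =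
      ∑ v : V, xw E x (insert v (Finset.image S Finset.univ)) /
        (∑ w : V, xw E x (insert w (Finset.image S Finset.univ))) *
        Φ (fun i : Fin (k-1) =>
          if h : (i : ℕ) + 1 < k - 1 then S ⟨(i : ℕ) + 1, h⟩ else v) := by
  simp only [chainP, Finset.sum_mul]
  rw [Finset.sum_comm]
  refine Finset.sum_congr rfl fun v _ => ?_
  simp [ite_mul]

theorem sum_tupleInit_mul (k : ℕ) (μ : (Fin (k-1) → V) → ℝ) (Φ : List V → ℝ) :
    ∑ f : Fin (k-1) → V, tupleInit k μ (List.ofFn f) * Φ (List.ofFn f) =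
      ∑ S, μ S * Φ (List.ofFn S).reverse := by
  simp only [tupleInit, Finset.sum_mul]
  rw [Finset.sum_comm]
  refine Finset.sum_congr rfl fun S _ => ?_
  have hrev : (List.ofFn S).reverse = List.ofFn fun i => S (Fin.rev i) := by
    refine List.ext_getElem (by simp) fun i h1 h2 => ?_
    simp only [List.getElem_reverse, List.getElem_ofFn, List.length_ofFn, Fin.rev]
    congr 2
    omega
  have h : ∀ f : Fin (k-1) → V,
      List.ofFn f = (List.ofFn S).reverse ↔ f = fun i => S (Fin.rev i) := by
    intro f
    rw [hrev]
    exact List.ofFn_injective.eq_iff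
  simp only [h, ite_mul, zero_mul]
  rw [Finset.sum_ite_eq' Finset.univ]
  simp [hrev]

/-- If the initial distribution is invariant, then the last `k-1` vertices of the walk
are distributed according to it at every time. -/
theorem sum_walkDist_mul {k : ℕ} (hk : 2 ≤ k) (E : Finset (Finset V)) (x : Finset V → ℝ)
    (π : (Fin (k-1) → V) → ℝ)
    (hπ : ∀ T, ∑ S, π S * chainP k E x S T = π T) (q : ℕ) :
    ∀ Φ : List V → ℝ,
      ∑ f : Fin (k - 1 + q) → V, walkDist k E x false (tupleInit k π) q (List.ofFn f) *
        Φ ((List.ofFn f).take (k-1)) = ∑ S, π S * Φ (List.ofFn S).reverse := by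
  induction q with
  | zero =>
    intro Φ
    rw [← sum_tupleInit_mul]
    refine Finset.sum_congr rfl fun f _ => ?_
    rw [List.take_of_length_le (by simp)]
    rfl
  | succ q ih =>
    intro Φ
    have h1 := ih (fun l => ∑ v, trp k E x false l v * Φ ((v :: l).take (k-1)))
    have h2 : ∀ (l : List V) (v : V),
        (v :: l.take (k-1)).take (k-1) = (v :: l).take (k-1) := by
      intro l v
      obtain ⟨m, hm⟩ : ∃ m, k - 1 = m + 1 := ⟨k - 2, by omega⟩
      simp [hm, List.take_take]
    simp only [trp_take, h2, trp_reverse_ofFn, ← reverse_ofFn_shift] at h1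
    have h3 : ∀ S, ∑ v : V, xw E x (insert v (Finset.image S Finset.univ)) /
        (∑ w : V, xw E x (insert w (Finset.image S Finset.univ))) *
        Φ (List.ofFn (fun i : Fin (k-1) =>
          if h : (i : ℕ) + 1 < k - 1 then S ⟨(i : ℕ) + 1, h⟩ else v)).reverse =
        ∑ T, chainP k E x S T * Φ (List.ofFn T).reverse := fun S =>
      (sum_chainP_mul k E x S (fun T => Φ (List.ofFn T).reverse)).symm
    simp only [h3, Finset.mul_sum, ← mul_assoc] at h1
    rw [Finset.sum_comm (s := (Finset.univ : Finset (Fin (k-1) → V)))] at h1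
    simp only [← Finset.sum_mul, hπ] at h1
    rw [← h1]
    change ∑ f : Fin ((k - 1 + q) + 1) → V, _ = _
    rw [← (Fin.consEquiv (fun _ : Fin ((k - 1 + q) + 1) => V)).sum_comp,
      Fintype.sum_prod_type, Finset.sum_comm]
    refine Finset.sum_congr rfl fun g _ => Finset.sum_congr rfl fun v _ => ?_
    have h4 : List.ofFn (n := (k - 1 + q) + 1)
        ((Fin.consEquiv (fun _ : Fin ((k - 1 + q) + 1) => V)) (v, g)) = v :: List.ofFn g := by
      simp [Fin.consEquiv, List.ofFn_succ]
    rw [h4, walkDist, mul_assoc]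

theorem headProb_eq {k : ℕ} (hk : 2 ≤ k) (E : Finset (Finset V)) (x : Finset V → ℝ)
    (π : (Fin (k-1) → V) → ℝ)
    (hπ : ∀ T, ∑ S, π S * chainP k E x S T = π T) (q : ℕ) (v : V) :
    headProb k E x false (tupleInit k π) q v =
      ∑ S, if S ⟨k - 2, by omega⟩ = v then π S else 0 := by
  have h := sum_walkDist_mul hk E x π hπ q (fun l => if l.head? = some v then 1 else 0)
  have h1 : ∀ S : Fin (k-1) → V, (List.ofFn S).reverse.head? = some v ↔
      S ⟨k - 2, by omega⟩ = v := by
    intro S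
    rw [List.head?_eq_getElem?, List.getElem?_eq_getElem (by simp; omega)]
    simp [show k - 1 - 1 = k - 2 by omega]
  have h2 : ∀ l : List V, (l.take (k-1)).head? = l.head? := by
    intro l
    rw [List.head?_take, if_neg (by omega)]
  simp only [h1, h2, mul_ite, mul_one, mul_zero] at h
  rw [headProb, ← h]

/-- Total weight of the edges obtained from the tuple `S` by adding one vertex. -/
def extWeight {m : ℕ} (E : Finset (Finset V)) (x : Finset V → ℝ) (S : Fin m → V) : ℝ :=
  ∑ w : V, xw E x (insert w (Finset.image S Finset.univ))

theorem image_snoc {α : Type*} [DecidableEq α] {m : ℕ} (S : Fin m → α) (v : α) :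
    Finset.image (Fin.snoc S v : Fin (m+1) → α) Finset.univ =
      insert v (Finset.image S Finset.univ) := by
  ext a
  simp [Fin.exists_fin_succ', eq_comm, or_comm]

theorem image_cons {α : Type*} [DecidableEq α] {m : ℕ} (S : Fin m → α) (v : α) :
    Finset.image (Fin.cons v S : Fin (m+1) → α) Finset.univ =
      insert v (Finset.image S Finset.univ) := by
  ext a
  simp [Fin.exists_fin_succ, eq_comm]

theorem sum_snoc {α : Type*} [Fintype α] {m : ℕ} (Φ : (Fin (m+1) → α) → ℝ) :
    ∑ f, Φ f = ∑ S : Fin m → α, ∑ v : α, Φ (Fin.snoc S v) := by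
  rw [← (Fin.snocEquiv (fun _ : Fin (m+1) => α)).sum_comp, Fintype.sum_prod_type,
    Finset.sum_comm]
  rfl

theorem sum_cons {α : Type*} [Fintype α] {m : ℕ} (Φ : (Fin (m+1) → α) → ℝ) :
    ∑ f, Φ f = ∑ S : Fin m → α, ∑ v : α, Φ (Fin.cons v S) := by
  rw [← (Fin.consEquiv (fun _ : Fin (m+1) => α)).sum_comp, Fintype.sum_prod_type,
    Finset.sum_comm]
  rfl

/-- The weight of a tuple of `m+1` vertices tested against its initial segment. -/
theorem sum_xw_init {m : ℕ} (E : Finset (Finset V)) (x : Finset V → ℝ)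
    (Φ : (Fin m → V) → ℝ) :
    ∑ f : Fin (m+1) → V, xw E x (Finset.image f Finset.univ) * Φ (Fin.init f) =
      ∑ S, extWeight E x S * Φ S := by
  rw [sum_snoc]
  simp [image_snoc, extWeight, Finset.sum_mul]

theorem sum_xw_tail {m : ℕ} (E : Finset (Finset V)) (x : Finset V → ℝ)
    (Φ : (Fin m → V) → ℝ) :
    ∑ f : Fin (m+1) → V, xw E x (Finset.image f Finset.univ) * Φ (Fin.tail f) =
      ∑ S, extWeight E x S * Φ S := by
  rw [sum_cons]
  simp [image_cons, extWeight, Finset.sum_mul]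

/-- For a stationary distribution the ratio `π / extWeight` does not change along a step
of positive probability. -/
theorem ratio_init_eq_ratio_tail {m : ℕ} (E : Finset (Finset V)) (x : Finset V → ℝ)
    (hx : ∀ e ∈ E, 0 < x e) (π : (Fin (m+2-1) → V) → ℝ)
    (hπ : ∀ T, ∑ S, π S * chainP (m+2) E x S T = π T)
    (hsupp : ∀ S : Fin (m+1) → V, extWeight E x S = 0 → π S = 0)
    (f : Fin (m+2) → V) (hf : Finset.image f Finset.univ ∈ E) :
    π (Fin.init f) / extWeight E x (Fin.init f : Fin (m+1) → V) =
      π (Fin.tail f) / extWeight E x (Fin.tail f : Fin (m+1) → V) := by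
  set r : (Fin (m+1) → V) → ℝ := fun S => π S / extWeight E x S with hr
  set F : (Fin (m+2) → V) → ℝ := fun f => xw E x (Finset.image f Finset.univ) with hF
  have hrd : ∀ S : Fin (m+1) → V, extWeight E x S * r S = π S := fun S =>
    mul_div_cancel_of_imp' (hsupp S)
  have hshift : ∀ (S : Fin (m+1) → V) (v : V),
      (Fin.tail (Fin.snoc S v : Fin (m+2) → V) : Fin (m+1) → V) =
        fun i : Fin (m+1) => if h : (i : ℕ) + 1 < m + 2 - 1 then S ⟨(i : ℕ) + 1, h⟩ else v := by
    intro S v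
    funext i
    simp [Fin.tail, Fin.snoc, Fin.castLT]
  have hcross : ∑ f, F f * (r (Fin.init f) * r (Fin.tail f)) = ∑ T, π T * r T := by
    calc ∑ f, F f * (r (Fin.init f) * r (Fin.tail f))
        = ∑ S : Fin (m+1) → V, π S * ∑ T, chainP (m+2) E x S T * r T := by
          rw [sum_snoc]
          refine Finset.sum_congr rfl fun S _ => ?_
          have h := sum_chainP_mul (m+2) E x S r
          rw [h, Finset.mul_sum]
          refine Finset.sum_congr rfl fun v _ => ?_
          have h1 := hshift S v
          simp only [hF, image_snoc, Fin.init_snoc, h1]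
          simp only [hr, extWeight]
          ring!
      _ = ∑ T, (∑ S : Fin (m+1) → V, π S * chainP (m+2) E x S T) * r T := by
          simp only [Finset.mul_sum, Finset.sum_mul, mul_assoc]
          exact Finset.sum_comm
      _ = ∑ T, π T * r T := by
          refine Finset.sum_congr rfl fun T _ => ?_
          congr 1
          exact hπ T
  have hinit : ∑ f, F f * r (Fin.init f) ^ 2 = ∑ T, π T * r T := by
    rw [sum_xw_init E x (fun S => r S ^ 2)]
    refine Finset.sum_congr rfl fun S _ => ?_
    rw [← hrd S]; ring
  have htail : ∑ f, F f * r (Fin.tail f) ^ 2 = ∑ T, π T * r T := by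
    rw [sum_xw_tail E x (fun S => r S ^ 2)]
    refine Finset.sum_congr rfl fun S _ => ?_
    rw [← hrd S]; ring
  have hzero : ∑ f, F f * (r (Fin.init f) - r (Fin.tail f)) ^ 2 = 0 := by
    have : ∀ f, F f * (r (Fin.init f) - r (Fin.tail f)) ^ 2 =
        F f * r (Fin.init f) ^ 2 + F f * r (Fin.tail f) ^ 2 -
          2 * (F f * (r (Fin.init f) * r (Fin.tail f))) := fun f => by ring
    simp only [this, Finset.sum_sub_distrib, Finset.sum_add_distrib, ← Finset.mul_sum,
      hcross, hinit, htail]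
    ring
  have hFnn : ∀ f, 0 ≤ F f := by
    intro f
    simp only [hF, xw]
    split_ifs with h
    · exact (hx _ h).le
    · exact le_rfl
  have hFf : F f ≠ 0 := by
    simp only [hF, xw, if_pos hf]
    exact (hx _ hf).ne'
  have := (Finset.sum_eq_zero_iff_of_nonneg
    (fun f _ => mul_nonneg (hFnn f) (sq_nonneg _))).1 hzero f (Finset.mem_univ _)
  have h2 := (mul_eq_zero.1 this).resolve_left hFf
  exact sub_eq_zero.1 (pow_eq_zero_iff two_ne_zero |>.1 h2)

theorem injective_of_image_mem {α : Type*} [DecidableEq α] {m : ℕ} {E : Finset (Finset α)}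
    (hE : ∀ e ∈ E, e.card = m) {f : Fin m → α}
    (hf : Finset.image f Finset.univ ∈ E) : Function.Injective f := by
  rw [← Set.injOn_univ, ← Finset.coe_univ, ← Finset.card_image_iff, hE _ hf]
  simp

/-- If any two injective tuples have a common extension, then a function on tuples that
is invariant along edges is constant on injective tuples. -/
theorem eq_of_invariant {α : Type*} [DecidableEq α] {m : ℕ} {E : Finset (Finset α)}
    (hE : ∀ e ∈ E, e.card = m + 2)
    (hcommon : ∀ S S' : Fin (m+1) → α, Function.Injective S → Function.Injective S' →
      ∃ w, insert w (Finset.image S Finset.univ) ∈ E ∧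
        insert w (Finset.image S' Finset.univ) ∈ E)
    (r : (Fin (m+1) → α) → ℝ)
    (hr : ∀ f : Fin (m+2) → α, Finset.image f Finset.univ ∈ E →
      r (Fin.init f) = r (Fin.tail f))
    (S S' : Fin (m+1) → α) (hS : Function.Injective S) (hS' : Function.Injective S') :
    r S = r S' := by
  have key : ∀ j : ℕ, ∀ S S' : Fin (m+1) → α, Function.Injective S → Function.Injective S' →
      (∀ i : Fin (m+1), j ≤ i → S i = S' i) → r S = r S' := by
    intro j
    induction j with
    | zero =>
      intro S S' _ _ h
      rw [funext fun i => h i (Nat.zero_le _)]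
    | succ j ih =>
      intro S S' hS hS' h
      obtain ⟨w, hw, hw'⟩ := hcommon S S' hS hS'
      rw [← image_snoc] at hw hw'
      have h1 := hr _ hw
      have h2 := hr _ hw'
      rw [Fin.init_snoc] at h1 h2
      rw [h1, h2]
      refine ih _ _ ((injective_of_image_mem hE hw).comp (Fin.succ_injective _))
        ((injective_of_image_mem hE hw').comp (Fin.succ_injective _)) fun i hi => ?_
      simp only [Fin.tail, Fin.snoc]
      split_ifs with hlt
      · simpa using h _ (by simpa [Fin.castLT] using hi)
      · rfl
  exact key (m+1) S S' hS hS' fun i hi => absurd i.2 (by omega)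

theorem card_le_card_extensions {k : ℕ} {E : Finset (Finset V)}
    (hE : ∀ e ∈ E, e.card = k + 1) {A : Finset V} (hA : A.card = k) :
    (E.filter (fun e => A ⊆ e)).card ≤
      (Finset.univ.filter (fun w => insert w A ∈ E)).card := by
  refine (Finset.card_le_card (t := (Finset.univ.filter (fun w => insert w A ∈ E)).image
    (fun w => insert w A)) ?_).trans Finset.card_image_le
  intro e he
  rw [Finset.mem_filter] at he
  obtain ⟨he, hAe⟩ := he
  have hc : (e \ A).card = 1 := by
    rw [Finset.card_sdiff_of_subset hAe, hE e he, hA]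
    omega
  obtain ⟨w, hw⟩ := Finset.card_eq_one.1 hc
  have : insert w A = e := by
    rw [← Finset.sdiff_union_of_subset hAe, hw, Finset.insert_eq]
  simp only [Finset.mem_image, Finset.mem_filter, Finset.mem_univ, true_and]
  exact ⟨w, this.symm ▸ he, this⟩

theorem card_filter_image_eq {k : ℕ} {e e' : Finset V} (h : e.card = e'.card) :
    (Finset.univ.filter (fun f : Fin k → V => Finset.image f Finset.univ = e)).card =
      (Finset.univ.filter (fun f : Fin k → V => Finset.image f Finset.univ = e')).card := by
  have key : ∀ e e' : Finset V, e.card = e'.card →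
      (Finset.univ.filter (fun f : Fin k → V => Finset.image f Finset.univ = e)).card ≤
      (Finset.univ.filter (fun f : Fin k → V => Finset.image f Finset.univ = e')).card := by
    intro e e' h
    let φ : {a // a ∈ e} ≃ {a // a ∈ e'} := Finset.equivOfCardEq h
    let σ : Equiv.Perm V := φ.extendSubtype
    have hσ : e.image σ = e' := by
      refine Finset.eq_of_subset_of_card_le ?_ ?_
      · intro a ha
        obtain ⟨b, hb, rfl⟩ := Finset.mem_image.1 ha
        exact φ.extendSubtype_mem b hb
      · rw [Finset.card_image_of_injective _ σ.injective, h]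
    refine Finset.card_le_card_of_injOn (fun f => σ ∘ f) ?_ ?_
    · intro f hf
      simp only [Finset.coe_filter, Finset.mem_univ, true_and, Set.mem_ofPred_eq] at hf ⊢
      rw [← Finset.image_image, hf, hσ]
    · intro f _ g _ hfg
      exact σ.injective.comp_left hfg
  exact le_antisymm (key _ _ h) (key _ _ h.symm)

/-- The weight of the ordered edges with a prescribed vertex `v` in a fixed position is
proportional to the weighted degree of `v`. -/
theorem exists_sum_eq_mul_degree {k : ℕ} {E : Finset (Finset V)}
    (hE : ∀ e ∈ E, e.card = k) (x : Finset V → ℝ) (j : Fin k) :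
    ∃ C : ℝ, ∀ v : V,
      ∑ f : Fin k → V, (if f j = v then xw E x (Finset.image f Finset.univ) else 0) =
        C * ∑ e ∈ E.filter (fun e => v ∈ e), x e := by
  obtain ⟨N, hN⟩ : ∃ N : ℕ, ∀ e ∈ E,
      (Finset.univ.filter (fun f : Fin k → V => Finset.image f Finset.univ = e)).card = N := by
    rcases E.eq_empty_or_nonempty with rfl | ⟨e₀, he₀⟩
    · exact ⟨0, by simp⟩
    · exact ⟨_, fun e he => card_filter_image_eq ((hE e he).trans (hE e₀ he₀).symm)⟩
  refine ⟨N / k, fun v => ?_⟩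
  have hk : (k : ℝ) ≠ 0 := by
    have := j.pos
    positivity
  have hsymm : ∀ i : Fin k,
      ∑ f : Fin k → V, (if f i = v then xw E x (Finset.image f Finset.univ) else 0) =
      ∑ f : Fin k → V, (if f j = v then xw E x (Finset.image f Finset.univ) else 0) := by
    intro i
    rw [← (Equiv.arrowCongr (Equiv.swap i j) (Equiv.refl V)).sum_comp]
    refine Finset.sum_congr rfl fun f _ => ?_
    have h1 : (Equiv.arrowCongr (Equiv.swap i j) (Equiv.refl V)) f =
        f ∘ Equiv.swap i j := by
      funext a
      simp [Equiv.arrowCongr]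
    have h2 : Finset.image (f ∘ Equiv.swap i j) Finset.univ = Finset.image f Finset.univ := by
      rw [← Finset.image_image, Finset.image_univ_equiv]
    rw [h1, h2]
    simp
  have htot : ∑ i : Fin k, ∑ f : Fin k → V,
      (if f i = v then xw E x (Finset.image f Finset.univ) else 0) =
      N * ∑ e ∈ E.filter (fun e => v ∈ e), x e := by
    rw [Finset.sum_comm]
    have h1 : ∀ f : Fin k → V,
        ∑ i : Fin k, (if f i = v then xw E x (Finset.image f Finset.univ) else 0) =
        ∑ e ∈ E.filter (fun e => v ∈ e),
          if Finset.image f Finset.univ = e then x e else 0 := by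
      intro f
      rw [Finset.sum_ite_eq]
      by_cases hf : Finset.image f Finset.univ ∈ E
      · have hinj := injective_of_image_mem hE hf
        by_cases hv : v ∈ Finset.image f Finset.univ
        · rw [if_pos (Finset.mem_filter.2 ⟨hf, hv⟩), xw, if_pos hf]
          obtain ⟨i, -, rfl⟩ := Finset.mem_image.1 hv
          simp [hinj.eq_iff]
        · rw [if_neg (c := _ ∈ E.filter _) (fun h => hv (Finset.mem_filter.1 h).2)]
          refine Finset.sum_eq_zero fun i _ => if_neg fun h => hv ?_
          exact h ▸ Finset.mem_image_of_mem f (Finset.mem_univ i)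
      · rw [if_neg (fun h => hf (Finset.mem_filter.1 h).1)]
        simp [xw, hf]
    simp only [h1]
    rw [Finset.sum_comm, Finset.mul_sum]
    refine Finset.sum_congr rfl fun e he => ?_
    rw [← Finset.sum_filter, Finset.sum_const, hN e (Finset.mem_filter.1 he).1, nsmul_eq_mul]
  simp only [hsymm, Finset.sum_const, Finset.card_univ, Fintype.card_fin, nsmul_eq_mul] at htot
  rw [div_mul_eq_mul_div, eq_div_iff hk, ← htot, mul_comm]

theorem rpow_gap {n : ℕ} (hn : 2 ^ 15 + 1 ≤ n) :
    ∃ a : ℝ, 0 < a ∧ a < 1 / 2 ∧ (n : ℝ) ^ (-(2 : ℝ)/5) = a ^ 6 ∧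
      (n : ℝ) ^ (-(1 : ℝ)/3) = a ^ 5 := by
  have hn' : (2 : ℝ) ^ 15 + 1 ≤ n := by exact_mod_cast hn
  have h0 : (0 : ℝ) < n := by linarith [show (0 : ℝ) < 2 ^ 15 by positivity]
  refine ⟨(n : ℝ) ^ (-(1 : ℝ)/15), by positivity, ?_, ?_, ?_⟩
  · have h : ((2 : ℝ) ^ (15 : ℕ)) ^ (-(1 : ℝ)/15) = 1 / 2 := by
      rw [← Real.rpow_natCast, ← Real.rpow_mul (by norm_num)]
      norm_num [Real.rpow_neg_one]
    rw [← h]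
    exact Real.rpow_lt_rpow_of_neg (by positivity) (by linarith) (by norm_num)
  · rw [← Real.rpow_natCast, ← Real.rpow_mul h0.le]
    norm_num
  · rw [← Real.rpow_natCast, ← Real.rpow_mul h0.le]
    norm_num

/-- A probability vector proportional to a nearly constant weight is nearly uniform. -/
theorem near_uniform_of_proportional {n : ℕ} (hn : 0 < n) {ε δ c : ℝ} (hε : ε < 1)
    (hεδ : ε < δ) (hgap : 1 < (1 + δ) * (1 - ε)) (p deg : Fin n → ℝ)
    (hp : ∀ v, p v = c * deg v) (hsum : ∑ v, p v = 1)
    (hle : ∀ v, deg v ≤ 1) (hge : ∀ v, 1 - ε ≤ deg v) (v : Fin n) :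
    (1 - δ) * (1 / (n : ℝ)) < p v ∧ p v < (1 + δ) * (1 / (n : ℝ)) := by
  have hn' : (0 : ℝ) < n := by exact_mod_cast hn
  simp only [hp, ← Finset.mul_sum] at hsum
  have h1 : ∑ v, deg v ≤ n := by
    simpa using Finset.sum_le_sum fun (v : Fin n) (_ : v ∈ Finset.univ) => hle v
  have h2 : n * (1 - ε) ≤ ∑ v, deg v := by
    have h := Finset.card_nsmul_le_sum Finset.univ deg (1 - ε) fun v _ => hge v
    rwa [Finset.card_univ, Fintype.card_fin, nsmul_eq_mul] at h
  have h3 : 0 < n * (1 - ε) := mul_pos hn' (by linarith)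
  have hc : 0 < c := by
    by_contra! h
    nlinarith
  have h4 : 1 ≤ c * n := by nlinarith
  have h5 : c * (n * (1 - ε)) ≤ 1 := by nlinarith
  rw [hp, mul_one_div, mul_one_div, div_lt_iff₀ hn', lt_div_iff₀ hn']
  have h6 : c * n * (1 - ε) ≤ c * n * deg v :=
    mul_le_mul_of_nonneg_left (hge v) (by positivity)
  have h7 : c * n * deg v ≤ c * n * 1 :=
    mul_le_mul_of_nonneg_left (hle v) (by positivity)
  have h8 : c * n < 1 + δ := by
    by_contra! h
    nlinarith
  constructor <;> nlinarith

/-- Lemma 5.7: for an `(n,k,γ)`-graph `G` (with `n` large) and an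
`n^{−2/5}`-almost-perfect fractional matching `x` of `G`, the stationary `x`-walk `W`
(the simple `x`-walk whose initial distribution is a stationary distribution `π`)
satisfies `ℙ[W_i = v] = (1 ± n^{−1/3}) · 1/n` for every time `i ∈ ℕ` and every
vertex `v`. -/
theorem stmt_14 (k : ℕ) (hk : 2 ≤ k) (γ : ℝ) (hγ : 0 < γ) :
    ∃ n₀ : ℕ, ∀ n : ℕ, n₀ ≤ n →
    ∀ E : Finset (Finset (Fin n)),
      (∀ e ∈ E, e.card = k) →
      (∀ S : Finset (Fin n), S.card = k - 1 →
        (1/2 + γ) * (n : ℝ) ≤ ((E.filter (fun e => S ⊆ e)).card : ℝ)) →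
    ∀ x : Finset (Fin n) → ℝ, (∀ e ∈ E, 0 < x e) →
      -- x is a fractional matching ...
      (∀ v : Fin n, ∑ e ∈ E.filter (fun e => v ∈ e), x e ≤ 1) →
      -- ... which is n^{−2/5}-almost-perfect
      (∀ v : Fin n, 1 - (n : ℝ) ^ (-(2 : ℝ)/5) ≤ ∑ e ∈ E.filter (fun e => v ∈ e), x e) →
    ∀ π : (Fin (k-1) → Fin n) → ℝ, IsStationaryDist k E x π →
    ∀ i : ℕ, ∀ v : Fin n,
      (1 - (n : ℝ) ^ (-(1 : ℝ)/3)) * (1 / (n : ℝ)) <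
        headProb k E x false (tupleInit k π) i v ∧
      headProb k E x false (tupleInit k π) i v <
        (1 + (n : ℝ) ^ (-(1 : ℝ)/3)) * (1 / (n : ℝ)) := by
  refine ⟨2 ^ 15 + 1, fun n hn E hE hdeg x hx hle hge π hπ i v => ?_⟩
  obtain ⟨m, rfl⟩ : ∃ m, k = m + 2 := ⟨k - 2, by omega⟩
  obtain ⟨-, hinj, hone, hstat⟩ := hπ
  have hn0 : 0 < n := by omega
  have hn' : (0 : ℝ) < n := by exact_mod_cast hn0
  have hcard : ∀ S : Fin (m+1) → Fin n, Function.Injective S → (1/2 + γ) * (n : ℝ) ≤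
      ((Finset.univ.filter fun w => insert w (Finset.image S Finset.univ) ∈ E).card : ℝ) := by
    intro S hS
    have hA : (Finset.image S Finset.univ).card = m + 1 := by
      rw [Finset.card_image_of_injective _ hS]
      simp
    exact (hdeg _ hA).trans (Nat.cast_le.2 (card_le_card_extensions hE hA))
  have hcommon : ∀ S S' : Fin (m+1) → Fin n, Function.Injective S → Function.Injective S' →
      ∃ w, insert w (Finset.image S Finset.univ) ∈ E ∧
        insert w (Finset.image S' Finset.univ) ∈ E := by
    intro S S' hS hS'
    by_contra! hno
    have hdisj : Disjoint
        (Finset.univ.filter fun w => insert w (Finset.image S Finset.univ) ∈ E)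
        (Finset.univ.filter fun w => insert w (Finset.image S' Finset.univ) ∈ E) :=
      Finset.disjoint_filter.2 fun w _ h => hno w h
    have h1 := Finset.card_le_univ (Finset.disjUnion _ _ hdisj)
    rw [Finset.card_disjUnion, Fintype.card_fin, ← Nat.cast_le (α := ℝ), Nat.cast_add] at h1
    have h2 := hcard S hS
    have h3 := hcard S' hS'
    have h4 := mul_pos hγ hn'
    linarith
  have hpos : ∀ S : Fin (m+1) → Fin n, Function.Injective S → extWeight E x S ≠ 0 := by
    intro S hS
    obtain ⟨w, hw, -⟩ := hcommon S S hS hS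
    refine (Finset.sum_pos' (fun u _ => ?_) ⟨w, Finset.mem_univ _, ?_⟩).ne'
    · rw [xw]
      split_ifs with h
      · exact (hx _ h).le
      · exact le_rfl
    · rw [xw, if_pos hw]
      exact hx _ hw
  have hsupp : ∀ S : Fin (m+1) → Fin n, extWeight E x S = 0 → π S = 0 := fun S hS =>
    hinj S fun h => hpos S h hS
  have hconst := eq_of_invariant hE hcommon
    (fun S : Fin (m+1) → Fin n => π S / extWeight E x S)
    (ratio_init_eq_ratio_tail E x hx π hstat hsupp)
  obtain ⟨S₀, hS₀⟩ : ∃ S₀ : Fin (m+1) → Fin n, π S₀ ≠ 0 := by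
    by_contra! h
    exact zero_ne_one ((Finset.sum_eq_zero fun S _ => h S).symm.trans hone)
  have hS₀inj : Function.Injective S₀ := by
    by_contra h
    exact hS₀ (hinj S₀ h)
  have hprop : ∀ S : Fin (m+1) → Fin n, π S = extWeight E x S * (π S₀ / extWeight E x S₀) := by
    intro S
    by_cases hS : Function.Injective S
    · rw [← hconst S S₀ hS hS₀inj, mul_div_cancel₀ _ (hpos S hS)]
    · have : extWeight E x S = 0 := by
        refine Finset.sum_eq_zero fun w _ => if_neg fun hw => hS ?_
        rw [← image_snoc] at hw
        have := (injective_of_image_mem hE hw).comp (Fin.castSucc_injective _)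
        convert this using 1
        funext a
        simp
      rw [this, zero_mul, hsupp S this]
  obtain ⟨C, hC⟩ := exists_sum_eq_mul_degree hE x (Fin.last m).castSucc
  have hhead : ∀ u, headProb (m+2) E x false (tupleInit (m+2) π) i u =
      π S₀ / extWeight E x S₀ * C * ∑ e ∈ E.filter (fun e => u ∈ e), x e := by
    intro u
    rw [headProb_eq hk E x π hstat, mul_assoc, ← hC u]
    obtain ⟨Φ, hΦ⟩ : ∃ Φ : (Fin (m+1) → Fin n) → ℝ,
        ∀ S, Φ S = if S (Fin.last m) = u then 1 else 0 := ⟨_, fun _ => rfl⟩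
    have h : ∀ f : Fin (m+2) → Fin n,
        (if f (Fin.last m).castSucc = u then xw E x (Finset.image f Finset.univ) else 0) =
        xw E x (Finset.image f Finset.univ) * Φ (Fin.init f) := by
      intro f
      rw [hΦ]
      by_cases hu : f (Fin.last m).castSucc = u <;> simp [Fin.init, hu]
    simp only [h]
    rw [sum_xw_init, Finset.mul_sum]
    refine Finset.sum_congr rfl fun S _ => ?_
    rw [← mul_assoc, mul_comm (_ / _), ← hprop S, hΦ]
    change (if S (Fin.last m) = u then π S else 0) = _
    by_cases hu : S (Fin.last m) = u <;> simp [hu]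
  have hsum : ∑ u, headProb (m+2) E x false (tupleInit (m+2) π) i u = 1 := by
    simp only [headProb_eq hk E x π hstat]
    rw [Finset.sum_comm]
    simpa using hone
  obtain ⟨a, ha0, ha, hε, hδ⟩ := rpow_gap hn
  simp only [hε] at hge
  rw [hδ]
  have ha5 : 0 < a ^ 5 := pow_pos ha0 5
  have ha6 : a ^ 6 = a * a ^ 5 := by ring
  have ha5' : a ^ 5 < 1 / 2 := by
    calc a ^ 5 ≤ a ^ 1 := pow_le_pow_of_le_one ha0.le (by linarith) (by norm_num)
      _ < 1 / 2 := by simpa using ha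
  have hlt : a ^ 6 < a ^ 5 / 2 := by nlinarith
  exact near_uniform_of_proportional hn0 (by linarith) (by linarith) (by nlinarith) _ _
    hhead hsum hle hge v
end
end

section
/- For every integer k ≥ 2 and every constant γ > 0 there exist a constant c > 0 and n₀ ∈ ℕ such that for all n ≥ n₀, every (n,k,γ)-graph G contains at least exp(n ln n − c n) distinct tight paths of length at least n − n^{7/8}. -/
open scoped Classical

/-- The set of tight paths of length at least `n − n^{7/8}` in the `k`-graph on `Fin n`
with edge set `E`: each such path is encoded as its edge set, a subset of `E` whose
edges are exactly the sets of `k` consecutive vertices of some injective vertex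
sequence `v` of length `m`, where the length `m − (k−1)` of the path is at least
`n − n^{7/8}`. -/
noncomputable def longTightPaths (n k : ℕ) (E : Finset (Finset (Fin n))) :
    Finset (Finset (Finset (Fin n))) :=
  E.powerset.filter (fun P =>
    ∃ m : ℕ, ∃ v : Fin m → Fin n, Function.Injective v ∧
      (n : ℝ) - (n : ℝ) ^ ((7 : ℝ)/8) ≤ (m : ℝ) - ((k : ℝ) - 1) ∧
      P = Finset.image (fun i : Fin (m - (k-1)) =>
            Finset.image (fun j : Fin k =>
              v ⟨(i : ℕ) + (j : ℕ), by have h1 := i.isLt; have h2 := j.isLt; omega⟩)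
              Finset.univ)
          Finset.univ)

/-- The list `l` is a tight walk in the hypergraph `E`: any `k` consecutive entries form an edge. -/
def Tight {V : Type*} [DecidableEq V] (E : Finset (Finset V)) (k : ℕ) (l : List V) : Prop :=
  ∀ b, b <:+: l → b.length = k → b.toFinset ∈ E

/-- The vertices of `W` that extend the set `S` to an edge of `E`. -/
def linkIn {V : Type*} [DecidableEq V] (E : Finset (Finset V)) (W S : Finset V) : Finset V :=
  W.filter (fun v => insert v S ∈ E)

/-- Every `(k-1)`-subset of `Y` has at least a proportion `c` of `W` in its neighbourhood. -/
def CodegreeGE {V : Type*} [DecidableEq V] (E : Finset (Finset V)) (k : ℕ) (Y W : Finset V)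
    (c : ℝ) : Prop :=
  ∀ S ⊆ Y, S.card = k - 1 → c * (W.card : ℝ) ≤ ((linkIn E W S).card : ℝ)

section TightLists

variable {V : Type*} [DecidableEq V] {E : Finset (Finset V)} {k : ℕ}

lemma Tight.of_infix {l l' : List V} (h : Tight E k l) (hl : l' <:+: l) : Tight E k l' :=
  fun b hb hk => h b (hb.trans hl) hk

lemma tight_of_length_lt {l : List V} (h : l.length < k) : Tight E k l :=
  fun _ hb hk => absurd hb.length_le (by omega)

lemma Tight.glue {p q r : List V} (h₁ : Tight E k (p ++ q)) (h₂ : Tight E k (q ++ r))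
    (hq : k - 1 ≤ q.length) : Tight E k (p ++ q ++ r) := by
  rintro b ⟨a, c, habc⟩ hb
  by_cases h : p.length ≤ a.length
  · have hp : p <+: a := by
      refine List.prefix_of_prefix_length_le (l₃ := p ++ q ++ r) ⟨q ++ r, by simp⟩
        ⟨b ++ c, by rw [← habc]; simp⟩ h
    obtain ⟨a', rfl⟩ := hp
    refine h₂ b ⟨a', c, ?_⟩ hb
    simpa [List.append_assoc] using habc
  · have hp : a ++ b <+: p ++ q := by
      refine List.prefix_of_prefix_length_le (l₃ := p ++ q ++ r) ⟨c, habc⟩ ⟨r, rfl⟩ ?_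
      simp only [List.length_append]; omega
    exact h₁ b (List.IsInfix.trans ⟨a, [], by simp⟩ hp.isInfix) hb

lemma tight_map_range {f : ℕ → V} {M : ℕ}
    (h : ∀ i, i + k ≤ M → (Finset.range k).image (fun j => f (i + j)) ∈ E) :
    Tight E k ((List.range M).map f) := by
  rintro b ⟨a, c, habc⟩ hb
  have hlen := congrArg List.length habc
  simp only [List.length_append, List.length_map, List.length_range] at hlen
  have hbe : b = (List.range k).map (fun j => f (a.length + j)) := by
    apply List.ext_getElem
    · simp [hb]
    · intro i h1 h2
      have h3 : (a ++ b ++ c)[a.length + i]'(by simp; omega) = b[i] := by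
        rw [List.getElem_append_left (by simp; omega), List.getElem_append_right (by omega)]
        simp
      rw [← h3]
      simp [habc]
  have := h a.length (by omega)
  convert this using 1
  rw [hbe]
  ext x
  simp

/-- A sequence of rows of length `k` read one after the other is tight as soon as every hybrid of
two consecutive rows is an edge. -/
lemma tight_rows (hk : 0 < k) {R : ℕ → ℕ → V} {M : ℕ}
    (h : ∀ ρ j, j < k → ρ * k + j + k ≤ M →
      (Finset.range k).image (fun b => if b < j then R (ρ + 1) b else R ρ b) ∈ E) :
    Tight E k ((List.range M).map (fun n => R (n / k) (n % k))) := by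
  apply tight_map_range
  intro i hi
  have hj := Nat.mod_lt i hk
  have hdm := Nat.div_add_mod' i k
  have := h (i / k) (i % k) hj (by omega)
  convert this using 1
  generalize i / k = ρ at *
  generalize i % k = j at *
  subst hdm
  ext x
  simp only [Finset.mem_image, Finset.mem_range]
  constructor
  · rintro ⟨a, ha, rfl⟩
    by_cases hc : j + a < k
    · refine ⟨j + a, hc, ?_⟩
      have h1 : (ρ * k + j + a) / k = ρ := by
        rw [show ρ * k + j + a = j + a + k * ρ by ring, Nat.add_mul_div_left _ _ hk,
          Nat.div_eq_of_lt hc]; simp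
      have h2 : (ρ * k + j + a) % k = j + a := by
        rw [show ρ * k + j + a = j + a + k * ρ by ring, Nat.add_mul_mod_self_left,
          Nat.mod_eq_of_lt hc]
      rw [h1, h2, if_neg (by omega)]
    · obtain ⟨b, rfl⟩ : ∃ b, a = k - j + b := ⟨a - (k - j), by omega⟩
      refine ⟨b, by omega, ?_⟩
      have h0 : ρ * k + j + (k - j + b) = b + k * (ρ + 1) := by
        have : j + (k - j) = k := by omega
        calc ρ * k + j + (k - j + b) = ρ * k + (j + (k - j)) + b := by ring
          _ = _ := by rw [this]; ring
      have hb : b < k := by omega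
      rw [h0, Nat.add_mul_div_left _ _ hk, Nat.div_eq_of_lt hb, Nat.add_mul_mod_self_left,
          Nat.mod_eq_of_lt hb, if_pos (by omega)]
      simp
  · rintro ⟨b, hb, rfl⟩
    by_cases hc : b < j
    · refine ⟨k - j + b, by omega, ?_⟩
      have h0 : ρ * k + j + (k - j + b) = b + k * (ρ + 1) := by
        have : j + (k - j) = k := by omega
        calc ρ * k + j + (k - j + b) = ρ * k + (j + (k - j)) + b := by ring
          _ = _ := by rw [this]; ring
      rw [h0, Nat.add_mul_div_left _ _ hk, Nat.div_eq_of_lt hb, Nat.add_mul_mod_self_left,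
          Nat.mod_eq_of_lt hb, if_pos hc]
      simp
    · refine ⟨b - j, by omega, ?_⟩
      have h0 : ρ * k + j + (b - j) = b + k * ρ := by
        have : j + (b - j) = b := by omega
        calc ρ * k + j + (b - j) = ρ * k + (j + (b - j)) := by ring
          _ = _ := by rw [this]; ring
      rw [h0, Nat.add_mul_div_left _ _ hk, Nat.div_eq_of_lt hb, Nat.add_mul_mod_self_left,
          Nat.mod_eq_of_lt hb, if_neg hc]
      simp

end TightLists

section Boxes

/-- A dense bipartite relation contains a dense complete bipartite one, with a large part `I` on
the bounded side `P`. -/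
lemma exists_common_subset {α β : Type*} [DecidableEq β] (Y : Finset α) (P : Finset β)
    (r : β → α → Prop) {a b K : ℝ} (ha : 0 ≤ a) (hb : 0 < b) (hK : 0 < K) (hY : (Y.card : ℝ) ≤ K)
    (hP : 0 < P.card)
    (h : (a + b) * P.card * K ≤ ∑ y ∈ Y, ((P.filter (fun p => r p y)).card : ℝ)) :
    ∃ I ⊆ P, a * P.card ≤ I.card ∧
      b * K / 2 ^ P.card ≤ ((Y.filter (fun y => ∀ p ∈ I, r p y)).card : ℝ) := by
  set F : α → Finset β := fun y => P.filter (fun p => r p y) with hF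
  set Big := Y.filter (fun y => a * P.card ≤ (F y).card) with hBig
  have hP' : (0 : ℝ) < P.card := by exact_mod_cast hP
  have hle : ∀ y ∈ Y, ((F y).card : ℝ) ≤
      (if a * P.card ≤ (F y).card then (P.card : ℝ) else 0) + a * P.card := by
    intro y _
    split_ifs with hc
    · have : ((F y).card : ℝ) ≤ P.card := by
        exact_mod_cast Finset.card_le_card (Finset.filter_subset _ _)
      nlinarith [mul_nonneg ha hP'.le]
    · push Not at hc; linarith
  have hsum := h.trans (Finset.sum_le_sum hle)
  rw [Finset.sum_add_distrib, ← Finset.sum_filter, Finset.sum_const, Finset.sum_const,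
    nsmul_eq_mul, nsmul_eq_mul] at hsum
  have hbig : b * K ≤ Big.card := by
    have h1 : (Y.card : ℝ) * (a * P.card) ≤ K * (a * P.card) :=
      mul_le_mul_of_nonneg_right hY (by positivity)
    have h2 : (b * K) * P.card ≤ Big.card * P.card := by nlinarith
    exact le_of_mul_le_mul_right h2 hP'
  have hne : Big.Nonempty := by
    rw [← Finset.card_pos]
    have : (0 : ℝ) < Big.card := lt_of_lt_of_le (by positivity) hbig
    exact_mod_cast this
  have hcard : ((Big.image F).card : ℝ) ≤ 2 ^ P.card := by
    have : (Big.image F).card ≤ P.powerset.card := by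
      apply Finset.card_le_card
      intro x hx
      obtain ⟨y, _, rfl⟩ := Finset.mem_image.1 hx
      exact Finset.mem_powerset.2 (Finset.filter_subset _ _)
    rw [Finset.card_powerset] at this
    exact_mod_cast this
  obtain ⟨I, hI, hfib⟩ := Finset.exists_le_card_fiber_of_nsmul_le_card_of_maps_to
    (s := Big) (t := Big.image F) (f := F) (b := b * K / 2 ^ P.card)
    (fun y hy => Finset.mem_image_of_mem _ hy) (hne.image _) (by
      rw [nsmul_eq_mul]
      calc ((Big.image F).card : ℝ) * (b * K / 2 ^ P.card)
          ≤ 2 ^ P.card * (b * K / 2 ^ P.card) := by gcongr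
        _ = b * K := by field_simp
        _ ≤ _ := hbig)
  obtain ⟨y, hy, rfl⟩ := Finset.mem_image.1 hI
  refine ⟨F y, Finset.filter_subset _ _, (Finset.mem_filter.1 hy).2, hfib.trans ?_⟩
  norm_cast
  apply Finset.card_le_card
  intro z hz
  obtain ⟨hz1, hz2⟩ := Finset.mem_filter.1 hz
  refine Finset.mem_filter.2 ⟨(Finset.mem_filter.1 hz1).1, fun p hp => ?_⟩
  rw [← hz2] at hp
  exact (Finset.mem_filter.1 hp).2

lemma card_lists_le {V : Type*} [DecidableEq V] (U : Finset V) (r : ℕ) (R : Finset (List V))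
    (hR : ∀ l ∈ R, l.length = r ∧ ∀ a ∈ l, a ∈ U) : R.card ≤ U.card ^ r := by
  induction r generalizing R with
  | zero =>
    have : R ⊆ {[]} := by
      intro l hl
      simpa using (hR l hl).1
    simpa using Finset.card_le_card this
  | succ r ih =>
    have hsub : R ⊆ (U ×ˢ (R.image List.tail)).image (fun p => p.1 :: p.2) := by
      intro l hl
      obtain ⟨h1, h2⟩ := hR l hl
      match l, h1 with
      | a :: t, _ =>
        exact Finset.mem_image.2 ⟨(a, t), Finset.mem_product.2 ⟨h2 a (by simp),
          Finset.mem_image.2 ⟨_, hl, rfl⟩⟩, rfl⟩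
    have h3 := ih (R.image List.tail) (by
      intro t ht
      obtain ⟨l, hl, rfl⟩ := Finset.mem_image.1 ht
      obtain ⟨h1, h2⟩ := hR l hl
      exact ⟨by simp [h1], fun a ha => h2 a (List.mem_of_mem_tail ha)⟩)
    calc R.card ≤ _ := Finset.card_le_card hsub
      _ ≤ _ := Finset.card_image_le
      _ = U.card * (R.image List.tail).card := Finset.card_product _ _
      _ ≤ U.card * U.card ^ r := by gcongr
      _ = _ := by ring

/-- Erdős: a dense `r`-ary relation on a large set contains a complete `r`-partite relation
with parts of size `t`. -/
lemma exists_box (r t : ℕ) : ∀ d : ℝ, 0 < d → ∃ n₀ : ℕ, ∀ {V : Type} [DecidableEq V]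
    (U : Finset V) (R : Finset (List V)), n₀ ≤ U.card →
    (∀ l ∈ R, l.length = r ∧ ∀ a ∈ l, a ∈ U) → d * (U.card : ℝ) ^ r ≤ R.card →
    ∃ T : ℕ → ℕ → V, (∀ j < r, Set.InjOn (T j) (Set.Iio t)) ∧
      ∀ g : ℕ → ℕ, (∀ j, g j < t) → (List.range r).map (fun j => T j (g j)) ∈ R := by
  induction r with
  | zero =>
    intro d hd
    refine ⟨1, fun {V} _ U R hU hR hc => ?_⟩
    obtain ⟨u, hu⟩ := Finset.card_pos.1 (show 0 < U.card by omega)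
    have hpos : 0 < R.card := by
      have : (0 : ℝ) < R.card := lt_of_lt_of_le (by simpa using hd) hc
      exact_mod_cast this
    obtain ⟨l, hl⟩ := Finset.card_pos.1 hpos
    have := List.length_eq_zero_iff.1 (hR l hl).1
    subst this
    exact ⟨fun _ _ => u, by simp, by simpa using fun _ _ => hl⟩
  | succ r ih =>
    intro d hd
    set M : ℕ := ⌈4 * (t + 1) / d⌉₊ with hM
    have hM0 : 0 < M := Nat.ceil_pos.2 (by positivity)
    obtain ⟨n₀, hn₀⟩ := ih (d / 4 / 2 ^ M) (by positivity)
    refine ⟨max (n₀ + 1) ⌈2 * M / d⌉₊, fun {V} _ U R hU hR hc => ?_⟩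
    have hU0 : n₀ + 1 ≤ U.card := (le_max_left _ _).trans hU
    have hUpos : (0 : ℝ) < U.card := by
      have : 0 < U.card := by omega
      exact_mod_cast this
    have hUM : 2 * M / d ≤ U.card :=
      (Nat.le_ceil _).trans (by exact_mod_cast (le_max_right _ _).trans hU)
    set Y := R.image List.tail with hY
    have hYl : ∀ l ∈ Y, l.length = r ∧ ∀ a ∈ l, a ∈ U := by
      intro l hl
      obtain ⟨l', hl', rfl⟩ := Finset.mem_image.1 hl
      obtain ⟨h1, h2⟩ := hR l' hl'
      exact ⟨by simp [h1], fun a ha => h2 a (List.mem_of_mem_tail ha)⟩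
    have hYc : (Y.card : ℝ) ≤ (U.card : ℝ) ^ r := by exact_mod_cast card_lists_le U r Y hYl
    set deg : V → ℕ := fun u => (Y.filter (fun y => u :: y ∈ R)).card with hdeg
    have hRsum : R.card ≤ ∑ u ∈ U, deg u := by
      have : R ⊆ U.biUnion (fun u => (Y.filter (fun y => u :: y ∈ R)).image (u :: ·)) := by
        intro l hl
        obtain ⟨h1, h2⟩ := hR l hl
        match l, h1 with
        | a :: s, _ =>
          refine Finset.mem_biUnion.2 ⟨a, h2 a (by simp), Finset.mem_image.2 ⟨s, ?_, rfl⟩⟩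
          exact Finset.mem_filter.2 ⟨Finset.mem_image.2 ⟨_, hl, rfl⟩, hl⟩
      refine (Finset.card_le_card this).trans (Finset.card_biUnion_le.trans ?_)
      exact Finset.sum_le_sum fun u _ => Finset.card_image_le
    set D : ℝ := d / 2 * (U.card : ℝ) ^ r with hD
    set H := U.filter (fun u => D ≤ deg u) with hH
    have hHc : (M : ℝ) ≤ H.card := by
      have h1 : (R.card : ℝ) ≤ ∑ u ∈ U, ((if D ≤ deg u then (U.card : ℝ) ^ r else 0) + D) := by
        refine le_trans (b := ((∑ u ∈ U, deg u : ℕ) : ℝ)) (by exact_mod_cast hRsum) ?_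
        push_cast
        refine Finset.sum_le_sum fun u _ => ?_
        split_ifs with hcu
        · have : (deg u : ℝ) ≤ Y.card := by
            exact_mod_cast Finset.card_le_card (Finset.filter_subset _ _)
          have : 0 ≤ D := by positivity
          linarith
        · push Not at hcu; linarith
      rw [Finset.sum_add_distrib, ← Finset.sum_filter, Finset.sum_const, Finset.sum_const,
        nsmul_eq_mul, nsmul_eq_mul] at h1
      have hpow : (0 : ℝ) < (U.card : ℝ) ^ r := by positivity
      have h2 : (d / 2 * U.card) * (U.card : ℝ) ^ r ≤ H.card * (U.card : ℝ) ^ r := by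
        have h3 := hc.trans h1
        rw [pow_succ] at h3
        nlinarith
      have h4 := le_of_mul_le_mul_right h2 hpow
      have h5 : (M : ℝ) ≤ d / 2 * U.card := by
        rw [div_le_iff₀ hd] at hUM; linarith
      linarith
    obtain ⟨P, hPH, hPc⟩ := Finset.exists_subset_card_eq (show M ≤ H.card by exact_mod_cast hHc)
    obtain ⟨I, hIP, hIc, hIY⟩ := exists_common_subset Y P (fun u y => u :: y ∈ R)
      (a := d / 4) (b := d / 4) (K := (U.card : ℝ) ^ r) (by positivity) (by positivity)
      (by positivity) hYc (by omega) (by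
        have h1 : ∑ y ∈ Y, ((P.filter (fun p => p :: y ∈ R)).card : ℝ) = ∑ u ∈ P, (deg u : ℝ) := by
          have := Finset.sum_card_bipartiteAbove_eq_sum_card_bipartiteBelow
            (s := P) (t := Y) (fun u y => u :: y ∈ R)
          simp only [Finset.bipartiteAbove, Finset.bipartiteBelow] at this
          exact_mod_cast this.symm
        refine le_trans ?_ (le_of_eq (h1.symm.trans ?_))
        swap
        · exact Finset.sum_congr rfl fun _ _ => by congr!
        have h2 : ∑ u ∈ P, D ≤ ∑ u ∈ P, (deg u : ℝ) :=
          Finset.sum_le_sum fun u hu => (Finset.mem_filter.1 (hPH hu)).2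
        rw [Finset.sum_const, nsmul_eq_mul] at h2
        refine le_trans (le_of_eq ?_) h2
        rw [hD]; ring)
    rw [hPc] at hIc hIY
    have htI : t ≤ I.card := by
      have h1 : 4 * (t + 1) / d ≤ M := Nat.le_ceil _
      rw [div_le_iff₀ hd] at h1
      have : (t : ℝ) ≤ I.card := by nlinarith
      exact_mod_cast this
    obtain ⟨T, hT1, hT2⟩ := hn₀ U (Y.filter (fun y => ∀ p ∈ I, p :: y ∈ R)) (by omega)
      (fun l hl => hYl l (Finset.mem_filter.1 hl).1) (by
        calc d / 4 / 2 ^ M * (U.card : ℝ) ^ r = d / 4 * (U.card : ℝ) ^ r / 2 ^ M := by ring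
          _ ≤ _ := by convert hIY)
    obtain ⟨u₀, _⟩ := Finset.card_pos.1 (show 0 < U.card by omega)
    refine ⟨fun j => j.casesOn (fun i => I.toList.getD i u₀) T, ?_, ?_⟩
    · rintro (_ | j) hj
      · intro a ha b hb hab
        have ha' : a < I.toList.length := by simpa using lt_of_lt_of_le ha htI
        have hb' : b < I.toList.length := by simpa using lt_of_lt_of_le hb htI
        replace hab : I.toList.getD a u₀ = I.toList.getD b u₀ := hab
        rw [List.getD_eq_getElem _ _ ha', List.getD_eq_getElem _ _ hb'] at hab
        exact (List.Nodup.getElem_inj_iff I.nodup_toList).1 hab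
      · exact hT1 j (by omega)
    · intro g hg
      rw [List.range_succ_eq_map, List.map_cons, List.map_map]
      have h1 := hT2 (fun j => g (j + 1)) (fun j => hg _)
      have h2 := (Finset.mem_filter.1 h1).2 (I.toList.getD (g 0) u₀) (by
        have : g 0 < I.toList.length := by simpa using lt_of_lt_of_le (hg 0) htI
        rw [List.getD_eq_getElem _ _ this]
        exact Finset.mem_toList.1 (List.getElem_mem this))
      exact h2

end Boxes

section SequentialChoice

/-- If every valid list of length less than `r` has at least `D` valid one-step extensions, there
are at least `D ^ r` valid lists of length `r`. -/
lemma exists_many_lists {V : Type*} [DecidableEq V] (U : Finset V) (P : List V → Prop) {D : ℝ}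
    (hD : 0 ≤ D) (r : ℕ) (h0 : P [])
    (hstep : ∀ c, P c → (∀ a ∈ c, a ∈ U) → c.length < r →
      ∃ X ⊆ U, D ≤ X.card ∧ ∀ b ∈ X, P (c ++ [b])) :
    ∃ R : Finset (List V), (∀ l ∈ R, P l ∧ l.length = r ∧ ∀ a ∈ l, a ∈ U) ∧ D ^ r ≤ R.card := by
  induction r with
  | zero => exact ⟨{[]}, by simpa using h0, by simp⟩
  | succ r ih =>
    obtain ⟨R, hR, hRc⟩ := ih fun c h1 h2 h3 => hstep c h1 h2 (by omega)
    have hX : ∀ c ∈ R, ∃ X ⊆ U, D ≤ X.card ∧ ∀ b ∈ X, P (c ++ [b]) := fun c hc =>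
      hstep c (hR c hc).1 (hR c hc).2.2 (by have := (hR c hc).2.1; omega)
    choose! X hXU hXD hXP using hX
    refine ⟨(R.sigma X).image (fun p => p.1 ++ [p.2]), ?_, ?_⟩
    · intro l hl
      obtain ⟨⟨c, b⟩, hcb, rfl⟩ := Finset.mem_image.1 hl
      obtain ⟨hc, hb⟩ := Finset.mem_sigma.1 hcb
      refine ⟨hXP c hc b hb, by simp [(hR c hc).2.1], fun a ha => ?_⟩
      rcases List.mem_append.1 ha with ha | ha
      · exact (hR c hc).2.2 a ha
      · rw [List.mem_singleton.1 ha]; exact hXU c hc hb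
    · rw [Finset.card_image_of_injOn, Finset.card_sigma]
      · push_cast
        calc D ^ (r + 1) = D ^ r * D := pow_succ _ _
          _ ≤ R.card * D := by gcongr
          _ = ∑ c ∈ R, D := by simp
          _ ≤ _ := Finset.sum_le_sum hXD
      · rintro ⟨c, b⟩ _ ⟨c', b'⟩ _ h
        have := List.append_inj' h rfl
        simp only [List.cons.injEq, and_true] at this
        obtain ⟨rfl, rfl⟩ := this
        rfl

end SequentialChoice

section PathCover

variable {V : Type*} [DecidableEq V] {E : Finset (Finset V)} {k : ℕ}

/-- A complete `k`-partite subhypergraph contains tight paths running through its parts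
periodically. -/
lemma exists_tight_of_box (hE : ∀ e ∈ E, e.card = k) (hk : 0 < k) {T : ℕ → ℕ → V} {t M : ℕ}
    (hinj : ∀ j < k, Set.InjOn (T j) (Set.Iio t))
    (hT : ∀ g : ℕ → ℕ, (∀ j, g j < t) → (Finset.range k).image (fun j => T j (g j)) ∈ E)
    (hM : M ≤ k * t) :
    ∃ l : List V, l.length = M ∧ l.Nodup ∧ Tight E k l ∧ ∀ v ∈ l, ∃ j < k, ∃ a < t, v = T j a := by
  have hlt : ∀ n < M, n / k < t := fun n hn => by
    rw [Nat.div_lt_iff_lt_mul hk, mul_comm]; omega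
  refine ⟨(List.range M).map (fun n => T (n % k) (n / k)), by simp, ?_, ?_, ?_⟩
  · refine List.Nodup.map_on ?_ List.nodup_range
    intro x hx y hy hxy
    have hx := hlt x (List.mem_range.1 hx)
    have hy := hlt y (List.mem_range.1 hy)
    have hxk := Nat.mod_lt x hk
    have hyk := Nat.mod_lt y hk
    have hmod : x % k = y % k := by
      by_contra hne
      set g : ℕ → ℕ := fun j => if j = x % k then x / k else y / k with hg
      have h1 := hT g (fun j => by simp only [hg]; split_ifs <;> assumption)
      have h2 := hE _ h1
      have h3 : Set.InjOn (fun j => T j (g j)) (Finset.range k) := by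
        rw [← Finset.card_image_iff, h2, Finset.card_range]
      refine hne (h3 (by simpa using hxk) (by simpa using hyk) ?_)
      simp only [hg, if_neg (Ne.symm hne)]
      simpa using hxy
    have hdiv : x / k = y / k := hinj _ hxk hx hy (by simpa [hmod] using hxy)
    rw [← Nat.div_add_mod x k, ← Nat.div_add_mod y k, hmod, hdiv]
  · refine tight_rows (R := fun ρ j => T j ρ) hk ?_
    intro ρ j hj hle
    have h1 : ρ < t := by
      by_contra hcon
      have : k * t ≤ ρ * k := by rw [mul_comm]; exact Nat.mul_le_mul_right _ (by omega)
      omega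
    have h2 : 0 < j → ρ + 1 < t := by
      intro hj0
      by_contra hcon
      have : k * t ≤ (ρ + 1) * k := by rw [mul_comm]; exact Nat.mul_le_mul_right _ (by omega)
      rw [add_mul] at this
      omega
    have := hT (fun b => if b < j then ρ + 1 else ρ) (fun b => by
      split_ifs with h
      · exact h2 (by omega)
      · exact h1)
    convert this using 2
    ext b
    split_ifs <;> rfl
  · intro v hv
    obtain ⟨n, hn, rfl⟩ := List.mem_map.1 hv
    exact ⟨_, Nat.mod_lt n hk, _, hlt n (List.mem_range.1 hn), rfl⟩

/-- `L` is a family of vertex-disjoint tight paths in `A`, each with at least `q` and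
fewer than `2 * q` vertices. -/
def IsPathFamily (E : Finset (Finset V)) (k q : ℕ) (A : Finset V) (L : List (List V)) : Prop :=
  L.flatten.Nodup ∧ (∀ v ∈ L.flatten, v ∈ A) ∧ ∀ P ∈ L, Tight E k P ∧ q ≤ P.length ∧ P.length < 2 * q

lemma IsPathFamily.cons {q : ℕ} {A : Finset V} {L : List (List V)} (h : IsPathFamily E k q A L)
    (hq : 0 < q) {l : List V} (hl : Tight E k l) (hnd : (l ++ L.flatten).Nodup)
    (hlA : ∀ v ∈ l, v ∈ A) (hlq : q ≤ l.length) (hlq' : l.length ≤ 2 * q) :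
    ∃ L', IsPathFamily E k q A L' ∧ L'.flatten = l ++ L.flatten := by
  have hmem : ∀ v ∈ l ++ L.flatten, v ∈ A := fun v hv =>
    (List.mem_append.1 hv).elim (hlA v) (h.2.1 v)
  rcases hlq'.lt_or_eq with hlt | heq
  · refine ⟨l :: L, ⟨by simpa using hnd, by simpa using hmem, ?_⟩, by simp⟩
    intro P hP
    rcases List.mem_cons.1 hP with rfl | hP
    · exact ⟨hl, hlq, hlt⟩
    · exact h.2.2 P hP
  · have hf : (l.take q :: l.drop q :: L).flatten = l ++ L.flatten := by
      simp [← List.append_assoc]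
    refine ⟨l.take q :: l.drop q :: L, ⟨by rwa [hf], by rwa [hf], ?_⟩, hf⟩
    intro P hP
    rcases List.mem_cons.1 hP with rfl | hP
    · exact ⟨hl.of_infix (List.take_prefix _ _).isInfix, by simp; omega, by simp; omega⟩
    rcases List.mem_cons.1 hP with rfl | hP
    · exact ⟨hl.of_infix (List.drop_suffix _ _).isInfix, by simp; omega, by simp; omega⟩
    · exact h.2.2 P hP

lemma linkIn_card_union_le (A B S : Finset V) :
    (linkIn E (A ∪ B) S).card ≤ (linkIn E A S).card + (linkIn E B S).card := by
  rw [linkIn, Finset.filter_union]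
  exact Finset.card_union_le _ _

lemma sum_linkIn_flatten_le (Y : Finset (List V)) {c : ℝ} (L : List (List V))
    (h : ∀ P ∈ L, ∑ S ∈ Y, ((linkIn E P.toFinset S.toFinset).card : ℝ) ≤ c * P.length) :
    ∑ S ∈ Y, ((linkIn E L.flatten.toFinset S.toFinset).card : ℝ) ≤ c * L.flatten.length := by
  induction L with
  | nil => simp [linkIn]
  | cons P L ih =>
    have h1 := ih fun Q hQ => h Q (by simp [hQ])
    have h2 := h P (by simp)
    rw [List.flatten_cons, List.toFinset_append, List.length_append]
    push_cast
    calc _ ≤ ∑ S ∈ Y, (((linkIn E P.toFinset S.toFinset).card : ℝ) +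
          (linkIn E L.flatten.toFinset S.toFinset).card) :=
          Finset.sum_le_sum fun S _ => by exact_mod_cast linkIn_card_union_le _ _ _
      _ ≤ _ := by rw [Finset.sum_add_distrib]; linarith

end PathCover

section CoverLemma

variable {V : Type} [DecidableEq V] {E : Finset (Finset V)} {k : ℕ}

lemma exists_many_nodup_lists (U : Finset V) (r : ℕ) (hU : 2 * r ≤ U.card) :
    ∃ Y : Finset (List V), (∀ l ∈ Y, l.Nodup ∧ l.length = r ∧ ∀ a ∈ l, a ∈ U) ∧
      ((U.card : ℝ) / 2) ^ r ≤ Y.card := by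
  refine exists_many_lists U List.Nodup (by positivity) r List.nodup_nil ?_
  intro c hc _ hlen
  refine ⟨U \ c.toFinset, Finset.sdiff_subset, ?_, ?_⟩
  · have h1 := Finset.le_card_sdiff c.toFinset U
    have h2 := c.toFinset_card_le
    rw [div_le_iff₀ (by norm_num)]
    norm_cast
    omega
  · intro b hb
    rw [← List.concat_eq_append, List.nodup_concat]
    exact ⟨by simpa using (Finset.mem_sdiff.1 hb).2, hc⟩

/-- A path family leaving many vertices uncovered can be enlarged, provided many edges lie inside
the uncovered set. -/
lemma exists_tight_of_many_edges (k q : ℕ) (hk : 0 < k) {d : ℝ} (hd : 0 < d) :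
    ∃ n₀ : ℕ, ∀ {V : Type} [DecidableEq V] (E : Finset (Finset V)), (∀ e ∈ E, e.card = k) →
      ∀ (U : Finset V) (R : Finset (List V)), n₀ ≤ U.card →
      (∀ l ∈ R, l.toFinset ∈ E ∧ l.length = k ∧ ∀ a ∈ l, a ∈ U) →
      d * (U.card : ℝ) ^ k ≤ R.card →
      ∃ l : List V, l.length = q ∧ l.Nodup ∧ Tight E k l ∧ ∀ v ∈ l, v ∈ U := by
  obtain ⟨n₀, hn₀⟩ := exists_box k q d hd
  refine ⟨n₀, fun {V} _ E hE U R hU hR hRc => ?_⟩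
  obtain ⟨T, hinj, hT⟩ := hn₀ U R hU (fun l hl => (hR l hl).2) hRc
  obtain ⟨l, h1, h2, h3, h4⟩ := exists_tight_of_box (E := E) hE hk hinj (fun g hg => by
    have := (hR _ (hT g hg)).1
    convert this using 1
    ext; simp) (M := q) (Nat.le_mul_of_pos_left _ hk)
  refine ⟨l, h1, h2, h3, fun v hv => ?_⟩
  obtain ⟨j, hj, a, ha, rfl⟩ := h4 v hv
  exact (hR _ (hT (fun _ => a) fun _ => ha)).2.2 _ (List.mem_map.2 ⟨j, List.mem_range.2 hj, rfl⟩)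

/-- If many `(k-1)`-lists over `U` extend to edges by every vertex of `I`, there is a tight path
in `U ∪ I` that uses the vertices of `I` once in every `k` steps. -/
lemma exists_tight_of_common_link (k t : ℕ) (hk : 0 < k) {d : ℝ} (hd : 0 < d) :
    ∃ n₀ : ℕ, ∀ {V : Type} [DecidableEq V] (E : Finset (Finset V)), (∀ e ∈ E, e.card = k) →
      ∀ (U I : Finset V) (R : Finset (List V)), n₀ ≤ U.card → I.card ≤ t →
      (∀ l ∈ R, (∀ p ∈ I, insert p l.toFinset ∈ E) ∧ l.length = k - 1 ∧ ∀ a ∈ l, a ∈ U) →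
      d * (U.card : ℝ) ^ (k - 1) ≤ R.card →
      ∀ M, M ≤ k * I.card →
      ∃ l : List V, l.length = M ∧ l.Nodup ∧ Tight E k l ∧ ∀ v ∈ l, v ∈ U ∨ v ∈ I := by
  obtain ⟨n₀, hn₀⟩ := exists_box (k - 1) t d hd
  refine ⟨n₀, fun {V} _ E hE U I R hU hIt hR hRc M hM => ?_⟩
  obtain ⟨T, hinj, hT⟩ := hn₀ U R hU (fun l hl => (hR l hl).2) hRc
  rcases Nat.eq_zero_or_pos I.card with hI0 | hI0
  · exact ⟨[], by simp; rw [hI0] at hM; omega, List.nodup_nil, tight_of_length_lt (by simpa),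
      by simp⟩
  have hne : I.Nonempty := Finset.card_pos.1 hI0
  obtain ⟨p₀, hp₀⟩ := hne
  set f : ℕ → V := fun a => I.toList.getD a p₀ with hf
  have hfget : ∀ a, (ha : a < I.card) → f a = I.toList[a]'(by simpa using ha) := fun a ha => by
    exact List.getD_eq_getElem _ _ (by simpa using ha)
  have hfI : ∀ a < I.card, f a ∈ I := fun a ha => by
    rw [hfget a ha, ← Finset.mem_toList]; exact List.getElem_mem _
  have hTU : ∀ j < k - 1, ∀ a < I.card, T j a ∈ U := fun j hj a ha =>
    (hR _ (hT (fun _ => a) fun _ => by omega)).2.2 _ (List.mem_map.2 ⟨j, List.mem_range.2 hj, rfl⟩)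
  have hex := exists_tight_of_box (E := E) (t := I.card)
    (T := fun j => if j < k - 1 then T j else f) hE hk ?_ ?_ hM
  · obtain ⟨l, h1, h2, h3, h4⟩ := hex
    refine ⟨l, h1, h2, h3, fun v hv => ?_⟩
    obtain ⟨j, hj, a, ha, rfl⟩ := h4 v hv
    split_ifs with h
    · exact Or.inl (hTU j h a ha)
    · exact Or.inr (hfI a ha)
  · intro j hj
    split_ifs with h
    · exact (hinj j h).mono (Set.Iio_subset_Iio hIt)
    · intro a ha b hb hab
      rw [hfget a ha, hfget b hb] at hab
      exact (I.nodup_toList.getElem_inj_iff).1 hab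
  · intro g hg
    have := (hR _ (hT g fun j => (hg j).trans_le hIt)).1 (f (g (k - 1))) (hfI _ (hg _))
    convert this using 1
    ext v
    simp only [Finset.mem_image, Finset.mem_range, Finset.mem_insert, List.mem_toFinset,
      List.mem_map, List.mem_range]
    constructor
    · rintro ⟨j, hj, rfl⟩
      by_cases h : j < k - 1
      · exact Or.inr ⟨j, h, by simp [h]⟩
      · obtain rfl : j = k - 1 := by omega
        simp
    · rintro (rfl | ⟨j, hj, rfl⟩)
      · exact ⟨k - 1, by omega, by simp⟩
      · exact ⟨j, by omega, by simp [hj]⟩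

/-- Almost all vertices can be covered by vertex-disjoint tight paths of bounded length. -/
lemma exists_path_cover (k q : ℕ) (hk : 2 ≤ k) (hq : 0 < q) {η δ : ℝ} (hη : 0 < η) (hδ : 0 < δ) :
    ∃ n₀ : ℕ, ∀ {V : Type} [DecidableEq V] (E : Finset (Finset V)), (∀ e ∈ E, e.card = k) →
      ∀ A : Finset V, n₀ ≤ A.card → CodegreeGE E k A A (1 / 2 + η) →
      ∃ L : List (List V), IsPathFamily E k q A L ∧
        (A.card : ℝ) - δ * A.card ≤ L.flatten.length := by
  obtain ⟨n₁, hn₁⟩ := exists_tight_of_many_edges k q (by omega) (d := η / 2 ^ k) (by positivity)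
  obtain ⟨n₂, hn₂⟩ := exists_tight_of_common_link k (2 * q) (by omega)
    (d := η / 4 / 2 ^ (2 * q) / 2 ^ (k - 1)) (by positivity)
  obtain ⟨n₃, hn₃⟩ := exists_nat_ge (((max (max n₁ n₂) (2 * k) : ℕ) : ℝ) / δ)
  refine ⟨n₃, fun {V} _ E hE A hA hdeg => ?_⟩
  have hbdd : ∀ L, IsPathFamily E k q A L → L.flatten.length ≤ A.card := fun L hL => by
    rw [← List.toFinset_card_of_nodup hL.1]
    exact Finset.card_le_card fun v hv => hL.2.1 v (by simpa using hv)
  obtain ⟨L, hL, hmax⟩ : ∃ L, IsPathFamily E k q A L ∧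
      ∀ L', IsPathFamily E k q A L' → L'.flatten.length ≤ L.flatten.length := by
    have hfin : (Set.range fun L : {L // IsPathFamily E k q A L} => L.1.flatten.length).Finite :=
      (Set.finite_Iic A.card).subset (by rintro _ ⟨L, rfl⟩; exact hbdd _ L.2)
    have hnon : (Set.range fun L : {L // IsPathFamily E k q A L} => L.1.flatten.length).Nonempty :=
      ⟨_, ⟨⟨[], by simp [IsPathFamily]⟩, rfl⟩⟩
    obtain ⟨_, ⟨⟨L, hL⟩, rfl⟩, hm⟩ := hfin.exists_maximal hnon
    refine ⟨L, hL, fun L' hL' => ?_⟩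
    by_contra hcon
    exact hcon (hm ⟨⟨L', hL'⟩, rfl⟩ (by dsimp only; omega))
  refine ⟨L, hL, ?_⟩
  by_contra hcon
  push Not at hcon
  set U := A \ L.flatten.toFinset with hUdef
  have hLA : L.flatten.toFinset ⊆ A := fun v hv => hL.2.1 v (by simpa using hv)
  have hUc : (U.card : ℝ) = A.card - L.flatten.length := by
    rw [hUdef, Finset.card_sdiff_of_subset hLA, List.toFinset_card_of_nodup hL.1,
      Nat.cast_sub (hbdd L hL)]
  have hUδ : δ * A.card < U.card := by rw [hUc]; linarith
  have hUn : max (max n₁ n₂) (2 * k) ≤ U.card := by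
    have h1 : ((max (max n₁ n₂) (2 * k) : ℕ) : ℝ) ≤ n₃ * δ := by rwa [div_le_iff₀ hδ] at hn₃
    have h2 : (n₃ : ℝ) ≤ A.card := by exact_mod_cast hA
    have : ((max (max n₁ n₂) (2 * k) : ℕ) : ℝ) ≤ U.card := by nlinarith
    exact_mod_cast this
  have hUL : ∀ v ∈ U, v ∉ L.flatten := fun v hv => by simpa using (Finset.mem_sdiff.1 hv).2
  have hUA : U ⊆ A := Finset.sdiff_subset
  obtain ⟨Y, hY, hYc⟩ := exists_many_nodup_lists U (k - 1) (by omega)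
  have hU0 : (0 : ℝ) < U.card := by
    have : 0 < U.card := by omega
    exact_mod_cast this
  have hA0 : (0 : ℝ) < A.card := hU0.trans_le (by exact_mod_cast Finset.card_le_card hUA)
  have hY0 : (0 : ℝ) < Y.card := lt_of_lt_of_le (by positivity) hYc
  rcases le_or_gt (η / 2 * A.card * Y.card)
    (∑ S ∈ Y, ((linkIn E U S.toFinset).card : ℝ)) with hcase | hcase
  · -- many edges inside `U`: add a new path
    have hex := hn₁ E hE U
      ((Y.sigma fun S => linkIn E U S.toFinset).image fun p => p.1 ++ [p.2]) (by omega) ?_ ?_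
    · obtain ⟨l, hlq, hlnd, hlt, hlU⟩ := hex
      obtain ⟨L', hL', hfl⟩ := hL.cons hq hlt (List.Nodup.append hlnd hL.1
        fun v hv hv' => hUL v (hlU v hv) hv') (fun v hv => hUA (hlU v hv)) hlq.ge (by omega)
      have := hmax L' hL'
      rw [hfl, List.length_append] at this
      omega
    · intro l hl
      obtain ⟨⟨S, v⟩, hSv, rfl⟩ := Finset.mem_image.1 hl
      obtain ⟨hS, hv⟩ := Finset.mem_sigma.1 hSv
      obtain ⟨hvU, hvE⟩ := Finset.mem_filter.1 hv
      refine ⟨?_, by simp [(hY S hS).2.1]; omega, ?_⟩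
      · convert hvE using 1
        ext; simp
      · intro a ha
        rcases List.mem_append.1 ha with ha | ha
        · exact (hY S hS).2.2 a ha
        · rw [List.mem_singleton.1 ha]; exact hvU
    · rw [Finset.card_image_of_injOn, Finset.card_sigma]
      · push_cast
        refine le_trans ?_ hcase
        have h1 : (U.card : ℝ) ≤ A.card := by exact_mod_cast Finset.card_le_card hUA
        calc η / 2 ^ k * (U.card : ℝ) ^ k = η / 2 * U.card * (U.card / 2) ^ (k - 1) := by
              obtain ⟨m, rfl⟩ : ∃ m, k = m + 1 := ⟨k - 1, by omega⟩
              simp only [Nat.add_sub_cancel, div_pow, pow_succ]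
              field_simp
          _ ≤ _ := by gcongr
      · rintro ⟨c, b⟩ _ ⟨c', b'⟩ _ h
        have := List.append_inj' h rfl
        simp only [List.cons.injEq, and_true] at this
        obtain ⟨rfl, rfl⟩ := this
        rfl
  · -- few edges inside `U`: replace some path by a longer one
    have hsum : (1 / 2 + η / 2) * Y.card * A.card <
        ∑ S ∈ Y, ((linkIn E L.flatten.toFinset S.toFinset).card : ℝ) := by
      have h1 : ∀ S ∈ Y, (1 / 2 + η) * (A.card : ℝ) ≤ (linkIn E U S.toFinset).card +
          (linkIn E L.flatten.toFinset S.toFinset).card := fun S hS => by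
        refine (hdeg S.toFinset (fun v hv => hUA ((hY S hS).2.2 v (by simpa using hv))) ?_).trans ?_
        · rw [List.toFinset_card_of_nodup (hY S hS).1, (hY S hS).2.1]
        · have := linkIn_card_union_le (E := E) U L.flatten.toFinset S.toFinset
          rw [hUdef, Finset.sdiff_union_of_subset hLA] at this
          exact_mod_cast this
      have h2 := Finset.sum_le_sum h1
      rw [Finset.sum_add_distrib, Finset.sum_const, nsmul_eq_mul] at h2
      nlinarith
    obtain ⟨P, hPL, hP⟩ : ∃ P ∈ L, (1 / 2 + η / 2) * Y.card * P.length <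
        ∑ S ∈ Y, ((linkIn E P.toFinset S.toFinset).card : ℝ) := by
      by_contra hno
      push Not at hno
      have h1 := sum_linkIn_flatten_le Y L hno
      have h2 : (1 / 2 + η / 2) * Y.card * L.flatten.length ≤ (1 / 2 + η / 2) * Y.card * A.card := by
        have : (L.flatten.length : ℝ) ≤ A.card := by exact_mod_cast hbdd L hL
        gcongr
      linarith
    obtain ⟨L₁, L₂, rfl⟩ := List.append_of_mem hPL
    have hperm : (L₁ ++ P :: L₂).flatten.Perm (P ++ (L₁ ++ L₂).flatten) := by
      simpa using List.perm_append_comm_assoc L₁.flatten P L₂.flatten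
    have hnd := hperm.nodup_iff.1 hL.1
    have hPnd : P.Nodup := (List.nodup_append.1 hnd).1
    have hdisj : ∀ v ∈ P, v ∉ (L₁ ++ L₂).flatten := fun v hv hv' =>
      (List.nodup_append.1 hnd).2.2 v hv v hv' rfl
    have hPc : P.toFinset.card = P.length := List.toFinset_card_of_nodup hPnd
    have hPq := (hL.2.2 P hPL).2
    have hL' : IsPathFamily E k q A (L₁ ++ L₂) := by
      refine ⟨(List.nodup_append.1 hnd).2.1, fun v hv => hL.2.1 v ?_, fun Q hQ => hL.2.2 Q ?_⟩
      · exact hperm.mem_iff.2 (List.mem_append_right _ hv)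
      · simp only [List.mem_append, List.mem_cons] at hQ ⊢; tauto
    obtain ⟨I, hIP, hIc, hIY⟩ := exists_common_subset Y P.toFinset
      (fun p S => insert p S.toFinset ∈ E) (a := 1 / 2 + η / 4) (b := η / 4) (K := Y.card)
      (by positivity) (by positivity) hY0 le_rfl (by omega) (by
        rw [hPc]
        refine le_trans (le_of_eq ?_) (hP.le.trans (le_of_eq ?_))
        · ring
        · simp only [linkIn]
          congr! 3
          ext v
          simp only [Finset.mem_filter])
    rw [hPc] at hIc hIY
    have hPI : P.length + 1 ≤ 2 * I.card := by
      have : (0 : ℝ) < P.length := by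
        have : 0 < P.length := by omega
        exact_mod_cast this
      have : (P.length : ℝ) < 2 * I.card := by nlinarith
      exact_mod_cast this
    have hIle : I.card ≤ P.length := hPc ▸ Finset.card_le_card hIP
    have hex := hn₂ E hE U I (Y.filter fun S => ∀ p ∈ I, insert p S.toFinset ∈ E) (by omega)
      (by omega) ?_ ?_ (P.length + 1) (hPI.trans (Nat.mul_le_mul_right _ hk))
    · obtain ⟨l, hll, hlnd, hlt, hlU⟩ := hex
      have hlP : ∀ v ∈ l, v ∈ U ∨ v ∈ P := fun v hv =>
        (hlU v hv).imp_right fun h => by simpa using hIP h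
      have hex := hL'.cons hq hlt (List.Nodup.append hlnd hL'.1 ?_) ?_ (by omega) (by omega)
      · obtain ⟨L'', hL'', hfl⟩ := hex
        have := hmax L'' hL''
        rw [hfl, hperm.length_eq, List.length_append, List.length_append] at this
        omega
      · intro v hv hv'
        rcases hlP v hv with h | h
        · exact hUL v h (hperm.mem_iff.2 (List.mem_append_right _ hv'))
        · exact hdisj v h hv'
      · intro v hv
        rcases hlP v hv with h | h
        · exact hUA h
        · exact hL.2.1 v (hperm.mem_iff.2 (List.mem_append_left _ h))
    · intro S hS
      obtain ⟨hS, hSI⟩ := Finset.mem_filter.1 hS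
      exact ⟨hSI, (hY S hS).2⟩
    · refine le_trans ?_ (hIY.trans (le_of_eq (by congr!)))
      calc η / 4 / 2 ^ (2 * q) / 2 ^ (k - 1) * (U.card : ℝ) ^ (k - 1)
          = η / 4 * (U.card / 2) ^ (k - 1) / 2 ^ (2 * q) := by rw [div_pow]; ring
        _ ≤ η / 4 * Y.card / 2 ^ (2 * q) := by gcongr
        _ ≤ η / 4 * Y.card / 2 ^ P.length := by
          gcongr
          · norm_num
          · omega

end CoverLemma

section Connection

/-- The vertex in row `ρ` and column `i` of the connecting walk from `u` to `y`. Between the first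
row `u` and the last row `y` the walk uses copies of the symbols `T (k + i)` and `T (k - 1 - i)`. -/
def connectingRow {V : Type*} (k : ℕ) (u y : ℕ → V) (T : ℕ → ℕ → V) : ℕ → ℕ → V
  | 0, i => u i
  | ρ + 1, i => if ρ = k + 1 then y i else if i < k - ρ then T (k + i) ρ else T (k - 1 - i) ρ

lemma tight_connectingRow {V : Type*} [DecidableEq V] {E : Finset (Finset V)} {k : ℕ} (hk : 0 < k)
    {u y : ℕ → V} {T : ℕ → ℕ → V}
    (hu : (Finset.range k).image u ∈ E)
    (hy : ∀ j < k, ∀ g : ℕ → ℕ, (∀ a, g a < k + 1) → (Finset.range k).image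
      (fun i => if i < j then y i else T (k - 1 - i) (g (k - 1 - i))) ∈ E)
    (hsu : ∀ j, 1 ≤ j → j ≤ k → ∀ g : ℕ → ℕ, (∀ a, g a < k + 1) → (Finset.range k).image
      (fun i => if i < j then T (k + i) (g (k + i)) else u i) ∈ E)
    (hsv : ∀ j, 1 ≤ j → j ≤ k → ∀ g : ℕ → ℕ, (∀ a, g a < k + 1) → (Finset.range k).image
      (fun i => if i < j then T (k + i) (g (k + i)) else T (k - 1 - i) (g (k - 1 - i))) ∈ E) :
    Tight E k ((List.range (k * (k + 2) + (k - 1))).map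
      fun n => connectingRow k u y T (n / k) (n % k)) := by
  refine tight_rows hk fun ρ j hj hle => ?_
  have hρ : ρ ≤ k + 1 := by
    by_contra hcon
    have : (k + 2) * k ≤ ρ * k := Nat.mul_le_mul_right _ (by omega)
    rw [mul_comm k (k + 2)] at hle
    omega
  rcases Nat.eq_zero_or_pos ρ with rfl | hρ0
  · rcases Nat.eq_zero_or_pos j with rfl | hj0
    · simpa [connectingRow] using hu
    · convert hsu j hj0 hj.le (fun _ => 0) (by omega) using 1
      refine Finset.image_congr fun i hi => ?_
      have hi : i < k := by simpa using hi
      simp [connectingRow, hi]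
  obtain ⟨ρ, rfl⟩ : ∃ ρ', ρ = ρ' + 1 := ⟨ρ - 1, by omega⟩
  rcases Nat.lt_or_ge ρ k with hρk | hρk
  · -- both rows consist of symbols
    have hrow : ∀ i < k, (if i < j then connectingRow k u y T (ρ + 1 + 1) i
        else connectingRow k u y T (ρ + 1) i) =
        if i < (if j < k - ρ then k - ρ else k - ρ - 1) then T (k + i) (if i < j then ρ + 1 else ρ)
        else T (k - 1 - i) (if i < j then ρ + 1 else ρ) := fun i hi => by
      simp only [connectingRow]
      split_ifs <;> first | rfl | omega
    set J := if j < k - ρ then k - ρ else k - ρ - 1 with hJ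
    have hJk : J ≤ k := by rw [hJ]; split_ifs <;> omega
    set g : ℕ → ℕ := fun a => if (if k ≤ a then a - k else k - 1 - a) < j then ρ + 1 else ρ with hg
    have hgk : ∀ a, g a < k + 1 := fun a => by simp only [hg]; split_ifs <;> omega
    rcases Nat.eq_zero_or_pos J with hJ0 | hJ0
    · convert hy 0 hk g hgk using 1
      refine Finset.image_congr fun i hi => ?_
      have hi : i < k := by simpa using hi
      rw [hrow i hi, if_neg (show ¬ i < J by omega)]
      simp only [hg, Nat.not_lt_zero, if_false]
      rw [if_neg (show ¬ k ≤ k - 1 - i by omega), show k - 1 - (k - 1 - i) = i by omega]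
    · convert hsv J hJ0 hJk g hgk using 1
      refine Finset.image_congr fun i hi => ?_
      have hi : i < k := by simpa using hi
      rw [hrow i hi]
      simp only [hg]
      rw [if_neg (show ¬ k ≤ k - 1 - i by omega), show k - 1 - (k - 1 - i) = i by omega,
        if_pos (show k ≤ k + i by omega), show k + i - k = i by omega]
  · obtain rfl : ρ = k := by omega
    convert hy j hj (fun _ => ρ) (by omega) using 1
    refine Finset.image_congr fun i hi => ?_
    simp [connectingRow]

lemma exists_connector_lists {V : Type} [DecidableEq V] {E : Finset (Finset V)} {k r : ℕ}
    {Y B : Finset V} {η : ℝ} (hη : 0 ≤ η) (hB : (r + 1 : ℝ) ≤ η * B.card)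
    (hdeg : CodegreeGE E k Y B (1 / 2 + η)) (w : V) (F₁ F₂ : List V → Finset V)
    (hF : ∀ p : List V, p.Nodup → w ∉ p → (∀ v ∈ p, v ∈ B) → p.length < r →
      (F₁ p ⊆ Y ∧ (F₁ p).card = k - 1) ∧ F₂ p ⊆ Y ∧ (F₂ p).card = k - 1) :
    ∃ R : Finset (List V), (∀ c ∈ R, (c.Nodup ∧ w ∉ c ∧ ∀ p b s, c = p ++ b :: s →
        insert b (F₁ p) ∈ E ∧ insert b (F₂ p) ∈ E) ∧ c.length = r ∧ ∀ v ∈ c, v ∈ B) ∧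
      (η * B.card) ^ r ≤ R.card := by
  refine exists_many_lists B (fun c => c.Nodup ∧ w ∉ c ∧ ∀ p b s, c = p ++ b :: s →
        insert b (F₁ p) ∈ E ∧ insert b (F₂ p) ∈ E) (by positivity) r (by simp) ?_
  rintro c ⟨hnd, hw, hc⟩ hcB hlen
  obtain ⟨⟨h1, h1'⟩, h2, h2'⟩ := hF c hnd hw hcB hlen
  refine ⟨(linkIn E B (F₁ c) ∩ linkIn E B (F₂ c)) \ insert w c.toFinset,
    fun v hv => ?_, ?_, fun b hb => ?_⟩
  · exact (Finset.mem_filter.1 (Finset.mem_inter.1 (Finset.mem_sdiff.1 hv).1).1).1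
  · have hd1 := hdeg _ h1 h1'
    have hd2 := hdeg _ h2 h2'
    have h3 := Finset.card_union_add_card_inter (linkIn E B (F₁ c)) (linkIn E B (F₂ c))
    have h4 : (linkIn E B (F₁ c) ∪ linkIn E B (F₂ c)).card ≤ B.card :=
      Finset.card_le_card (Finset.union_subset (Finset.filter_subset _ _) (Finset.filter_subset _ _))
    have h5 := Finset.le_card_sdiff (insert w c.toFinset) (linkIn E B (F₁ c) ∩ linkIn E B (F₂ c))
    have h6 := (Finset.card_insert_le w c.toFinset).trans
      (Nat.add_le_add_right c.toFinset_card_le 1)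
    have h7 : (linkIn E B (F₁ c)).card + (linkIn E B (F₂ c)).card ≤
      ((linkIn E B (F₁ c) ∩ linkIn E B (F₂ c)) \ insert w c.toFinset).card + r + B.card := by omega
    have h8 : ((linkIn E B (F₁ c)).card : ℝ) + (linkIn E B (F₂ c)).card ≤
      ((linkIn E B (F₁ c) ∩ linkIn E B (F₂ c)) \ insert w c.toFinset).card + r + B.card := by
      exact_mod_cast h7
    nlinarith
  · obtain ⟨hb, hbn⟩ := Finset.mem_sdiff.1 hb
    obtain ⟨hb1, hb2⟩ := Finset.mem_inter.1 hb
    simp only [Finset.mem_insert, List.mem_toFinset, not_or] at hbn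
    refine ⟨?_, by simp [hw, Ne.symm hbn.1], fun p b' s h => ?_⟩
    · rw [← List.concat_eq_append, List.nodup_concat]
      exact ⟨hbn.2, hnd⟩
    · rcases List.eq_nil_or_concat s with rfl | ⟨s, b'', rfl⟩
      · obtain ⟨rfl, h⟩ := List.append_inj' h rfl
        obtain rfl : b = b' := by simpa using h
        exact ⟨(Finset.mem_filter.1 hb1).2, (Finset.mem_filter.1 hb2).2⟩
      · rw [List.concat_eq_append, ← List.cons_append, ← List.append_assoc] at h
        exact hc p b' s (List.append_inj' h rfl).1


lemma exists_eq_map_range {V : Type*} (l : List V) (w : V) :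
    ∃ f : ℕ → V, l = (List.range l.length).map f :=
  ⟨fun i => l.getD i w, by
    apply List.ext_getElem
    · simp
    · intro i h1 h2
      simp [List.getElem?_eq_getElem h1]⟩

lemma injOn_of_nodup_map_range {V : Type*} {f : ℕ → V} {m : ℕ}
    (h : ((List.range m).map f).Nodup) : Set.InjOn f (Set.Iio m) := fun _ hi _ hj hij =>
  List.inj_on_of_nodup_map h (List.mem_range.2 hi) (List.mem_range.2 hj) hij

/-- Two `(k-1)`-tuples can be connected by a tight path of fixed length through a reservoir `B`. -/
lemma exists_connection (k : ℕ) (hk : 2 ≤ k) {η : ℝ} (hη : 0 < η) :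
    ∃ n₀ : ℕ, ∀ {V : Type} [DecidableEq V] (E : Finset (Finset V)) (Y B : Finset V), B ⊆ Y →
      n₀ ≤ B.card → CodegreeGE E k Y B (1 / 2 + η) →
      ∀ x y : List V, x.Nodup → y.Nodup → x.length = k - 1 → y.length = k - 1 →
      (∀ v ∈ x, v ∈ Y ∧ v ∉ B) → (∀ v ∈ y, v ∈ Y ∧ v ∉ B) →
      ∃ z : List V, z.Nodup ∧ (∀ v ∈ z, v ∈ B) ∧ z.length = 1 + k * (k + 1) ∧
        Tight E k (x ++ z ++ y) := by
  obtain ⟨n₁, hn₁⟩ := exists_box (2 * k) (k + 1) (η ^ (2 * k)) (by positivity)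
  obtain ⟨n₂, hn₂⟩ := exists_nat_ge ((2 * k + 1 : ℝ) / η)
  refine ⟨max n₁ (n₂ + 1), fun {V} _ E Y B hBY hB hdeg x y hxnd hynd hx hy hxY hyY => ?_⟩
  have hBc : (2 * k + 1 : ℝ) ≤ η * B.card := by
    rw [div_le_iff₀ hη] at hn₂
    have : (n₂ : ℝ) ≤ B.card := by exact_mod_cast (le_of_max_le_right hB).trans' (Nat.le_succ _)
    nlinarith
  have hB0 : (0 : ℝ) < B.card := by
    have : 0 < B.card := by have := le_of_max_le_right hB; omega
    exact_mod_cast this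
  -- choose the vertex that completes `x` to an edge
  obtain ⟨w, hw⟩ : (linkIn E B x.toFinset).Nonempty := by
    rw [← Finset.card_pos]
    have := hdeg x.toFinset (fun v hv => (hxY v (by simpa using hv)).1)
      (by rw [List.toFinset_card_of_nodup hxnd, hx])
    have : (0 : ℝ) < (linkIn E B x.toFinset).card := lt_of_lt_of_le (by positivity) this
    exact_mod_cast this
  obtain ⟨hwB, hwE⟩ := Finset.mem_filter.1 hw
  obtain ⟨xf, hxf⟩ := exists_eq_map_range x w
  obtain ⟨yf, hyf⟩ := exists_eq_map_range y w
  rw [hx] at hxf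
  rw [hy] at hyf
  have hxm : ∀ i < k - 1, xf i ∈ Y ∧ xf i ∉ B := fun i hi => hxY _ (by
    rw [hxf]; exact List.mem_map.2 ⟨i, List.mem_range.2 hi, rfl⟩)
  have hym : ∀ i < k - 1, yf i ∈ Y ∧ yf i ∉ B := fun i hi => hyY _ (by
    rw [hyf]; exact List.mem_map.2 ⟨i, List.mem_range.2 hi, rfl⟩)
  have hxinj : Set.InjOn xf (Set.Iio (k - 1)) := injOn_of_nodup_map_range (hxf ▸ hxnd)
  have hyinj : Set.InjOn yf (Set.Iio (k - 1)) := injOn_of_nodup_map_range (hyf ▸ hynd)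
  set u : ℕ → V := fun i => if i < k - 1 then xf i else w with hu
  have huY : ∀ i < k, u i ∈ Y := fun i hi => by
    simp only [hu]; split_ifs with h
    · exact (hxm i h).1
    · exact hBY hwB
  have huB : ∀ i, u i ∈ B → u i = w := fun i hi => by
    simp only [hu] at hi ⊢; split_ifs at hi ⊢ with h
    · exact absurd hi (hxm i h).2
    · rfl
  have huinj : Set.InjOn u (Set.Iio k) := by
    intro i hi j hj hij
    have hi : i < k := hi
    have hj : j < k := hj
    simp only [hu] at hij
    split_ifs at hij with h1 h2 h2
    · exact hxinj h1 h2 hij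
    · exact absurd (hij ▸ hwB) (hxm i h1).2
    · exact absurd (hij ▸ hwB) (hxm j h2).2
    · omega
  set F₀ : List V → Finset V := fun p => (Finset.range (k - 1 - p.length)).image yf ∪ p.toFinset
    with hF₀
  set F₁ : List V → Finset V := fun p => if p.length < k then F₀ p else
    (p.drop k).toFinset ∪ (Finset.Ico (p.length - k + 1) k).image u with hF₁
  set F₂ : List V → Finset V := fun p => if p.length < k then F₀ p else
    (p.drop k).toFinset ∪ (p.take (2 * k - 1 - p.length)).toFinset with hF₂
  have hF₀c : ∀ p : List V, p.Nodup → (∀ v ∈ p, v ∈ B) → p.length < k →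
      F₀ p ⊆ Y ∧ (F₀ p).card = k - 1 := fun p hp hpB hpk => by
    refine ⟨?_, ?_⟩
    · refine Finset.union_subset ?_ fun v hv => hBY (hpB v (by simpa using hv))
      intro v hv
      obtain ⟨i, hi, rfl⟩ := Finset.mem_image.1 hv
      exact (hym i (by have := Finset.mem_range.1 hi; omega)).1
    · rw [Finset.card_union_of_disjoint, List.toFinset_card_of_nodup hp, Finset.card_image_of_injOn,
        Finset.card_range]
      · omega
      · exact hyinj.mono fun i hi => by
          have : i < k - 1 - p.length := by simpa using hi
          exact Set.mem_Iio.2 (by omega)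
      · refine Finset.disjoint_left.2 fun v hv hv' => ?_
        obtain ⟨i, hi, rfl⟩ := Finset.mem_image.1 hv
        exact (hym i (by have := Finset.mem_range.1 hi; omega)).2 (hpB _ (by simpa using hv'))
  obtain ⟨R, hR, hRc⟩ := exists_connector_lists (r := 2 * k) hη.le (by exact_mod_cast hBc) hdeg w
    F₁ F₂ (fun p hp hwp hpB hpk => by
      by_cases h : p.length < k
      · simpa [hF₁, hF₂, h] using hF₀c p hp hpB h
      simp only [hF₁, hF₂, h, if_false]
      have hdB : ∀ v ∈ (p.drop k).toFinset, v ∈ B := fun v hv =>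
        hpB v (List.mem_of_mem_drop (by simpa using hv))
      have htB : ∀ v ∈ (p.take (2 * k - 1 - p.length)).toFinset, v ∈ B := fun v hv =>
        hpB v (List.mem_of_mem_take (by simpa using hv))
      have hdc : (p.drop k).toFinset.card = p.length - k := by
        rw [List.toFinset_card_of_nodup (hp.sublist (List.drop_sublist _ _)), List.length_drop]
      refine ⟨⟨Finset.union_subset (fun v hv => hBY (hdB v hv)) ?_, ?_⟩,
        Finset.union_subset (fun v hv => hBY (hdB v hv)) fun v hv => hBY (htB v hv), ?_⟩
      · intro v hv
        obtain ⟨i, hi, rfl⟩ := Finset.mem_image.1 hv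
        exact huY i (Finset.mem_Ico.1 hi).2
      · rw [Finset.card_union_of_disjoint, hdc, Finset.card_image_of_injOn, Nat.card_Ico]
        · omega
        · exact huinj.mono fun i hi => by
            have : p.length - k + 1 ≤ i ∧ i < k := by simpa using hi
            exact Set.mem_Iio.2 this.2
        · refine Finset.disjoint_left.2 fun v hv hv' => ?_
          obtain ⟨i, hi, rfl⟩ := Finset.mem_image.1 hv'
          have := huB i (hdB _ hv)
          exact hwp (this ▸ List.mem_of_mem_drop (by simpa using hv))
      · rw [Finset.card_union_of_disjoint, hdc,
          List.toFinset_card_of_nodup (hp.sublist (List.take_sublist _ _)), List.length_take]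
        · omega
        · refine Finset.disjoint_left.2 fun v hv hv' => ?_
          exact List.disjoint_take_drop hp (show 2 * k - 1 - p.length ≤ k by omega)
            (by simpa using hv') (by simpa using hv))
  obtain ⟨T, hTinj, hT⟩ := hn₁ B R (le_of_max_le_left hB) (fun l hl => (hR l hl).2)
    (by rwa [← mul_pow])
  have hedge : ∀ g : ℕ → ℕ, (∀ a, g a < k + 1) → ∀ ℓ < 2 * k,
      insert (T ℓ (g ℓ)) (F₁ ((List.range ℓ).map fun a => T a (g a))) ∈ E ∧
      insert (T ℓ (g ℓ)) (F₂ ((List.range ℓ).map fun a => T a (g a))) ∈ E := fun g hg ℓ hℓ => by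
    refine (hR _ (hT g hg)).1.2.2 _ _
      ((List.range (2 * k - ℓ - 1)).map fun a => T (ℓ + (a + 1)) (g (ℓ + (a + 1)))) ?_
    rw [show 2 * k = ℓ + ((2 * k - ℓ - 1) + 1) by omega, List.range_add, List.range_succ_eq_map]
    simp [Function.comp_def]
  have hTB : ∀ a < 2 * k, ∀ ρ < k + 1, T a ρ ∈ B ∧ T a ρ ≠ w := fun a ha ρ hρ => by
    have hc := hR _ (hT (fun _ => ρ) fun _ => hρ)
    have hmem : T a ρ ∈ (List.range (2 * k)).map fun j => T j ρ :=
      List.mem_map.2 ⟨a, List.mem_range.2 ha, rfl⟩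
    exact ⟨hc.2.2 _ hmem, fun h => hc.1.2.1 (h ▸ hmem)⟩
  have hTinj' : ∀ a < 2 * k, ∀ b < 2 * k, ∀ ρ < k + 1, ∀ σ < k + 1, T a ρ = T b σ →
      a = b ∧ ρ = σ := fun a ha b hb ρ hρ σ hσ hab => by
    have heq : a = b := by
      by_contra hne
      set g : ℕ → ℕ := fun j => if j = a then ρ else σ with hg
      have hnd := (hR _ (hT g fun j => by simp only [hg]; split_ifs <;> assumption)).1.1
      refine hne (injOn_of_nodup_map_range hnd ha hb ?_)
      simpa [hg, Ne.symm hne] using hab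
    subst heq
    exact ⟨rfl, hTinj a ha hρ hσ hab⟩
  have htight := tight_connectingRow (E := E) (u := u) (y := yf) (T := T) (by omega : 0 < k)
    ?_ ?_ ?_ ?_
  · have hz : ∀ m, m < k * (k + 1) → connectingRow k u yf T ((k - 1 + (m + 1)) / k)
        ((k - 1 + (m + 1)) % k) =
        T (if m % k < k - m / k then k + m % k else k - 1 - m % k) (m / k) := fun m hm => by
      have h1 : m / k < k + 1 := by rwa [Nat.div_lt_iff_lt_mul (by omega), mul_comm]
      rw [show k - 1 + (m + 1) = m + k by omega, Nat.add_div_right _ (by omega), Nat.add_mod_right]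
      simp only [connectingRow]
      rw [if_neg (by omega)]
      split_ifs <;> rfl
    have hz0 : connectingRow k u yf T ((k - 1 + 0) / k) ((k - 1 + 0) % k) = w := by
      rw [Nat.add_zero, Nat.div_eq_of_lt (by omega), Nat.mod_eq_of_lt (by omega)]
      simp [connectingRow, hu]
    have hsym : ∀ m, (if m % k < k - m / k then k + m % k else k - 1 - m % k) < 2 * k := fun m => by
      have := Nat.mod_lt m (show 0 < k by omega)
      split_ifs <;> omega
    have hrow : ∀ m, m < k * (k + 1) → m / k < k + 1 := fun m hm => by
      rwa [Nat.div_lt_iff_lt_mul (by omega), mul_comm]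
    refine ⟨(List.range (1 + k * (k + 1))).map fun m =>
      connectingRow k u yf T ((k - 1 + m) / k) ((k - 1 + m) % k), ?_, ?_, by simp, ?_⟩
    · refine List.Nodup.map_on ?_ List.nodup_range
      intro a ha b hb hab
      rw [List.mem_range] at ha hb
      rcases a with _ | a <;> rcases b with _ | b
      · rfl
      · rw [hz0, hz b (by omega)] at hab
        exact absurd hab.symm (hTB _ (hsym b) _ (hrow b (by omega))).2
      · rw [hz0, hz a (by omega)] at hab
        exact absurd hab (hTB _ (hsym a) _ (hrow a (by omega))).2
      · rw [hz a (by omega), hz b (by omega)] at hab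
        obtain ⟨h1, h2⟩ := hTinj' _ (hsym a) _ (hsym b) _ (hrow a (by omega)) _
          (hrow b (by omega)) hab
        have ha' := Nat.mod_lt a (show 0 < k by omega)
        have hb' := Nat.mod_lt b (show 0 < k by omega)
        have h3 : a % k = b % k := by
          split_ifs at h1 <;> omega
        rw [← Nat.div_add_mod a k, ← Nat.div_add_mod b k, h2, h3]
    · intro v hv
      obtain ⟨m, hm, rfl⟩ := List.mem_map.1 hv
      rw [List.mem_range] at hm
      rcases m with _ | m
      · rw [hz0]; exact hwB
      · rw [hz m (by omega)]
        exact (hTB _ (hsym m) _ (hrow m (by omega))).1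
    · convert htight using 1
      rw [show k * (k + 2) + (k - 1) = (k - 1) + (1 + k * (k + 1)) + (k - 1) by
        have : k * (k + 2) = k * (k + 1) + k := by ring
        omega, List.range_add (n := k - 1 + (1 + k * (k + 1))), List.range_add (n := k - 1)]
      simp only [List.map_append, List.map_map, Function.comp_def]
      rw [hxf, hyf]
      congr 1
      · congr 1
        refine List.map_congr_left fun i hi => ?_
        rw [List.mem_range] at hi
        rw [Nat.div_eq_of_lt (by omega), Nat.mod_eq_of_lt (by omega)]
        simp [connectingRow, hu, hi]
      · refine List.map_congr_left fun i hi => ?_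
        rw [List.mem_range] at hi
        rw [show k - 1 + (1 + k * (k + 1)) + i = i + k * (k + 2) by
          have : k * (k + 2) = k * (k + 1) + k := by ring
          omega, Nat.add_mul_div_left _ _ (by omega), Nat.add_mul_mod_self_left,
          Nat.div_eq_of_lt (by omega), Nat.mod_eq_of_lt (by omega), zero_add]
        simp [connectingRow]
  · convert hwE using 1
    ext v
    rw [hxf]
    simp only [Finset.mem_image, Finset.mem_range, Finset.mem_insert, List.mem_toFinset,
      List.mem_map, List.mem_range, hu]
    constructor
    · rintro ⟨i, hi, rfl⟩
      by_cases h : i < k - 1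
      · exact Or.inr ⟨i, h, by simp [h]⟩
      · simp [h]
    · rintro (rfl | ⟨i, hi, rfl⟩)
      · exact ⟨k - 1, by omega, by simp⟩
      · exact ⟨i, by omega, by simp [hi]⟩
  · intro j hj g hg
    convert (hedge g hg (k - 1 - j) (by omega)).1 using 1
    ext v
    simp only [hF₁, hF₀, List.length_map, List.length_range, if_pos (show k - 1 - j < k by omega),
      show k - 1 - (k - 1 - j) = j by omega, Finset.mem_image, Finset.mem_range, Finset.mem_insert,
      Finset.mem_union, List.mem_toFinset, List.mem_map, List.mem_range]
    constructor
    · rintro ⟨i, hi, rfl⟩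
      rcases lt_trichotomy i j with h | h | h
      · exact Or.inr (Or.inl ⟨i, h, by simp [h]⟩)
      · subst h; simp
      · exact Or.inr (Or.inr ⟨k - 1 - i, by omega, by simp [Nat.not_lt.2 h.le]⟩)
    · rintro (rfl | ⟨i, hi, rfl⟩ | ⟨a, ha, rfl⟩)
      · exact ⟨j, hj, by simp⟩
      · exact ⟨i, by omega, by simp [hi]⟩
      · exact ⟨k - 1 - a, by omega, by
          rw [if_neg (by omega), show k - 1 - (k - 1 - a) = a by omega]⟩
  · intro j hj1 hj g hg
    convert (hedge g hg (k + (j - 1)) (by omega)).1 using 1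
    ext v
    simp only [hF₁, List.length_map, List.length_range,
      if_neg (show ¬ k + (j - 1) < k by omega), show k + (j - 1) - k + 1 = j by omega,
      Finset.mem_image, Finset.mem_range, Finset.mem_insert, Finset.mem_Ico,
      Finset.mem_union, List.mem_toFinset, List.mem_drop_iff_getElem, List.getElem_map,
      List.getElem_range]
    constructor
    · rintro ⟨i, hi, rfl⟩
      rcases Nat.lt_or_ge i j with h | h
      · rcases Nat.lt_or_ge i (j - 1) with h' | h'
        · exact Or.inr (Or.inl ⟨i, by omega, by simp [h]⟩)
        · obtain rfl : i = j - 1 := by omega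
          simp [h]
      · exact Or.inr (Or.inr ⟨i, ⟨h, hi⟩, by simp [Nat.not_lt.2 h]⟩)
    · rintro (rfl | ⟨i, hi, rfl⟩ | ⟨i, hi, rfl⟩)
      · exact ⟨j - 1, by omega, by rw [if_pos (by omega)]⟩
      · exact ⟨i, by omega, by rw [if_pos (by omega)]⟩
      · exact ⟨i, hi.2, by rw [if_neg (by omega)]⟩
  · intro j hj1 hj g hg
    convert (hedge g hg (k + (j - 1)) (by omega)).2 using 1
    ext v
    simp only [hF₂, List.length_map, List.length_range,
      if_neg (show ¬ k + (j - 1) < k by omega), show 2 * k - 1 - (k + (j - 1)) = k - j by omega,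
      Finset.mem_image, Finset.mem_range, Finset.mem_insert,
      Finset.mem_union, List.mem_toFinset, List.mem_drop_iff_getElem, List.mem_take_iff_getElem,
      List.getElem_map, List.getElem_range]
    constructor
    · rintro ⟨i, hi, rfl⟩
      rcases Nat.lt_or_ge i j with h | h
      · rcases Nat.lt_or_ge i (j - 1) with h' | h'
        · exact Or.inr (Or.inl ⟨i, by omega, by simp [h]⟩)
        · obtain rfl : i = j - 1 := by omega
          simp [h]
      · exact Or.inr (Or.inr ⟨k - 1 - i, by omega, by simp [Nat.not_lt.2 h]⟩)
    · rintro (rfl | ⟨i, hi, rfl⟩ | ⟨i, hi, rfl⟩)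
      · exact ⟨j - 1, by omega, by rw [if_pos (by omega)]⟩
      · exact ⟨i, by omega, by rw [if_pos (by omega)]⟩
      · exact ⟨k - 1 - i, by omega, by
          rw [if_neg (by omega), show k - 1 - (k - 1 - i) = i by omega]⟩

end Connection

section Splitting

/-- Chernoff's inequality: few subsets of `W` split the set `F` unevenly. -/
lemma card_deviating_le {V : Type*} [DecidableEq V] {W F : Finset V} (hF : F ⊆ W) {t : ℝ}
    (ht : 0 < t) :
    ((W.powerset.filter (fun A => t ≤ |((A ∩ F).card : ℝ) - F.card / 2|)).card : ℝ) ≤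
      2 * (2 ^ W.card * Real.exp (-(2 * t ^ 2 / W.card))) := by
  rcases Nat.eq_zero_or_pos W.card with hW | hW
  · have : W.powerset.card = 1 := by rw [Finset.card_powerset, hW, pow_zero]
    have h1 := Finset.card_filter_le W.powerset (fun A => t ≤ |((A ∩ F).card : ℝ) - F.card / 2|)
    rw [this] at h1
    have h2 : ((W.powerset.filter
      (fun A => t ≤ |((A ∩ F).card : ℝ) - F.card / 2|)).card : ℝ) ≤ 1 := by exact_mod_cast h1
    simp only [hW]
    simp
    linarith
  have hW' : (0 : ℝ) < W.card := by exact_mod_cast hW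
  have hFW : (F.card : ℝ) ≤ W.card := by exact_mod_cast Finset.card_le_card hF
  have hsum : ∀ l : ℝ, ∑ A ∈ W.powerset, Real.exp (l * ((A ∩ F).card - F.card / 2)) ≤
      2 ^ W.card * Real.exp (l ^ 2 * W.card / 8) := fun l => by
    have h1 : ∀ A ∈ W.powerset, Real.exp (l * ((A ∩ F).card - F.card / 2)) =
        (∏ i ∈ A, if i ∈ F then Real.exp l else 1) * Real.exp (-(l / 2)) ^ F.card := by
      intro A _
      rw [Finset.prod_ite, Finset.prod_const_one, mul_one, Finset.prod_const,
        Finset.filter_mem_eq_inter, ← Real.exp_nat_mul, ← Real.exp_nat_mul, ← Real.exp_add]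
      congr 1; ring
    rw [Finset.sum_congr rfl h1, ← Finset.sum_mul, ← Finset.prod_one_add]
    have h2 : ∏ i ∈ W, (1 + if i ∈ F then Real.exp l else 1) =
        (1 + Real.exp l) ^ F.card * 2 ^ (W.card - F.card) := by
      have : ∀ i, (1 + if i ∈ F then Real.exp l else 1 : ℝ) = if i ∈ F then 1 + Real.exp l else 2 := by
        intro i; split_ifs <;> norm_num
      simp_rw [this]
      rw [Finset.prod_ite, Finset.prod_const, Finset.prod_const, Finset.filter_mem_eq_inter,
        Finset.inter_eq_right.2 hF, Finset.filter_notMem_eq_sdiff, Finset.card_sdiff_of_subset hF]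
    have h3 : (1 + Real.exp l) * Real.exp (-(l / 2)) ≤ 2 * Real.exp (l ^ 2 / 8) := by
      have := Real.cosh_le_exp_half_sq (l / 2)
      rw [Real.cosh_eq] at this
      have h4 : Real.exp l * Real.exp (-(l / 2)) = Real.exp (l / 2) := by
        rw [← Real.exp_add]; congr 1; ring
      rw [show (l / 2) ^ 2 / 2 = l ^ 2 / 8 by ring] at this
      rw [add_mul, one_mul, h4]
      linarith
    have hsplit : (2 : ℝ) ^ W.card = 2 ^ F.card * 2 ^ (W.card - F.card) := by
      rw [← pow_add, Nat.add_sub_cancel' (Finset.card_le_card hF)]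
    calc _ = ((1 + Real.exp l) * Real.exp (-(l / 2))) ^ F.card * 2 ^ (W.card - F.card) := by
          rw [h2, mul_pow]; ring
      _ ≤ (2 * Real.exp (l ^ 2 / 8)) ^ F.card * 2 ^ (W.card - F.card) := by
          gcongr
      _ = 2 ^ W.card * Real.exp (l ^ 2 * F.card / 8) := by
          rw [mul_pow, hsplit, ← Real.exp_nat_mul]
          rw [show (F.card : ℝ) * (l ^ 2 / 8) = l ^ 2 * F.card / 8 by ring]; ring
      _ ≤ _ := by gcongr
  set l : ℝ := 4 * t / W.card with hl
  have hl0 : 0 < l := by positivity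
  have htail : ∀ σ : ℝ, σ ^ 2 = 1 →
      ((W.powerset.filter (fun A => t ≤ σ * (((A ∩ F).card : ℝ) - F.card / 2))).card : ℝ) ≤
      2 ^ W.card * Real.exp (-(2 * t ^ 2 / W.card)) := fun σ hσ => by
    have h1 : ((W.powerset.filter
        (fun A => t ≤ σ * (((A ∩ F).card : ℝ) - F.card / 2))).card : ℝ) * Real.exp (l * t) ≤
        ∑ A ∈ W.powerset, Real.exp ((σ * l) * ((A ∩ F).card - F.card / 2)) := by
      rw [← nsmul_eq_mul, ← Finset.sum_const]
      refine (Finset.sum_le_sum fun A hA => ?_).trans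
        (Finset.sum_le_sum_of_subset_of_nonneg (Finset.filter_subset _ _) fun _ _ _ => by positivity)
      have := (Finset.mem_filter.1 hA).2
      rw [Real.exp_le_exp]
      nlinarith
    have h2 := h1.trans (hsum (σ * l))
    rw [← le_div_iff₀ (by positivity)] at h2
    refine h2.trans (le_of_eq ?_)
    rw [mul_div_assoc, ← Real.exp_sub, mul_pow, hσ]
    congr 2
    rw [hl]
    field_simp
    ring
  have h1 := htail 1 (by norm_num)
  have h2 := htail (-1) (by norm_num)
  have hsub : W.powerset.filter (fun A => t ≤ |((A ∩ F).card : ℝ) - F.card / 2|) ⊆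
      W.powerset.filter (fun A => t ≤ 1 * (((A ∩ F).card : ℝ) - F.card / 2)) ∪
      W.powerset.filter (fun A => t ≤ -1 * (((A ∩ F).card : ℝ) - F.card / 2)) := by
    intro A hA
    obtain ⟨hA1, hA2⟩ := Finset.mem_filter.1 hA
    rw [Finset.mem_union, Finset.mem_filter, Finset.mem_filter, one_mul, neg_one_mul]
    rcases le_abs.1 hA2 with h | h
    · exact Or.inl ⟨hA1, h⟩
    · exact Or.inr ⟨hA1, h⟩
  have h3 : ((W.powerset.filter (fun A => t ≤ |((A ∩ F).card : ℝ) - F.card / 2|)).card : ℝ) ≤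
      (W.powerset.filter (fun A => t ≤ 1 * (((A ∩ F).card : ℝ) - F.card / 2))).card +
      (W.powerset.filter (fun A => t ≤ -1 * (((A ∩ F).card : ℝ) - F.card / 2))).card := by
    exact_mod_cast (Finset.card_le_card hsub).trans (Finset.card_union_le _ _)
  linarith

/-- The codegree proportion guaranteed for typical sets of size `n`. -/
noncomputable def typicalCodegree (κ g : ℝ) (n : ℕ) : ℝ := 1 / 2 + κ - g * (n : ℝ) ^ (-(1 / 4 : ℝ))

lemma eventually_union_bound (k K : ℕ) {c : ℝ} (hc : 0 < c) :
    ∀ᶠ n : ℕ in Filter.atTop,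
      4 * (n + 1 : ℝ) * (K * n + 1) ^ k * Real.exp (-(c * Real.sqrt n)) ≤ 1 := by
  have h1 := (isLittleO_pow_exp_pos_mul_atTop (2 * (k + 1)) hc).bound
    (show (0 : ℝ) < 1 / (8 * (K + 1) ^ k) by positivity)
  have h2 : Filter.Tendsto (fun n : ℕ => Real.sqrt n) Filter.atTop Filter.atTop :=
    Real.tendsto_sqrt_atTop.comp tendsto_natCast_atTop_atTop
  filter_upwards [h2.eventually h1, Filter.eventually_ge_atTop 1] with n hn hn1
  have hn1' : (1 : ℝ) ≤ n := by exact_mod_cast hn1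
  rw [Real.norm_of_nonneg (by positivity), Real.norm_of_nonneg (by positivity), pow_mul,
    Real.sq_sqrt (by positivity), one_div, ← div_eq_inv_mul, le_div_iff₀ (by positivity)] at hn
  rw [Real.exp_neg, ← div_eq_mul_inv, div_le_one (by positivity)]
  calc 4 * (n + 1 : ℝ) * (K * n + 1) ^ k ≤ 4 * (n + n : ℝ) * ((K + 1) * n) ^ k := by
        gcongr
        linarith
    _ = n ^ (k + 1) * (8 * (K + 1) ^ k) := by rw [mul_pow, pow_succ]; ring
    _ ≤ _ := hn

/-- The error terms in halving a typical set are absorbed by the weaker requirement on the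
halves. -/
lemma typicalCodegree_half {κ g : ℝ} (hκ : 0 ≤ κ) (hg : 0 < g) :
    ∀ᶠ n : ℕ in Filter.atTop, ∀ m : ℕ, n ≤ 2 * m + 1 → 2 * m ≤ n + 1 → ∀ d : ℝ,
      typicalCodegree κ g n * n / 2 - 3 / 100 * g * (n : ℝ) ^ (3 / 4 : ℝ) ≤ d →
      typicalCodegree κ g m * m ≤ d := by
  have h2 : Filter.Tendsto (fun n : ℕ => (n : ℝ) ^ (3 / 4 : ℝ)) Filter.atTop Filter.atTop :=
    (tendsto_rpow_atTop (by norm_num)).comp tendsto_natCast_atTop_atTop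
  filter_upwards [h2.eventually_ge_atTop (100 * (1 / 2 + κ) / g), Filter.eventually_ge_atTop 100]
    with n hn hn1 m hm1 hm2 d hd
  refine le_trans ?_ hd
  have hn' : (100 : ℝ) ≤ n := by exact_mod_cast hn1
  have hn0 : (0 : ℝ) < n := by linarith
  have hm1' : (n : ℝ) ≤ 2 * m + 1 := by exact_mod_cast hm1
  have hm2' : (2 : ℝ) * m ≤ n + 1 := by exact_mod_cast hm2
  have hm0 : (0 : ℝ) < m := by linarith
  have h34 : (n : ℝ) ^ (3 / 4 : ℝ) = n * (n : ℝ) ^ (-(1 / 4 : ℝ)) := by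
    rw [← Real.rpow_one_add' hn0.le (by norm_num)]; norm_num
  set N := (n : ℝ) ^ (-(1 / 4 : ℝ)) with hN
  have hN0 : 0 < N := by positivity
  have hmN : 11 / 10 * N ≤ (m : ℝ) ^ (-(1 / 4 : ℝ)) := by
    have h1 : (m : ℝ) ≤ 2 / 3 * n := by linarith
    have h3 : (11 / 10 : ℝ) ≤ (2 / 3 : ℝ) ^ (-(1 / 4 : ℝ)) := by
      have : ((11 / 10 : ℝ) ^ (4 : ℝ)) ^ (1 / 4 : ℝ) ≤ ((2 / 3 : ℝ)⁻¹) ^ (1 / 4 : ℝ) := by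
        refine Real.rpow_le_rpow (by positivity) ?_ (by norm_num)
        rw [show (4 : ℝ) = ((4 : ℕ) : ℝ) by norm_num, Real.rpow_natCast]
        norm_num
      rw [← Real.rpow_mul (by norm_num)] at this
      rw [Real.rpow_neg (by norm_num), ← Real.inv_rpow (by norm_num)]
      norm_num at this ⊢
      exact this
    calc 11 / 10 * N ≤ (2 / 3 : ℝ) ^ (-(1 / 4 : ℝ)) * N := by gcongr
      _ = (2 / 3 * n : ℝ) ^ (-(1 / 4 : ℝ)) := by rw [Real.mul_rpow (by norm_num) hn0.le]
      _ ≤ _ := Real.rpow_le_rpow_of_nonpos hm0 h1 (by norm_num)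
  rw [div_le_iff₀ hg, h34] at hn
  rw [h34]
  simp only [typicalCodegree]
  rw [← hN]
  have h5 : g * (11 / 10 * N) * m ≤ g * (m : ℝ) ^ (-(1 / 4 : ℝ)) * m := by gcongr
  have h6 : g * (11 / 10 * N) * ((n - 1) / 2) ≤ g * (11 / 10 * N) * m := by gcongr; linarith
  have h7 : (1 / 2 + κ) * m ≤ (1 / 2 + κ) * ((n + 1) / 2) := by gcongr; linarith
  have h8 : 100 * (g * N) ≤ n * (g * N) := by gcongr
  nlinarith

lemma two_pow_div_le_choose (n : ℕ) : (2 : ℝ) ^ n / (n + 1) ≤ n.choose (n / 2) := by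
  rw [div_le_iff₀ (by positivity)]
  have h1 : 2 ^ n ≤ (n + 1) * n.choose (n / 2) := by
    rw [← Nat.sum_range_choose]
    calc _ ≤ ∑ m ∈ Finset.range (n + 1), n.choose (n / 2) :=
          Finset.sum_le_sum fun m _ => Nat.choose_le_middle m n
      _ = _ := by simp
  rw [mul_comm]
  exact_mod_cast h1

/-- A large proportion of the balanced partitions of a typical set have typical parts. -/
lemma exists_many_typical_halves (k K : ℕ) {κ g : ℝ} (hκ : 0 ≤ κ) (hg : 0 < g) :
    ∃ n₁ : ℕ, ∀ {V : Type} [DecidableEq V] (E : Finset (Finset V)) (Y W : Finset V),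
      n₁ ≤ W.card → Y.card ≤ K * W.card →
      CodegreeGE E k Y W (typicalCodegree κ g W.card) →
      ∃ 𝓐 : Finset (Finset V), (∀ A ∈ 𝓐, A ⊆ W ∧ A.card = W.card / 2 ∧
        CodegreeGE E k Y A (typicalCodegree κ g A.card) ∧
        CodegreeGE E k Y (W \ A) (typicalCodegree κ g (W \ A).card)) ∧
        (2 : ℝ) ^ W.card / (2 * (W.card + 1)) ≤ 𝓐.card := by
  obtain ⟨n₁, hn₁⟩ := Filter.eventually_atTop.1
    (((typicalCodegree_half hκ hg).and (eventually_union_bound k K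
      (show 0 < 2 * (3 / 100 * g) ^ 2 by positivity))).and (Filter.eventually_ge_atTop 1))
  refine ⟨n₁, fun {V} _ E Y W hW hY hdeg => ?_⟩
  obtain ⟨⟨hhalf, hunion⟩, hW1⟩ := hn₁ _ hW
  have hW0 : (0 : ℝ) < W.card := by exact_mod_cast hW1
  set t : ℝ := 3 / 100 * g * (W.card : ℝ) ^ (3 / 4 : ℝ) with ht
  have ht0 : 0 < t := by positivity
  set bad : Finset (Finset V) := (Y.powersetCard (k - 1)).biUnion fun S =>
    W.powerset.filter (fun A => t ≤ |((A ∩ linkIn E W S).card : ℝ) - (linkIn E W S).card / 2|)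
    with hbad
  have hlink : ∀ S, linkIn E W S ⊆ W := fun S => Finset.filter_subset _ _
  have hbadc : (bad.card : ℝ) ≤ (K * W.card + 1) ^ k *
      (2 * (2 ^ W.card * Real.exp (-(2 * (3 / 100 * g) ^ 2 * Real.sqrt W.card)))) := by
    have h1 : (bad.card : ℝ) ≤ ∑ S ∈ Y.powersetCard (k - 1), ((W.powerset.filter (fun A =>
        t ≤ |((A ∩ linkIn E W S).card : ℝ) - (linkIn E W S).card / 2|)).card : ℝ) := by
      exact_mod_cast Finset.card_biUnion_le
    refine h1.trans ((Finset.sum_le_sum fun S _ => card_deviating_le (hlink S) ht0).trans ?_)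
    rw [Finset.sum_const, Finset.card_powersetCard, nsmul_eq_mul]
    have hexp : 2 * t ^ 2 / W.card = 2 * (3 / 100 * g) ^ 2 * Real.sqrt W.card := by
      have : ((W.card : ℝ) ^ (3 / 4 : ℝ)) ^ 2 = W.card * Real.sqrt W.card := by
        rw [Real.sqrt_eq_rpow, ← Real.rpow_natCast, ← Real.rpow_mul hW0.le,
          ← Real.rpow_one_add' hW0.le (by norm_num)]
        norm_num
      rw [ht, mul_pow, this]
      field_simp
    rw [hexp]
    have h2 : ((Y.card.choose (k - 1) : ℕ) : ℝ) ≤ (K * W.card + 1) ^ k := by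
      have h3 : Y.card.choose (k - 1) ≤ (K * W.card + 1) ^ k :=
        (Nat.choose_le_pow _ _).trans ((Nat.pow_le_pow_left (hY.trans (Nat.le_succ _)) _).trans
          (Nat.pow_le_pow_right (by omega) (by omega)))
      exact_mod_cast h3
    gcongr
  refine ⟨W.powersetCard (W.card / 2) \ bad, fun A hA => ?_, ?_⟩
  · obtain ⟨hA1, hA2⟩ := Finset.mem_sdiff.1 hA
    obtain ⟨hAW, hAc⟩ := Finset.mem_powersetCard.1 hA1
    have hAc' : (W \ A).card = W.card - W.card / 2 := by
      rw [Finset.card_sdiff_of_subset hAW, hAc]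
    have hdev : ∀ S ⊆ Y, S.card = k - 1 →
        |((A ∩ linkIn E W S).card : ℝ) - (linkIn E W S).card / 2| < t := fun S hS hSc => by
      by_contra hcon
      exact hA2 (Finset.mem_biUnion.2 ⟨S, Finset.mem_powersetCard.2 ⟨hS, hSc⟩,
        Finset.mem_filter.2 ⟨Finset.mem_powerset.2 hAW, not_lt.1 hcon⟩⟩)
    have hl1 : ∀ S, linkIn E A S = A ∩ linkIn E W S := fun S => by
      ext v; simp only [linkIn, Finset.mem_inter, Finset.mem_filter]
      exact ⟨fun h => ⟨h.1, hAW h.1, h.2⟩, fun h => ⟨h.1, h.2.2⟩⟩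
    have hl2 : ∀ S, linkIn E (W \ A) S = linkIn E W S \ A := fun S => by
      ext v; simp only [linkIn, Finset.mem_sdiff, Finset.mem_filter]; tauto
    refine ⟨hAW, hAc, fun S hS hSc => ?_, fun S hS hSc => ?_⟩
    · have h1 := abs_lt.1 (hdev S hS hSc)
      have h2 := hdeg S hS hSc
      refine hhalf _ (by omega) (by omega) _ ?_
      rw [hl1]
      linarith
    · have h1 := abs_lt.1 (hdev S hS hSc)
      have h2 := hdeg S hS hSc
      refine hhalf _ (by omega) (by omega) _ ?_
      have h3 : ((linkIn E W S).card : ℝ) = (linkIn E W S \ A).card + (A ∩ linkIn E W S).card := by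
        rw [Finset.inter_comm]
        exact_mod_cast (Finset.card_sdiff_add_card_inter _ _).symm
      rw [hl2]
      linarith
  · have h1 := Finset.le_card_sdiff bad (W.powersetCard (W.card / 2))
    rw [Finset.card_powersetCard] at h1
    have h2 : ((W.card.choose (W.card / 2) : ℕ) : ℝ) ≤
        (W.powersetCard (W.card / 2) \ bad).card + bad.card := by exact_mod_cast (by omega)
    have h3 := two_pow_div_le_choose W.card
    have h4 : (bad.card : ℝ) ≤ 2 ^ W.card / (2 * (W.card + 1)) := by
      refine hbadc.trans ?_
      rw [le_div_iff₀ (by positivity)]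
      calc _ = 2 ^ W.card * (4 * (W.card + 1 : ℝ) * (K * W.card + 1) ^ k *
            Real.exp (-(2 * (3 / 100 * g) ^ 2 * Real.sqrt W.card))) := by ring
        _ ≤ 2 ^ W.card * 1 := by gcongr
        _ = _ := mul_one _
    have h5 : (2 : ℝ) ^ W.card / (W.card + 1) = 2 ^ W.card / (2 * (W.card + 1)) +
        2 ^ W.card / (2 * (W.card + 1)) := by field_simp; norm_num
    linarith

end Splitting

section AlmostSpanning

lemma CodegreeGE.mono {V : Type*} [DecidableEq V] {E : Finset (Finset V)} {k : ℕ}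
    {Y Y' W : Finset V} {c c' : ℝ} (h : CodegreeGE E k Y W c) (hY : Y' ⊆ Y) (hc : c' ≤ c) :
    CodegreeGE E k Y' W c' := fun S hS hSc =>
  (mul_le_mul_of_nonneg_right hc (Nat.cast_nonneg _)).trans (h S (hS.trans hY) hSc)

lemma CodegreeGE.of_subset {V : Type*} [DecidableEq V] {E : Finset (Finset V)} {k : ℕ}
    {Y W W' : Finset V} {c c' : ℝ} (h : CodegreeGE E k Y W c) (hW : W' ⊆ W)
    (hc : c' * W'.card ≤ c * W.card - (W \ W').card) : CodegreeGE E k Y W' c' := fun S hS hSc => by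
  have h1 := h S hS hSc
  have h2 := linkIn_card_union_le (E := E) W' (W \ W') S
  rw [Finset.union_sdiff_of_subset hW] at h2
  have h3 : (linkIn E (W \ W') S).card ≤ (W \ W').card :=
    Finset.card_le_card (Finset.filter_subset _ _)
  have h4 : ((linkIn E W S).card : ℝ) ≤ (linkIn E W' S).card + (W \ W').card := by
    exact_mod_cast h2.trans (Nat.add_le_add_left h3 _)
  linarith

/-- A typical set contains a small typical subset. -/
lemma exists_typical_subset (k j K : ℕ) {κ g : ℝ} (hκ : 0 ≤ κ) (hg : 0 < g) :
    ∃ n₁ : ℕ, ∀ {V : Type} [DecidableEq V] (E : Finset (Finset V)) (Y W : Finset V),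
      n₁ ≤ W.card → Y.card ≤ K * W.card →
      CodegreeGE E k Y W (typicalCodegree κ g W.card) →
      ∃ B ⊆ W, 2 ^ j * B.card ≤ W.card ∧ W.card ≤ 3 ^ j * B.card ∧
        CodegreeGE E k Y B (typicalCodegree κ g B.card) := by
  induction j generalizing K with
  | zero => exact ⟨0, fun E Y W _ _ h => ⟨W, subset_rfl, by simp, by simp, h⟩⟩
  | succ j ih =>
    obtain ⟨n₁, hn₁⟩ := exists_many_typical_halves k K hκ hg
    obtain ⟨n₂, hn₂⟩ := ih (3 * K)
    refine ⟨max (max n₁ (3 * n₂)) 2, fun {V} _ E Y W hW hY hdeg => ?_⟩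
    obtain ⟨𝓐, h𝓐, hc⟩ := hn₁ E Y W (by omega) hY hdeg
    have h0 : (0 : ℝ) < 𝓐.card := lt_of_lt_of_le (by positivity) hc
    obtain ⟨A, hA⟩ := Finset.card_pos.1 (show 0 < 𝓐.card by exact_mod_cast h0)
    obtain ⟨hAW, hAc, hAd, -⟩ := h𝓐 A hA
    have h3 : W.card ≤ 3 * A.card := by omega
    obtain ⟨B, hBA, hB1, hB2, hB3⟩ := hn₂ E Y A (by omega) (by
      calc Y.card ≤ K * W.card := hY
        _ ≤ K * (3 * A.card) := Nat.mul_le_mul_left _ h3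
        _ = _ := by ring) hAd
    refine ⟨B, hBA.trans hAW, ?_, ?_, hB3⟩
    · rw [pow_succ, mul_right_comm]; omega
    · rw [pow_succ, mul_right_comm]; omega

/-- Disjoint tight paths can be joined into one, starting from a prescribed tuple `x`, through a
reservoir `B`. -/
lemma exists_tight_joining {k : ℕ} (hk : 2 ≤ k) {V : Type} [DecidableEq V] {E : Finset (Finset V)}
    {Y B : Finset V} {η : ℝ} {n₀ : ℕ} (hη : 0 ≤ η) (hη1 : η ≤ 1) (hBY : B ⊆ Y)
    (hdeg : CodegreeGE E k Y B (1 / 2 + 2 * η)) (hn₀ : 2 * n₀ ≤ B.card)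
    (hconn : ∀ B' ⊆ Y, n₀ ≤ B'.card → CodegreeGE E k Y B' (1 / 2 + η) →
      ∀ x y : List V, x.Nodup → y.Nodup → x.length = k - 1 → y.length = k - 1 →
      (∀ v ∈ x, v ∈ Y ∧ v ∉ B') → (∀ v ∈ y, v ∈ Y ∧ v ∉ B') →
      ∃ z : List V, z.Nodup ∧ (∀ v ∈ z, v ∈ B') ∧ z.length = 1 + k * (k + 1) ∧
        Tight E k (x ++ z ++ y)) (L : List (List V)) :
    ∀ B' ⊆ B, ((B \ B').card + (1 + k * (k + 1)) * L.length : ℝ) ≤ η / 2 * B.card →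
    ∀ x : List V, x.Nodup → x.length = k - 1 → (∀ v ∈ x, v ∈ Y ∧ v ∉ B) → L.flatten.Nodup →
      (∀ v ∈ L.flatten, v ∈ Y ∧ v ∉ B) → (∀ P ∈ L, Tight E k P ∧ k ≤ P.length) →
      ∃ l : List V, l.Nodup ∧ (∀ v ∈ l, v ∈ L.flatten ∨ v ∈ B') ∧ L.flatten.length ≤ l.length ∧
        Tight E k (x ++ l) := by
  induction L with
  | nil =>
    intro B' _ _ x _ hx _ _ _ _
    exact ⟨[], List.nodup_nil, by simp, by simp, tight_of_length_lt (by simp [hx]; omega)⟩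
  | cons P L ih =>
    intro B' hB' hcard x hxnd hx hxY hnd hLY hL
    rw [List.flatten_cons] at hnd hLY
    obtain ⟨hPt, hPk⟩ := hL P (by simp)
    obtain ⟨hPnd, hLnd, hPL⟩ := List.nodup_append.1 hnd
    have hBsub := Finset.card_sdiff_add_card_eq_card hB'
    have hBsub' : ((B \ B').card : ℝ) + B'.card = B.card := by exact_mod_cast hBsub
    push_cast [List.length_cons] at hcard
    have hpos : (0 : ℝ) ≤ (1 + k * (k + 1)) * (L.length + 1) := by positivity
    have hB0 : (0 : ℝ) ≤ B.card := by positivity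
    have hdeg' : CodegreeGE E k Y B' (1 / 2 + η) := hdeg.of_subset hB' (by nlinarith)
    have hn₀' : n₀ ≤ B'.card := by
      have h1 : (2 * n₀ : ℝ) ≤ B.card := by exact_mod_cast hn₀
      have : (n₀ : ℝ) ≤ B'.card := by nlinarith
      exact_mod_cast this
    have htake : ∀ v ∈ P.take (k - 1), v ∈ P := fun v hv => List.mem_of_mem_take hv
    set d := P.length - (k - 1) with hd
    have hdrop : ∀ v ∈ P.drop d, v ∈ P := fun v hv => List.mem_of_mem_drop hv
    have hPY : ∀ v ∈ P, v ∈ Y ∧ v ∉ B := fun v hv => hLY v (List.mem_append_left _ hv)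
    obtain ⟨z, hznd, hzB, hzl, hzt⟩ := hconn B' (hB'.trans hBY) hn₀' hdeg' x (P.take (k - 1)) hxnd
      (hPnd.sublist (List.take_sublist _ _)) hx (by simp; omega)
      (fun v hv => ⟨(hxY v hv).1, fun h => (hxY v hv).2 (hB' h)⟩)
      (fun v hv => ⟨(hPY v (htake v hv)).1, fun h => (hPY v (htake v hv)).2 (hB' h)⟩)
    have hzc : z.toFinset.card = 1 + k * (k + 1) := by
      rw [List.toFinset_card_of_nodup hznd, hzl]
    obtain ⟨l, hlnd, hlB, hll, hlt⟩ := ih (B' \ z.toFinset) (Finset.sdiff_subset.trans hB') (by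
        have h1 : B \ (B' \ z.toFinset) ⊆ (B \ B') ∪ z.toFinset := fun v hv => by
          simp only [Finset.mem_sdiff, Finset.mem_union] at hv ⊢; tauto
        have h2 := (Finset.card_le_card h1).trans (Finset.card_union_le _ _)
        rw [hzc] at h2
        have h3 : ((B \ (B' \ z.toFinset)).card : ℝ) ≤ (B \ B').card + (1 + k * (k + 1)) := by
          exact_mod_cast h2
        linarith) (P.drop d)
      (hPnd.sublist (List.drop_sublist _ _)) (by simp; omega) (fun v hv => hPY v (hdrop v hv)) hLnd
      (fun v hv => hLY v (List.mem_append_right _ hv)) fun Q hQ => hL Q (by simp [hQ])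
    refine ⟨z ++ P ++ l, ?_, ?_, ?_, ?_⟩
    · refine List.nodup_append.2 ⟨List.nodup_append.2 ⟨hznd, hPnd, ?_⟩, hlnd, ?_⟩
      · rintro v hv _ hv' rfl
        exact (hPY v hv').2 (hB' (hzB v hv))
      · rintro v hv _ hv' rfl
        rcases List.mem_append.1 hv with hv | hv <;> rcases hlB v hv' with h | h
        · exact (hLY v (List.mem_append_right _ h)).2 (hB' (hzB v hv))
        · exact (Finset.mem_sdiff.1 h).2 (by simpa using hv)
        · exact hPL v hv v h rfl
        · exact (hPY v hv).2 (hB' (Finset.mem_sdiff.1 h).1)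
    · intro v hv
      rw [List.flatten_cons]
      simp only [List.mem_append] at hv ⊢
      rcases hv with (hv | hv) | hv
      · exact Or.inr (hzB v hv)
      · exact Or.inl (Or.inl hv)
      · rcases hlB v hv with h | h
        · exact Or.inl (Or.inr h)
        · exact Or.inr (Finset.mem_sdiff.1 h).1
    · simp only [List.flatten_cons, List.length_append]
      omega
    · have h1 : Tight E k (x ++ z ++ P) := by
        have := Tight.glue (p := x ++ z) (q := P.take (k - 1)) (r := P.drop (k - 1)) hzt
          (by rwa [List.take_append_drop]) (by simp; omega)
        rwa [List.append_assoc, List.take_append_drop] at this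
      have h2 := Tight.glue (p := x ++ z ++ P.take d) (q := P.drop d) (r := l)
        (by rwa [List.append_assoc, List.take_append_drop]) hlt (by simp; omega)
      rw [List.append_assoc (x ++ z), List.take_append_drop] at h2
      simpa using h2

lemma mul_length_le_length_flatten {α : Type*} {q : ℕ} {L : List (List α)}
    (h : ∀ P ∈ L, q ≤ P.length) : q * L.length ≤ L.flatten.length := by
  induction L with
  | nil => simp
  | cons P L ih =>
    have h1 := ih fun Q hQ => h Q (by simp [hQ])
    have h2 := h P (by simp)
    simp only [List.flatten_cons, List.length_append, List.length_cons]
    nlinarith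

/-- A large set with codegree proportion above one half contains, from any starting tuple, an
almost spanning tight path. -/
lemma exists_almost_spanning_tight (k : ℕ) (hk : 2 ≤ k) {η δ : ℝ} (hη : 0 < η) (hη1 : η ≤ 1)
    (hδ : 0 < δ) :
    ∃ s₀ : ℕ, ∀ {V : Type} [DecidableEq V] (E : Finset (Finset V)), (∀ e ∈ E, e.card = k) →
      ∀ (Q : Finset V) (x : List V), s₀ ≤ Q.card → x.Nodup → x.length = k - 1 →
      (∀ v ∈ x, v ∉ Q) → CodegreeGE E k (Q ∪ x.toFinset) Q (1 / 2 + η) →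
      ∃ l : List V, l.Nodup ∧ (∀ v ∈ l, v ∈ Q) ∧ Tight E k (x ++ l) ∧
        l.length = ⌈(1 - δ) * Q.card⌉₊ := by
  obtain ⟨j, hj⟩ := pow_unbounded_of_one_lt (max (4 / η) (4 / δ)) (one_lt_two (α := ℝ))
  obtain ⟨n₁, hn₁⟩ := exists_typical_subset k j 2 hη.le (half_pos hη)
  obtain ⟨n₂, hn₂⟩ := exists_connection k hk (show 0 < η / 4 by positivity)
  obtain ⟨q, hq⟩ := exists_nat_ge (max (k : ℝ) ((1 + k * (k + 1)) * 3 ^ j / (η / 8)))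
  have hqk : k ≤ q := by exact_mod_cast (le_max_left _ _).trans hq
  obtain ⟨n₃, hn₃⟩ := exists_path_cover k q hk (by omega) (half_pos hη) (half_pos hδ)
  refine ⟨max (max n₁ (3 ^ j * (2 * n₂ + 1))) (max (2 * n₃) k),
    fun {V} _ E hE Q x hQ hxnd hx hxQ hdeg => ?_⟩
  set Y := Q ∪ x.toFinset with hY
  have hQ0 : 0 < Q.card := by omega
  have hQ0' : (0 : ℝ) < Q.card := by exact_mod_cast hQ0
  obtain ⟨B, hBQ, hB1, hB2, hB3⟩ := hn₁ E Y Q (by omega) (by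
    have h1 : Y.card ≤ Q.card + x.toFinset.card := Finset.card_union_le Q x.toFinset
    have h2 := x.toFinset_card_le
    omega) (hdeg.mono subset_rfl (by
      have : 0 ≤ η / 2 * (Q.card : ℝ) ^ (-(1 / 4 : ℝ)) := by positivity
      simp only [typicalCodegree]; linarith))
  have hBn : 2 * n₂ + 1 ≤ B.card := by
    have : 3 ^ j * (2 * n₂ + 1) ≤ 3 ^ j * B.card := by omega
    exact Nat.le_of_mul_le_mul_left this (by positivity)
  have hBdeg : CodegreeGE E k Y B (1 / 2 + 2 * (η / 4)) := hB3.mono subset_rfl (by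
    have : (B.card : ℝ) ^ (-(1 / 4 : ℝ)) ≤ 1 :=
      Real.rpow_le_one_of_one_le_of_nonpos (by exact_mod_cast (by omega : 1 ≤ B.card)) (by norm_num)
    simp only [typicalCodegree]; nlinarith)
  have hB1' : (2 : ℝ) ^ j * B.card ≤ Q.card := by exact_mod_cast hB1
  have hB2' : (Q.card : ℝ) ≤ 3 ^ j * B.card := by exact_mod_cast hB2
  have hB0 : (0 : ℝ) < B.card := by exact_mod_cast (by omega : 0 < B.card)
  have hBη : B.card ≤ η / 4 * Q.card := by
    have h1 : 4 / η * B.card ≤ 2 ^ j * B.card := by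
      gcongr; exact (le_max_left _ _).trans hj.le
    rw [div_mul_eq_mul_div, div_le_iff₀ hη] at h1
    nlinarith
  have hBδ : B.card ≤ δ / 4 * Q.card := by
    have h1 : 4 / δ * B.card ≤ 2 ^ j * B.card := by
      gcongr; exact (le_max_right _ _).trans hj.le
    rw [div_mul_eq_mul_div, div_le_iff₀ hδ] at h1
    nlinarith
  have hAB : ((Q \ B).card : ℝ) + B.card = Q.card := by
    exact_mod_cast Finset.card_sdiff_add_card_eq_card hBQ
  have hAA : Q \ (Q \ B) = B := Finset.sdiff_sdiff_eq_self hBQ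
  have hAQ : Q \ B ⊆ Q := Finset.sdiff_subset
  obtain ⟨L, hL, hLlen⟩ := hn₃ E hE (Q \ B) (by
      have h1 : (2 * n₃ : ℝ) ≤ Q.card := by exact_mod_cast (by omega : 2 * n₃ ≤ Q.card)
      have : (n₃ : ℝ) ≤ (Q \ B).card := by nlinarith
      exact_mod_cast this)
    ((hdeg.of_subset hAQ (c' := 1 / 2 + η / 2) (by rw [hAA]; nlinarith)).mono
      (hAQ.trans Finset.subset_union_left) le_rfl)
  have hLA : L.flatten.length ≤ (Q \ B).card := by
    rw [← List.toFinset_card_of_nodup hL.1]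
    exact Finset.card_le_card fun v hv => hL.2.1 v (by simpa using hv)
  obtain ⟨l, hlnd, hlm, hll, hlt⟩ := exists_tight_joining hk (show 0 ≤ η / 4 by positivity)
    (by linarith) (hBQ.trans Finset.subset_union_left) hBdeg (by omega)
    (fun B' hB' => hn₂ E Y B' hB') L B subset_rfl (by
      have h1 : (q * L.length : ℝ) ≤ Q.card := by
        have := mul_length_le_length_flatten fun P hP => (hL.2.2 P hP).2.1
        exact_mod_cast (this.trans hLA).trans (Finset.card_le_card hAQ)
      have h2 := (le_max_right _ _).trans hq
      rw [div_le_iff₀ (by positivity)] at h2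
      have h3 : ((1 + k * (k + 1)) * L.length : ℝ) * 3 ^ j ≤ η / 8 * B.card * 3 ^ j := by
        calc ((1 + k * (k + 1)) * L.length : ℝ) * 3 ^ j
            = ((1 + k * (k + 1)) * 3 ^ j) * L.length := by ring
          _ ≤ (q * (η / 8)) * L.length := by gcongr
          _ = η / 8 * (q * L.length) := by ring
          _ ≤ η / 8 * (3 ^ j * B.card) := 
              mul_le_mul_of_nonneg_left (h1.trans hB2') (by positivity)
          _ = _ := by ring
      have h4 := le_of_mul_le_mul_right h3 (by positivity)
      simp only [Finset.sdiff_self, Finset.card_empty, Nat.cast_zero, zero_add]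
      linarith) x hxnd hx
    (fun v hv => ⟨Finset.mem_union_right _ (by simpa using hv), fun h => hxQ v hv (hBQ h)⟩) hL.1
    (fun v hv => by
      have := Finset.mem_sdiff.1 (hL.2.1 v hv)
      exact ⟨Finset.mem_union_left _ this.1, this.2⟩)
    fun P hP => ⟨(hL.2.2 P hP).1, hqk.trans (hL.2.2 P hP).2.1⟩
  refine ⟨l.take ⌈(1 - δ) * Q.card⌉₊, hlnd.sublist (List.take_sublist _ _), fun v hv => ?_, ?_, ?_⟩
  · rcases hlm v (List.mem_of_mem_take hv) with h | h
    · exact (Finset.mem_sdiff.1 (hL.2.1 v h)).1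
    · exact hBQ h
  · refine hlt.of_infix (List.IsPrefix.isInfix ?_)
    exact (List.prefix_append_right_inj _).2 (List.take_prefix _ _)
  · rw [List.length_take, Nat.min_eq_left]
    refine Nat.ceil_le.2 ?_
    have h1 : (L.flatten.length : ℝ) ≤ l.length := by exact_mod_cast hll
    nlinarith

end AlmostSpanning

section CountingTightLists

lemma le_typicalCodegree {κ g : ℝ} (hg : 0 ≤ g) (n : ℕ) :
    1 / 2 + (κ - g) ≤ typicalCodegree κ g n := by
  have : (n : ℝ) ^ (-(1 / 4 : ℝ)) ≤ 1 := by
    rcases Nat.eq_zero_or_pos n with rfl | hn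
    · rw [Nat.cast_zero, Real.zero_rpow (by norm_num)]; exact zero_le_one
    · exact Real.rpow_le_one_of_one_le_of_nonpos (by exact_mod_cast hn) (by norm_num)
  simp only [typicalCodegree]
  nlinarith

lemma Tight.append_of_drop {V : Type*} [DecidableEq V] {E : Finset (Finset V)} {k : ℕ}
    {x l l' : List V} (h : Tight E k (x ++ l)) (h' : Tight E k (l.drop (l.length - (k - 1)) ++ l'))
    (hl : k - 1 ≤ l.length) : Tight E k (x ++ (l ++ l')) := by
  have := Tight.glue (p := x ++ l.take (l.length - (k - 1))) (q := l.drop (l.length - (k - 1)))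
    (r := l') (by rwa [List.append_assoc, List.take_append_drop]) h' (by simp; omega)
  rwa [List.append_assoc x, List.take_append_drop, List.append_assoc] at this

/-- If every list in a family of lists of equal length has many continuations, then there are many
concatenations. -/
lemma exists_append_family {V : Type*} [DecidableEq V] (P : Finset (List V)) {m : ℕ} {N : ℝ}
    (hP : ∀ l ∈ P, l.length = m) (Q : List V → List V → Prop)
    (h : ∀ l ∈ P, ∃ R : Finset (List V), N ≤ R.card ∧ ∀ r ∈ R, Q l r) :
    ∃ R : Finset (List V), P.card * N ≤ R.card ∧ ∀ r ∈ R, ∃ l ∈ P, ∃ l', Q l l' ∧ r = l ++ l' := by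
  choose! f hf hfQ using h
  refine ⟨P.biUnion fun l => (f l).image (l ++ ·), ?_, fun r hr => ?_⟩
  · rw [Finset.card_biUnion]
    · push_cast
      rw [← nsmul_eq_mul]
      refine Finset.card_nsmul_le_sum _ _ _ fun l hl => ?_
      rw [Finset.card_image_of_injective _ (List.append_right_injective l)]
      exact hf l hl
    · intro a ha b hb hab
      rw [Function.onFun, Finset.disjoint_left]
      intro r hr hr'
      obtain ⟨c, -, rfl⟩ := Finset.mem_image.1 hr
      obtain ⟨d, -, hd⟩ := Finset.mem_image.1 hr'
      exact hab (List.append_inj hd ((hP b hb).trans (hP a ha).symm)).1.symm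
  · obtain ⟨l, hl, hr⟩ := Finset.mem_biUnion.1 hr
    obtain ⟨l', hl', rfl⟩ := Finset.mem_image.1 hr
    exact ⟨l, hl, l', hfQ l hl _ hl', rfl⟩

/-- If for each `A` in a family of subsets of `U` there are many lists of length `m` on `U` whose
first `r` entries are in `A` and whose other entries are not, then there are many lists in total. -/
lemma exists_union_family {V : Type*} [DecidableEq V] {U : Finset V} (𝓐 : Finset (Finset V))
    {m r : ℕ} {N : ℝ} (Q : List V → Prop) (h𝓐 : ∀ A ∈ 𝓐, A ⊆ U) (h : ∀ A ∈ 𝓐, ∃ R : Finset (List V),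
      N ≤ R.card ∧ ∀ l ∈ R, l.Nodup ∧ l.length = m ∧ (∀ v ∈ l, v ∈ U) ∧ (∀ v ∈ l.take r, v ∈ A) ∧
        (∀ v ∈ l.drop r, v ∉ A) ∧ Q l) :
    ∃ R : Finset (List V), 𝓐.card * N ≤ R.card * 2 ^ (U.card - m) ∧
      ∀ l ∈ R, l.Nodup ∧ l.length = m ∧ (∀ v ∈ l, v ∈ U) ∧ Q l := by
  choose! f hf hfQ using h
  refine ⟨𝓐.biUnion f, ?_, fun l hl => ?_⟩
  · have h1 : 𝓐.card * N ≤ ∑ A ∈ 𝓐, ((f A).card : ℝ) := by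
      rw [← nsmul_eq_mul]
      exact Finset.card_nsmul_le_sum _ _ _ hf
    refine h1.trans ?_
    have h2 : ∑ A ∈ 𝓐, (f A).card = ∑ l ∈ 𝓐.biUnion f, (𝓐.filter (l ∈ f ·)).card := by
      refine Eq.trans ?_
        (Finset.sum_card_bipartiteAbove_eq_sum_card_bipartiteBelow (fun A l => l ∈ f A))
      refine Finset.sum_congr rfl fun A hA => congrArg _ ?_
      ext l
      simp only [Finset.bipartiteAbove, Finset.mem_filter, Finset.mem_biUnion]
      exact ⟨fun h => ⟨⟨A, hA, h⟩, h⟩, And.right⟩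
    have h3 : ∑ l ∈ 𝓐.biUnion f, (𝓐.filter (l ∈ f ·)).card ≤
        (𝓐.biUnion f).card • 2 ^ (U.card - m) := by
      refine Finset.sum_le_card_nsmul _ _ _ fun l hl => ?_
      obtain ⟨A₀, hA₀, hl⟩ := Finset.mem_biUnion.1 hl
      obtain ⟨hnd, hm, hU, -⟩ := hfQ A₀ hA₀ l hl
      have hc : (U \ l.toFinset).card = U.card - m := by
        rw [Finset.card_sdiff_of_subset (fun v hv => hU v (by simpa using hv)),
          List.toFinset_card_of_nodup hnd, hm]
      rw [← hc, ← Finset.card_powerset]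
      refine Finset.card_le_card_of_injOn (· \ l.toFinset) (fun A hA => ?_) fun A hA B hB hAB => ?_
      · simp only [Finset.mem_coe, Finset.mem_filter] at hA
        exact Finset.mem_coe.2
          (Finset.mem_powerset.2 (Finset.sdiff_subset_sdiff (h𝓐 A hA.1) subset_rfl))
      · simp only [Finset.mem_coe, Finset.mem_filter] at hA hB
        have key : ∀ C ∈ 𝓐, l ∈ f C → ∀ v ∈ l, v ∈ C ↔ v ∈ l.take r := fun C hC hl v hv => by
          obtain ⟨-, -, -, ht, hd, -⟩ := hfQ C hC l hl
          refine ⟨fun h => ?_, ht v⟩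
          rw [← List.take_append_drop r l, List.mem_append] at hv
          exact hv.resolve_right fun h' => hd v h' h
        ext v
        by_cases hv : v ∈ l
        · rw [key A hA.1 hA.2 v hv, key B hB.1 hB.2 v hv]
        · have := congrArg (v ∈ ·) hAB
          simpa [hv] using this
    rw [← h2] at h3
    rw [smul_eq_mul] at h3
    exact_mod_cast h3
  · obtain ⟨A, hA, hl⟩ := Finset.mem_biUnion.1 hl
    obtain ⟨h1, h2, h3, -, -, h4⟩ := hfQ A hA l hl
    exact ⟨h1, h2, h3, h4⟩

lemma exp_le_of_doubling {N a D s n : ℝ} {h m : ℕ}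
    (hN : Real.exp (a - D * (2 * 2 ^ h - h - 2)) ≤ N)
    (hs : 1 ≤ s) (hn : n = s * 2 ^ (h + 1)) (hD : Real.log (4 * s) + 1 ≤ D) :
    Real.exp (2 * a + m * Real.log 2 - D * (2 * 2 ^ (h + 1) - (h + 1) - 2)) * (2 * (n + 1)) ≤
      2 ^ m * (N * N) := by
  have h2 : (1 : ℝ) ≤ 2 ^ (h + 1) := one_le_pow₀ (by norm_num)
  have hn1 : 1 ≤ n := hn ▸ by nlinarith
  have h3 : 2 * (n + 1) ≤ Real.exp ((h + 1) * D) := by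
    rw [← Real.log_le_iff_le_exp (by positivity)]
    calc Real.log (2 * (n + 1)) ≤ Real.log (4 * s * 2 ^ (h + 1)) :=
          Real.log_le_log (by positivity) (by rw [mul_assoc, ← hn]; linarith)
      _ = Real.log (4 * s) + (h + 1) * Real.log 2 := by
          rw [Real.log_mul (by positivity) (by positivity), Real.log_pow]; push_cast; rfl
      _ ≤ (h + 1) * D := by
          have h4 := Real.log_two_lt_d9
          have h5 : 0 ≤ Real.log (4 * s) := Real.log_nonneg (by linarith)
          have h6 : (0 : ℝ) ≤ h := Nat.cast_nonneg h
          nlinarith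
  have h4 : (2 : ℝ) ^ m = Real.exp (m * Real.log 2) := by
    rw [Real.exp_nat_mul, Real.exp_log (by norm_num)]
  calc _ ≤ Real.exp (2 * a + m * Real.log 2 - D * (2 * 2 ^ (h + 1) - (h + 1) - 2)) *
        Real.exp ((h + 1) * D) := by gcongr
    _ = Real.exp (m * Real.log 2) * (Real.exp (a - D * (2 * 2 ^ h - h - 2)) *
          Real.exp (a - D * (2 * 2 ^ h - h - 2))) := by
        rw [← Real.exp_add, ← Real.exp_add, ← Real.exp_add, pow_succ]
        ring_nf
    _ ≤ _ := by
        rw [h4]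
        have h5 := (Real.exp_pos (a - D * (2 * 2 ^ h - h - 2))).le
        exact mul_le_mul_of_nonneg_left (mul_le_mul hN hN h5 (h5.trans hN)) (Real.exp_pos _).le

/-- A typical set whose size is a constant times a power of two contains many almost spanning
tight lists of the same length, starting from any prescribed tuple. -/
lemma exists_many_almost_spanning (k : ℕ) (hk : 2 ≤ k) {κ g δ : ℝ} (hg : 0 < g) (hgκ : g < κ)
    (hκ : κ - g ≤ 1) (hδ : 0 < δ) (hδ1 : δ < 1) :
    ∃ s₀ : ℕ, ∀ s ≥ s₀, ∀ {V : Type} [DecidableEq V] (E : Finset (Finset V)),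
      (∀ e ∈ E, e.card = k) → ∀ (h : ℕ) (U : Finset V) (x : List V), U.card = s * 2 ^ h →
      x.Nodup → x.length = k - 1 → (∀ v ∈ x, v ∉ U) →
      CodegreeGE E k (U ∪ x.toFinset) U (typicalCodegree κ g U.card) →
      ∃ R : Finset (List V), Real.exp (Real.log 2 * ⌈(1 - δ) * s⌉₊ * (h * 2 ^ h) -
          (Real.log (4 * s) + 1) * (2 * 2 ^ h - h - 2)) ≤ R.card ∧
        ∀ l ∈ R, l.Nodup ∧ l.length = ⌈(1 - δ) * s⌉₊ * 2 ^ h ∧ (∀ v ∈ l, v ∈ U) ∧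
          Tight E k (x ++ l) := by
  obtain ⟨n₁, hn₁⟩ := exists_almost_spanning_tight k hk (sub_pos.2 hgκ) hκ hδ
  obtain ⟨n₂, hn₂⟩ := exists_many_typical_halves k 2 (hg.trans hgκ).le hg
  obtain ⟨n₃, hn₃⟩ := exists_nat_ge (k / (1 - δ))
  refine ⟨max (max n₁ n₂) (max n₃ k), fun s hs V _ E hE h => ?_⟩
  set m := ⌈(1 - δ) * s⌉₊ with hm
  have hms : m ≤ s := Nat.ceil_le.2 (by nlinarith [(Nat.cast_nonneg s : (0 : ℝ) ≤ s)])
  have hkm : k ≤ m := by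
    have h1 : (n₃ : ℝ) ≤ s := by exact_mod_cast (by omega : n₃ ≤ s)
    have h2 := hn₃.trans h1
    rw [div_le_iff₀ (by linarith)] at h2
    have h3 := Nat.le_ceil ((1 - δ) * s)
    rw [← hm] at h3
    have : (k : ℝ) ≤ m := by linarith
    exact_mod_cast this
  induction h with
  | zero =>
    intro U x hU hxnd hx hxU hdeg
    obtain ⟨l, hlnd, hlU, hlt, hll⟩ := hn₁ E hE U x (by omega) hxnd hx hxU
      (hdeg.mono subset_rfl (le_typicalCodegree hg.le _))
    refine ⟨{l}, by simp, fun l' hl' => ?_⟩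
    rw [Finset.mem_singleton.1 hl']
    refine ⟨hlnd, ?_, hlU, hlt⟩
    rw [hll, hU]
    simp [hm]
  | succ h ih =>
    intro U x hU hxnd hx hxU hdeg
    set N : ℝ := Real.exp (Real.log 2 * m * (h * 2 ^ h) -
          (Real.log (4 * s) + 1) * (2 * 2 ^ h - h - 2)) with hN
    have hpow : 1 ≤ 2 ^ h := Nat.one_le_two_pow
    have hU2 : U.card = 2 * (s * 2 ^ h) := by rw [hU]; ring
    have hs1 : s ≤ s * 2 ^ h := Nat.le_mul_of_pos_right _ hpow
    have hmk : k ≤ m * 2 ^ h := hkm.trans (Nat.le_mul_of_pos_right _ hpow)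
    obtain ⟨𝓐, h𝓐, h𝓐c⟩ := hn₂ E (U ∪ x.toFinset) U (by omega) (by
      have h1 := Finset.card_union_le U x.toFinset
      have h2 := x.toFinset_card_le
      omega) hdeg
    have hex := exists_union_family (U := U) (m := m * 2 ^ (h + 1)) (r := m * 2 ^ h) 𝓐 (N := N * N)
      (fun l => Tight E k (x ++ l)) (fun A hA => (h𝓐 A hA).1) ?_
    · obtain ⟨R, hR, hRl⟩ := hex
      refine ⟨R, ?_, fun l hl => ?_⟩
      · have key := exp_le_of_doubling (m := m * 2 ^ (h + 1)) (s := s) (n := U.card) hN.ge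
          (by exact_mod_cast (by omega : 1 ≤ s)) (by rw [hU]; push_cast; rfl) le_rfl
        have hmU : m * 2 ^ (h + 1) ≤ U.card := hU ▸ Nat.mul_le_mul_right _ hms
        have h1 := (mul_le_mul_of_nonneg_right h𝓐c (by positivity : 0 ≤ N * N)).trans hR
        have h2 : (2 : ℝ) ^ U.card = 2 ^ (m * 2 ^ (h + 1)) * 2 ^ (U.card - m * 2 ^ (h + 1)) := by
          rw [← pow_add, Nat.add_sub_cancel' hmU]
        rw [h2, div_mul_eq_mul_div, div_le_iff₀ (by positivity), mul_right_comm _ _ (N * N)] at h1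
        rw [mul_right_comm (R.card : ℝ)] at h1
        have h3 := key.trans (le_of_mul_le_mul_right h1 (by positivity))
        refine le_trans (le_of_eq ?_) (le_of_mul_le_mul_right h3 (by positivity))
        push_cast
        ring_nf
      · obtain ⟨h1, h2, h3, h4⟩ := hRl l hl
        exact ⟨h1, h2, h3, h4⟩
    · intro A hA
      obtain ⟨hAU, hAc, hA1, hA2⟩ := h𝓐 A hA
      have hAc' : A.card = s * 2 ^ h := by omega
      have hBc : (U \ A).card = s * 2 ^ h := by
        rw [Finset.card_sdiff_of_subset hAU]; omega
      have hBU : U \ A ⊆ U := Finset.sdiff_subset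
      obtain ⟨P, hPc, hP⟩ := ih A x hAc' hxnd hx (fun v hv h => hxU v hv (hAU h))
        (hA1.mono (Finset.union_subset_union hAU subset_rfl) le_rfl)
      obtain ⟨R, hR, hRl⟩ := exists_append_family P (fun l hl => (hP l hl).2.1)
        (fun l r => r.Nodup ∧ r.length = m * 2 ^ h ∧ (∀ v ∈ r, v ∈ U \ A) ∧
          Tight E k (l.drop (l.length - (k - 1)) ++ r)) fun l hl => by
        obtain ⟨hlnd, hll, hlA, hlt⟩ := hP l hl
        have hdrop : ∀ v ∈ l.drop (l.length - (k - 1)), v ∈ A := fun v hv =>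
          hlA v (List.mem_of_mem_drop hv)
        exact ih (U \ A) (l.drop (l.length - (k - 1))) hBc (hlnd.sublist (List.drop_sublist _ _))
          (by simp; omega) (fun v hv h => (Finset.mem_sdiff.1 h).2 (hdrop v hv))
          (hA2.mono (Finset.union_subset (hBU.trans Finset.subset_union_left) fun v hv =>
            Finset.mem_union_left _ (hAU (hdrop v (by simpa using hv)))) le_rfl)
      refine ⟨R, (mul_le_mul_of_nonneg_right hPc (Real.exp_pos _).le).trans hR, fun r hr => ?_⟩
      obtain ⟨l, hl, l', ⟨hnd', hl', hlU', hlt'⟩, rfl⟩ := hRl r hr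
      obtain ⟨hlnd, hll, hlA, hlt⟩ := hP l hl
      refine ⟨List.nodup_append.2 ⟨hlnd, hnd', ?_⟩, ?_, ?_, ?_, ?_, ?_⟩
      · rintro v hv _ hv' rfl
        exact (Finset.mem_sdiff.1 (hlU' v hv')).2 (hlA v hv)
      · rw [List.length_append, hll, hl']; ring
      · intro v hv
        rcases List.mem_append.1 hv with hv | hv
        · exact hAU (hlA v hv)
        · exact hBU (hlU' v hv)
      · rw [← hll, List.take_left]; exact hlA
      · rw [← hll, List.drop_left]; exact fun v hv => (Finset.mem_sdiff.1 (hlU' v hv)).2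
      · exact hlt.append_of_drop hlt' (by omega)

end CountingTightLists

section AlmostSpanningFamily

lemma exists_mul_two_pow {s₀ q : ℕ} (hs₀ : 0 < s₀) (hq : s₀ ≤ q) :
    ∃ s h : ℕ, s₀ ≤ s ∧ s ≤ 2 * s₀ ∧ s * 2 ^ h ≤ q ∧ q ≤ (s + 1) * 2 ^ h := by
  have h1 : 2 ^ Nat.log 2 (q / s₀) ≤ q / s₀ :=
    Nat.pow_log_le_self 2 (Nat.div_pos hq hs₀).ne'
  have h2 : q / s₀ < 2 ^ (Nat.log 2 (q / s₀) + 1) := Nat.lt_pow_succ_log_self one_lt_two _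
  set h := Nat.log 2 (q / s₀)
  have hpos : 0 < 2 ^ h := by positivity
  rw [Nat.le_div_iff_mul_le hs₀] at h1
  rw [Nat.div_lt_iff_lt_mul hs₀] at h2
  refine ⟨q / 2 ^ h, h, ?_, ?_, Nat.div_mul_le_self _ _, ?_⟩
  · rw [Nat.le_div_iff_mul_le hpos]; linarith
  · refine (Nat.div_lt_iff_lt_mul hpos).2 (h2.trans_le (le_of_eq ?_)) |>.le
    rw [pow_succ]; ring
  · exact (Nat.lt_mul_of_div_lt (Nat.lt_succ_self _) hpos).le.trans (by rw [mul_comm])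

lemma mul_log_sub_le {s₀ s q m : ℝ} {h : ℕ} (hs : 1 ≤ s) (hs₀ : s ≤ 2 * s₀) (hq : 0 < q)
    (hqs : q ≤ (s + 1) * 2 ^ h) (hm : 1 ≤ m) :
    m * 2 ^ h * Real.log q - 3 * (Real.log (8 * s₀) + 1) * (m * 2 ^ h) ≤
      Real.log 2 * m * (h * 2 ^ h) - (Real.log (4 * s) + 1) * (2 * 2 ^ h - h - 2) := by
  have h1 : Real.log q ≤ Real.log (4 * s) + h * Real.log 2 := by
    rw [← Real.log_pow, ← Real.log_mul (by positivity) (by positivity)]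
    refine Real.log_le_log hq (hqs.trans ?_)
    gcongr; linarith
  have h2 : Real.log (4 * s) ≤ Real.log (8 * s₀) :=
    Real.log_le_log (by positivity) (by linarith)
  have h3 : 0 ≤ Real.log (4 * s) := Real.log_nonneg (by linarith)
  have h4 : (0 : ℝ) < 2 ^ h := by positivity
  have h5 : (2 : ℝ) ^ h ≤ m * 2 ^ h := by nlinarith
  have h6 : 0 ≤ (Real.log (4 * s) + 1) * (h + 2) := by positivity
  have h7 := mul_le_mul_of_nonneg_left h1 (h4.le.trans h5)
  have h8 := mul_le_mul_of_nonneg_left h5 (by positivity : 0 ≤ 2 * (Real.log (4 * s) + 1))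
  have h9 := mul_le_mul_of_nonneg_right h2 (h4.le.trans h5)
  nlinarith

/-- Every large set `Q` has a subset `U`, containing almost all of `Q`, such that if `U` is typical
then it contains many almost spanning tight lists of the same length. -/
lemma exists_subset_many_almost_spanning (k : ℕ) (hk : 2 ≤ k) {κ g δ : ℝ} (hg : 0 < g)
    (hgκ : g < κ) (hκ : κ - g ≤ 1) (hδ : 0 < δ) (hδ1 : δ < 1) (a : ℕ) :
    ∃ (n₀ : ℕ) (C : ℝ), ∀ {V : Type} [DecidableEq V] (E : Finset (Finset V)),
      (∀ e ∈ E, e.card = k) → ∀ Q : Finset V, n₀ ≤ Q.card → ∃ U ⊆ Q, a * (Q \ U).card ≤ Q.card ∧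
      ∀ x : List V, x.Nodup → x.length = k - 1 → (∀ v ∈ x, v ∉ U) →
      CodegreeGE E k (U ∪ x.toFinset) U (typicalCodegree κ g U.card) →
      ∃ (R : Finset (List V)) (c : ℕ), Real.exp (c * Real.log Q.card - C * c) ≤ R.card ∧
        (1 - δ) * U.card ≤ c ∧ k ≤ c ∧
        ∀ l ∈ R, l.Nodup ∧ l.length = c ∧ (∀ v ∈ l, v ∈ U) ∧ Tight E k (x ++ l) := by
  obtain ⟨s₁, hs₁⟩ := exists_many_almost_spanning k hk hg hgκ hκ hδ hδ1
  obtain ⟨n₃, hn₃⟩ := exists_nat_ge (k / (1 - δ))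
  set s₀ := max (max s₁ n₃) (max a 1)
  refine ⟨s₀, 3 * (Real.log (8 * s₀) + 1), fun {V} _ E hE Q hQ => ?_⟩
  obtain ⟨s, h, hs, hs', hsQ, hQs⟩ := exists_mul_two_pow (by omega) hQ
  obtain ⟨U, hUQ, hU⟩ := Finset.exists_subset_card_eq hsQ
  refine ⟨U, hUQ, ?_, fun x hxnd hx hxU hdeg => ?_⟩
  · have h1 : (Q \ U).card ≤ 2 ^ h := by
      rw [Finset.card_sdiff_of_subset hUQ, hU]
      rw [add_mul] at hQs; omega
    calc a * (Q \ U).card ≤ s * 2 ^ h := Nat.mul_le_mul (by omega) h1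
      _ ≤ _ := hsQ
  · obtain ⟨R, hR, hRl⟩ := hs₁ s (by omega) E hE h U x hU hxnd hx hxU hdeg
    have hkm : k ≤ ⌈(1 - δ) * s⌉₊ := by
      have h1 : (n₃ : ℝ) ≤ s := by exact_mod_cast (by omega : n₃ ≤ s)
      have h2 := hn₃.trans h1
      rw [div_le_iff₀ (by linarith)] at h2
      have h3 := Nat.le_ceil ((1 - δ) * s)
      have : (k : ℝ) ≤ ⌈(1 - δ) * s⌉₊ := by linarith
      exact_mod_cast this
    refine ⟨R, ⌈(1 - δ) * s⌉₊ * 2 ^ h, le_trans (Real.exp_le_exp.2 ?_) hR, ?_,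
      hkm.trans (Nat.le_mul_of_pos_right _ (by positivity)), hRl⟩
    · push_cast
      exact mul_log_sub_le (by exact_mod_cast (by omega : 1 ≤ s)) (by exact_mod_cast hs')
        (by exact_mod_cast (by omega : 0 < Q.card)) (by exact_mod_cast hQs)
        (by exact_mod_cast (by omega : 1 ≤ ⌈(1 - δ) * s⌉₊))
    · rw [hU]
      push_cast
      rw [← mul_assoc]
      gcongr
      exact Nat.le_ceil _

end AlmostSpanningFamily

section ManyTightLists

lemma mul_log_le_add {N c q C C' : ℝ} (hN : 0 < N) (hc : 0 ≤ c) (hcN : c ≤ N) (hq : N ≤ 6 * q)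
    (hC : C' + 1 + Real.log 6 ≤ C) :
    N * Real.log N - C * N ≤
      c * Real.log q - C' * c + ((N - c) * Real.log (N - c) - C * (N - c)) := by
  have h1 : Real.log N ≤ Real.log 6 + Real.log q := by
    rw [← Real.log_mul (by norm_num) (by linarith)]
    exact Real.log_le_log hN hq
  have h2 : (N - c) * Real.log N ≤ (N - c) * Real.log (N - c) + c := by
    rcases hcN.eq_or_lt with rfl | h
    · simpa using hc
    · have h3 : 0 < N - c := sub_pos.2 h
      have h4 := Real.log_le_sub_one_of_pos (div_pos hN h3)
      rw [Real.log_div hN.ne' h3.ne'] at h4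
      have h5 := mul_le_mul_of_nonneg_left h4 h3.le
      have h6 : (N - c) * (N / (N - c) - 1) = c := by field_simp; ring
      linarith
  nlinarith [mul_le_mul_of_nonneg_left h1 hc, mul_le_mul_of_nonneg_left hC hc]

/-- Adding few vertices to a typical set and removing few vertices keeps it typical, with a smaller
codegree constant. -/
lemma CodegreeGE.of_near {V : Type*} [DecidableEq V] {E : Finset (Finset V)} {k : ℕ}
    {Y A L U : Finset V} {γ : ℝ} (hγ : 0 < γ) (hγ1 : γ ≤ 1)
    (h : CodegreeGE E k Y A (typicalCodegree (γ / 2) (γ / 8) A.card)) (hU : U ⊆ A ∪ L)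
    (hL : L.card ≤ γ / 16 * A.card) (hAU : (((A ∪ L) \ U).card : ℝ) ≤ γ / 96 * A.card) :
    CodegreeGE E k Y U (typicalCodegree (γ / 4) (γ / 8) U.card) := fun S hS hSc => by
  have h1 := (h.mono subset_rfl (le_typicalCodegree (by positivity) _)) S hS hSc
  have h2 : typicalCodegree (γ / 4) (γ / 8) U.card ≤ 1 / 2 + γ / 4 := by
    have : 0 ≤ γ / 8 * (U.card : ℝ) ^ (-(1 / 4 : ℝ)) := by positivity
    simp only [typicalCodegree]; linarith
  have h3 := linkIn_card_union_le (E := E) U ((A ∪ L) \ U) S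
  rw [Finset.union_sdiff_of_subset hU] at h3
  have h4 : (linkIn E A S).card ≤ (linkIn E (A ∪ L) S).card :=
    Finset.card_le_card (Finset.filter_subset_filter _ Finset.subset_union_left)
  have h5 : (linkIn E ((A ∪ L) \ U) S).card ≤ ((A ∪ L) \ U).card :=
    Finset.card_le_card (Finset.filter_subset _ _)
  have h6 : ((linkIn E A S).card : ℝ) ≤ (linkIn E U S).card + ((A ∪ L) \ U).card := by
    exact_mod_cast h4.trans (h3.trans (Nat.add_le_add_left h5 _))
  have h7 : (U.card : ℝ) ≤ A.card + L.card := by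
    exact_mod_cast (Finset.card_le_card hU).trans (Finset.card_union_le _ _)
  have h8 : typicalCodegree (γ / 4) (γ / 8) U.card * U.card ≤ (1 / 2 + γ / 4) * U.card :=
    mul_le_mul_of_nonneg_right h2 (Nat.cast_nonneg _)
  nlinarith [(Nat.cast_nonneg A.card : (0 : ℝ) ≤ A.card)]

/-- A typical set together with a few leftover vertices contains many tight lists covering all but
at most `τ` vertices. -/
lemma exists_many_tight_lists (k : ℕ) (hk : 2 ≤ k) {γ : ℝ} (hγ : 0 < γ) (hγ1 : γ ≤ 1) :
    ∃ (τ₀ : ℕ) (C : ℝ), 0 ≤ C ∧ ∀ τ ≥ τ₀, ∀ {V : Type} [DecidableEq V] (E : Finset (Finset V)),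
      (∀ e ∈ E, e.card = k) → ∀ (N : ℕ) (L W : Finset V) (x : List V), Disjoint L W →
      L.card + W.card = N → (L.card : ℝ) ≤ γ / 48 * W.card → x.Nodup → x.length = k - 1 →
      (∀ v ∈ x, v ∉ L ∪ W) →
      CodegreeGE E k (L ∪ W ∪ x.toFinset) W (typicalCodegree (γ / 2) (γ / 8) W.card) →
      ∃ R : Finset (List V), Real.exp (N * Real.log N - C * N - τ * Real.log τ) ≤ R.card ∧
        ∀ l ∈ R, l.Nodup ∧ (∀ v ∈ l, v ∈ L ∪ W) ∧ Tight E k (x ++ l) ∧ N ≤ l.length + τ := by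
  obtain ⟨a, ha⟩ := exists_nat_ge (192 / γ)
  obtain ⟨n₀, C', hn₀⟩ := exists_subset_many_almost_spanning k hk (g := γ / 8) (κ := γ / 4)
    (δ := γ / 192) (by positivity) (by linarith) (by linarith) (by positivity) (by linarith) a
  obtain ⟨n₂, hn₂⟩ := exists_many_typical_halves k 3 (κ := γ / 2) (g := γ / 8) (by positivity)
    (by positivity)
  set C := max 0 (C' + 1 + Real.log 6)
  have hC0 : 0 ≤ C := le_max_left _ _
  refine ⟨max (max (2 * n₂) (6 * n₀)) (max (2 * k) 4), C, hC0, fun τ hτ {V} _ E hE N => ?_⟩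
  rw [div_le_iff₀ hγ] at ha
  induction N using Nat.strong_induction_on with
  | _ N ih =>
  intro L W x hLW hN hL hxnd hx hxLW hdeg
  rcases le_or_gt N τ with hNτ | hNτ
  · refine ⟨{[]}, ?_, fun l hl => ?_⟩
    · rw [Finset.card_singleton, Nat.cast_one, Real.exp_le_one_iff]
      have h1 : (N : ℝ) * Real.log N ≤ τ * Real.log τ := by
        rcases Nat.eq_zero_or_pos N with rfl | h
        · have := Real.log_natCast_nonneg τ
          simp only [Nat.cast_zero, zero_mul]; positivity
        · have h2 : (1 : ℝ) ≤ N := by exact_mod_cast h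
          have h3 : (N : ℝ) ≤ τ := by exact_mod_cast hNτ
          exact mul_le_mul h3 (Real.log_le_log (by linarith) h3) (Real.log_nonneg h2) (by linarith)
      have h2 : 0 ≤ C * N := by positivity
      linarith
    · rw [Finset.mem_singleton.1 hl]
      exact ⟨List.nodup_nil, by simp, tight_of_length_lt (by simp [hx]; omega), by simpa using hNτ⟩
  have hLW' : L.card ≤ W.card := by
    have : (L.card : ℝ) ≤ W.card := by nlinarith [(Nat.cast_nonneg W.card : (0 : ℝ) ≤ W.card)]
    exact_mod_cast this
  obtain ⟨A, hAW, hAc, hA1, hA2⟩ : ∃ A ⊆ W, A.card = W.card / 2 ∧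
      CodegreeGE E k (L ∪ W ∪ x.toFinset) A (typicalCodegree (γ / 2) (γ / 8) A.card) ∧
      CodegreeGE E k (L ∪ W ∪ x.toFinset) (W \ A)
        (typicalCodegree (γ / 2) (γ / 8) (W \ A).card) := by
    obtain ⟨𝓐, h𝓐, hc⟩ := hn₂ E (L ∪ W ∪ x.toFinset) W (by omega) (by
      have h1 := Finset.card_union_le (L ∪ W) x.toFinset
      have h2 := Finset.card_union_le L W
      have h3 := x.toFinset_card_le
      omega) hdeg
    have h0 : (0 : ℝ) < 𝓐.card := lt_of_lt_of_le (by positivity) hc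
    obtain ⟨A, hA⟩ := Finset.card_pos.1 (show 0 < 𝓐.card by exact_mod_cast h0)
    exact ⟨A, h𝓐 A hA⟩
  have hW3 : (W.card : ℝ) ≤ 3 * A.card := by exact_mod_cast (by omega : W.card ≤ 3 * A.card)
  have hBc : (W \ A).card = W.card - W.card / 2 := by rw [Finset.card_sdiff_of_subset hAW, hAc]
  have hB2 : (W.card : ℝ) ≤ 2 * (W \ A).card := by
    exact_mod_cast (by omega : W.card ≤ 2 * (W \ A).card)
  have hA2' : 2 * (A.card : ℝ) ≤ W.card := by exact_mod_cast (by omega : 2 * A.card ≤ W.card)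
  have hAL : Disjoint A L := (hLW.mono_right hAW).symm
  have hQc : (A ∪ L).card = A.card + L.card := Finset.card_union_of_disjoint hAL
  obtain ⟨U, hUQ, haU, hU⟩ := hn₀ E hE (A ∪ L) (by omega)
  have hQY : A ∪ L ⊆ L ∪ W := Finset.union_subset (hAW.trans Finset.subset_union_right)
    Finset.subset_union_left
  have hQcR : ((A ∪ L).card : ℝ) = A.card + L.card := by exact_mod_cast hQc
  have hρ : ((A ∪ L) \ U).card * 192 ≤ γ * (A ∪ L).card := by
    have h1 : (a : ℝ) * ((A ∪ L) \ U).card ≤ (A ∪ L).card := by exact_mod_cast haU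
    nlinarith [mul_le_mul_of_nonneg_right ha (Nat.cast_nonneg ((A ∪ L) \ U).card)]
  have hQ2 : ((A ∪ L).card : ℝ) ≤ 2 * A.card := by nlinarith
  obtain ⟨P, c, hPc, hUc, hkc, hP⟩ := hU x hxnd hx
    (fun v hv h => hxLW v hv (hQY (hUQ h)))
    ((hA1.of_near hγ hγ1 hUQ (by nlinarith) (by nlinarith)).mono
      (Finset.union_subset_union (hUQ.trans hQY) subset_rfl) le_rfl)
  have hUρ : (U.card : ℝ) + ((A ∪ L) \ U).card = (A ∪ L).card := by
    rw [add_comm]; exact_mod_cast Finset.card_sdiff_add_card_eq_card hUQ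
  by_cases hPe : P.Nonempty
  swap
  · rw [Finset.not_nonempty_iff_eq_empty.1 hPe] at hPc
    exact absurd hPc (by simpa using Real.exp_pos _)
  have hcU : c ≤ U.card := by
    obtain ⟨l, hl⟩ := hPe
    obtain ⟨h1, h2, h3, -⟩ := hP l hl
    rw [← h2, ← List.toFinset_card_of_nodup h1]
    exact Finset.card_le_card fun v hv => h3 v (by simpa using hv)
  have hcQ : c ≤ (A ∪ L).card := hcU.trans (Finset.card_le_card hUQ)
  obtain ⟨R, hR, hRl⟩ := exists_append_family P (fun l hl => (hP l hl).2.1)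
    (fun l r => r.Nodup ∧ (∀ v ∈ r, v ∈ (A ∪ L) \ l.toFinset ∪ W \ A) ∧
      Tight E k (l.drop (l.length - (k - 1)) ++ r) ∧ N - c ≤ r.length + τ) fun l hl => by
    obtain ⟨hlnd, hll, hlU, hlt⟩ := hP l hl
    have hlQ : l.toFinset ⊆ A ∪ L := fun v hv => hUQ (hlU v (by simpa using hv))
    have hL' : ((A ∪ L) \ l.toFinset).card = (A ∪ L).card - c := by
      rw [Finset.card_sdiff_of_subset hlQ, List.toFinset_card_of_nodup hlnd, hll]
    have hsub : (A ∪ L) \ l.toFinset ∪ W \ A ⊆ L ∪ W := Finset.union_subset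
      (Finset.sdiff_subset.trans hQY) (Finset.sdiff_subset.trans Finset.subset_union_right)
    have hdrop : ∀ v ∈ l.drop (l.length - (k - 1)), v ∈ l := fun v hv => List.mem_of_mem_drop hv
    refine ih (N - c) (by omega) ((A ∪ L) \ l.toFinset) (W \ A)
      (l.drop (l.length - (k - 1))) ?_ (by omega) ?_ (hlnd.sublist (List.drop_sublist _ _))
      (by simp; omega) (fun v hv h => ?_) (hA2.mono ?_ le_rfl)
    · refine Finset.disjoint_of_subset_left Finset.sdiff_subset (Finset.disjoint_union_left.2
        ⟨Finset.disjoint_sdiff, hLW.mono_right Finset.sdiff_subset⟩)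
    · rw [hL', Nat.cast_sub hcQ]
      nlinarith
    · have h1 := hdrop v hv
      rcases Finset.mem_union.1 h with h | h
      · exact (Finset.mem_sdiff.1 h).2 (by simpa using h1)
      · rcases Finset.mem_union.1 (hUQ (hlU v h1)) with h2 | h2
        · exact (Finset.mem_sdiff.1 h).2 h2
        · exact Finset.disjoint_left.1 hLW h2 (Finset.mem_sdiff.1 h).1
    · refine Finset.union_subset (hsub.trans Finset.subset_union_left) fun v hv => ?_
      exact Finset.mem_union_left _ (hQY (hlQ (by simpa using hdrop v (by simpa using hv))))
  refine ⟨R, ?_, fun r hr => ?_⟩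
  · refine le_trans ?_ ((mul_le_mul_of_nonneg_right hPc (Real.exp_pos _).le).trans hR)
    rw [← Real.exp_add, Real.exp_le_exp]
    have hNc : c ≤ N := by omega
    have hNR : (L.card + W.card : ℝ) = N := by exact_mod_cast hN
    have := mul_log_le_add (N := N) (c := c) (q := (A ∪ L).card) (C := C) (C' := C')
      (by exact_mod_cast (by omega : 0 < N)) (by positivity) (by exact_mod_cast hNc)
      (by nlinarith) (le_max_right _ _)
    rw [Nat.cast_sub hNc]
    linarith
  · obtain ⟨l, hl, l', ⟨hnd', hlQ', hlt', hlen'⟩, rfl⟩ := hRl r hr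
    obtain ⟨hlnd, hll, hlU, hlt⟩ := hP l hl
    refine ⟨List.nodup_append.2 ⟨hlnd, hnd', ?_⟩, fun v hv => ?_, hlt.append_of_drop hlt' (by omega),
      by rw [List.length_append]; omega⟩
    · rintro v hv _ hv' rfl
      rcases Finset.mem_union.1 (hlQ' v hv') with h | h
      · exact (Finset.mem_sdiff.1 h).2 (by simpa using hv)
      · rcases Finset.mem_union.1 (hUQ (hlU v hv)) with h2 | h2
        · exact (Finset.mem_sdiff.1 h).2 h2
        · exact Finset.disjoint_left.1 hLW h2 (Finset.mem_sdiff.1 h).1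
    · rcases List.mem_append.1 hv with hv | hv
      · exact hQY (hUQ (hlU v hv))
      · rcases Finset.mem_union.1 (hlQ' v hv) with h | h
        · exact hQY (Finset.mem_sdiff.1 h).1
        · exact Finset.mem_union_right _ (Finset.mem_sdiff.1 h).1

end ManyTightLists

section Windows

variable {V : Type*} [DecidableEq V]

/-- The sets of `k` consecutive entries of a list. -/
def windows (k : ℕ) (l : List V) : Finset (Finset V) :=
  (Finset.range (l.length - (k - 1))).image fun i => ((l.drop i).take k).toFinset

lemma windows_subset {E : Finset (Finset V)} {k : ℕ} {l : List V} (hk : 0 < k) (hl : Tight E k l) :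
    windows k l ⊆ E := by
  intro e he
  obtain ⟨i, hi, rfl⟩ := Finset.mem_image.1 he
  rw [Finset.mem_range] at hi
  exact hl _ ((List.take_prefix _ _).isInfix.trans (List.drop_suffix _ _).isInfix)
    (by simp; omega)

lemma mem_window_iff {k i : ℕ} {l : List V} {v : V} :
    v ∈ ((l.drop i).take k).toFinset ↔ ∃ j < k, ∃ h : i + j < l.length, l[i + j] = v := by
  rw [List.mem_toFinset, List.mem_iff_getElem]
  constructor
  · rintro ⟨j, hj, rfl⟩
    have hj' := hj
    simp only [List.length_take, List.length_drop] at hj'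
    exact ⟨j, by omega, by omega, by simp⟩
  · rintro ⟨j, hj, h, rfl⟩
    exact ⟨j, by simp; omega, by simp⟩

lemma card_biUnion_filter_windows_le {k : ℕ} {l : List V} (hl : l.Nodup) (v : V) :
    (((windows k l).filter (v ∈ ·)).biUnion id).card ≤ k * k := by
  have h1 : ((windows k l).filter (v ∈ ·)).card ≤ k := by
    by_cases hv : v ∈ l
    · obtain ⟨p, hp, rfl⟩ := List.mem_iff_getElem.1 hv
      calc _ ≤ ((Finset.range k).image fun j => ((l.drop (p - j)).take k).toFinset).card := by
            refine Finset.card_le_card fun e he => ?_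
            obtain ⟨he, hpe⟩ := Finset.mem_filter.1 he
            obtain ⟨i, -, rfl⟩ := Finset.mem_image.1 he
            obtain ⟨j, hj, h, hij⟩ := mem_window_iff.1 hpe
            have : i + j = p := (List.Nodup.getElem_inj_iff hl).1 hij
            refine Finset.mem_image.2 ⟨j, Finset.mem_range.2 hj, ?_⟩
            rw [← this, Nat.add_sub_cancel]
        _ ≤ k := Finset.card_image_le.trans (Finset.card_range k).le
    · rw [Finset.filter_eq_empty_iff.2 fun e he h => hv ?_]
      · simp
      · obtain ⟨i, -, rfl⟩ := Finset.mem_image.1 he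
        obtain ⟨j, -, h, rfl⟩ := mem_window_iff.1 h
        exact List.getElem_mem _
  refine (Finset.card_biUnion_le_card_mul _ _ k fun e he => ?_).trans (Nat.mul_le_mul_right k h1)
  obtain ⟨i, -, rfl⟩ := Finset.mem_image.1 (Finset.mem_filter.1 he).1
  exact (List.toFinset_card_le _).trans (by simp)

lemma isChain_windows {k : ℕ} (hk : 2 ≤ k) {l : List V} (hl : k ≤ l.length) :
    l.IsChain fun a b => a ∈ ((windows k l).filter (b ∈ ·)).biUnion id := by
  rw [List.isChain_iff_getElem]
  intro i hi
  have key : ∀ s, s < l.length - (k - 1) → s ≤ i → i + 1 < s + k →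
      l[i] ∈ ((windows k l).filter (l[i + 1] ∈ ·)).biUnion id := fun s hs hsi his => by
    refine Finset.mem_biUnion.2 ⟨((l.drop s).take k).toFinset, Finset.mem_filter.2
      ⟨Finset.mem_image_of_mem _ (Finset.mem_range.2 hs), mem_window_iff.2 ?_⟩, mem_window_iff.2 ?_⟩
    · exact ⟨i + 1 - s, by omega, by omega, by congr 1; omega⟩
    · exact ⟨i - s, by omega, by omega, by congr 1; omega⟩
  rcases le_total i (l.length - k) with h | h
  · exact key i (by omega) le_rfl (by omega)
  · exact key (l.length - k) (by omega) h (by omega)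

lemma exists_finset_chains [Fintype V] (Nb : V → Finset V) {d : ℕ} (hd : ∀ v, (Nb v).card ≤ d)
    (m : ℕ) : ∃ F : Finset (List V), F.card ≤ Fintype.card V * d ^ m ∧
      ∀ l : List V, l.length = m + 1 → l.IsChain (fun a b => a ∈ Nb b) → l ∈ F := by
  induction m with
  | zero =>
    refine ⟨Finset.univ.image fun v => [v], Finset.card_image_le.trans (by simp), fun l hl _ => ?_⟩
    obtain ⟨v, rfl⟩ := List.length_eq_one_iff.1 hl
    exact Finset.mem_image_of_mem _ (Finset.mem_univ v)
  | succ m ih =>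
    obtain ⟨F, hF, hFm⟩ := ih
    refine ⟨F.biUnion fun l => (l.head?.elim ∅ Nb).image (· :: l), ?_, fun l hl hc => ?_⟩
    · calc _ ≤ F.card * d := Finset.card_biUnion_le_card_mul _ _ _ fun l _ => by
            refine Finset.card_image_le.trans ?_
            cases l.head? with
            | none => simp
            | some v => exact hd v
        _ ≤ Fintype.card V * d ^ m * d := Nat.mul_le_mul_right d hF
        _ = _ := by ring
    · match l, hl with
      | a :: b :: l, hl =>
        rw [List.isChain_cons_cons] at hc
        exact Finset.mem_biUnion.2 ⟨b :: l, hFm _ (by simpa using hl) hc.2,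
          Finset.mem_image_of_mem _ (by simpa using hc.1)⟩

/-- Few duplicate-free lists have the same sets of consecutive entries. -/
lemma card_le_card_image_windows [Fintype V] {k : ℕ} (hk : 2 ≤ k) (R : Finset (List V))
    (hR : ∀ l ∈ R, l.Nodup ∧ k ≤ l.length) :
    R.card ≤ Fintype.card V * (Fintype.card V * (k * k) ^ Fintype.card V) *
      (R.image (windows k)).card := by
  refine Finset.card_le_mul_card_image _ _ fun P hP => ?_
  obtain ⟨l₀, hl₀, rfl⟩ := Finset.mem_image.1 hP
  choose F hF hFm using exists_finset_chains
    (fun v => ((windows k l₀).filter (v ∈ ·)).biUnion id)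
    (card_biUnion_filter_windows_le (hR l₀ hl₀).1)
  calc _ ≤ ((Finset.range (Fintype.card V)).biUnion F).card := by
        refine Finset.card_le_card fun l hl => ?_
        obtain ⟨hlR, hl⟩ := Finset.mem_filter.1 hl
        obtain ⟨hnd, hkl⟩ := hR l hlR
        have hc := isChain_windows hk hkl
        rw [hl] at hc
        have hlen := hnd.length_le_card
        exact Finset.mem_biUnion.2 ⟨l.length - 1, Finset.mem_range.2 (by omega),
          hFm _ l (by omega) hc⟩
    _ ≤ (Finset.range (Fintype.card V)).card * (Fintype.card V * (k * k) ^ Fintype.card V) := by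
        refine Finset.card_biUnion_le_card_mul _ _ _ fun m hm => (hF m).trans ?_
        exact Nat.mul_le_mul_left _ (Nat.pow_le_pow_right (Nat.mul_pos (by omega) (by omega))
          (Finset.mem_range.1 hm).le)
    _ = _ := by rw [Finset.card_range]

end Windows

section Main

lemma windows_mem_longTightPaths {n k : ℕ} (hk : 0 < k) {E : Finset (Finset (Fin n))}
    {l : List (Fin n)} (hl : l.Nodup) (ht : Tight E k l)
    (hlen : (n : ℝ) - (n : ℝ) ^ ((7 : ℝ) / 8) ≤ (l.length : ℝ) - ((k : ℝ) - 1)) :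
    windows k l ∈ longTightPaths n k E := by
  refine Finset.mem_filter.2 ⟨Finset.mem_powerset.2 (windows_subset hk ht), l.length, l.get,
    List.nodup_iff_injective_get.1 hl, hlen, ?_⟩
  have key : ∀ i (hi : i < l.length - (k - 1)), ((l.drop i).take k).toFinset =
      Finset.univ.image fun j : Fin k => l.get ⟨i + j, by have := j.isLt; omega⟩ := fun i hi => by
    ext v
    rw [mem_window_iff, Finset.mem_image]
    constructor
    · rintro ⟨j, hj, h, rfl⟩
      exact ⟨⟨j, hj⟩, Finset.mem_univ _, rfl⟩
    · rintro ⟨j, -, rfl⟩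
      exact ⟨j, j.isLt, by have := j.isLt; omega, rfl⟩
  ext e
  simp only [windows, Finset.mem_image, Finset.mem_range, Finset.mem_univ, true_and]
  constructor
  · rintro ⟨i, hi, rfl⟩
    exact ⟨⟨i, hi⟩, by rw [key i hi]⟩
  · rintro ⟨i, rfl⟩
    exact ⟨i, i.isLt, by rw [key i i.isLt]⟩

lemma card_filter_subset_le_linkIn {V : Type*} [Fintype V] [DecidableEq V]
    {E : Finset (Finset V)} {k : ℕ} (hk : 0 < k) (hE : ∀ e ∈ E, e.card = k) {S : Finset V}
    (hS : S.card = k - 1) : (E.filter (S ⊆ ·)).card ≤ (linkIn E Finset.univ S).card := by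
  refine (Finset.card_le_card fun e he => ?_).trans
    (Finset.card_image_le (s := linkIn E Finset.univ S) (f := (insert · S)))
  obtain ⟨heE, hSe⟩ := Finset.mem_filter.1 he
  obtain ⟨v, hv⟩ : (e \ S).Nonempty := by
    rw [← Finset.card_pos, Finset.card_sdiff_of_subset hSe, hE e heE]; omega
  rw [Finset.mem_sdiff] at hv
  have : insert v S = e := Finset.eq_of_subset_of_card_le (Finset.insert_subset hv.1 hSe) (by
    rw [Finset.card_insert_of_notMem hv.2, hE e heE]; omega)
  exact Finset.mem_image.2 ⟨v, Finset.mem_filter.2 ⟨Finset.mem_univ v, this ▸ heE⟩, this⟩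

lemma mul_log_natCast_le {n k τ : ℕ} {C : ℝ} (hC : 0 ≤ C) (hk : 2 ≤ k) (hkn : k ≤ n)
    (hτ : (τ : ℝ) ≤ (n : ℝ) ^ ((7 : ℝ) / 8) / 2) :
    (n : ℝ) * Real.log n - (C + 4 * k + 2 * Real.log k + 6) * n +
        (2 * Real.log n + 2 * Real.log k * n) ≤
      (n - (k - 1) : ℕ) * Real.log (n - (k - 1) : ℕ) - C * (n - (k - 1) : ℕ) - τ * Real.log τ := by
  have hn0 : (0 : ℝ) < n := by exact_mod_cast (by omega : 0 < n)
  have hn1 : (1 : ℝ) ≤ n := by exact_mod_cast (by omega : 1 ≤ n)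
  have hlog0 : 0 ≤ Real.log n := Real.log_nonneg hn1
  have hcast : ((n - (k - 1) : ℕ) : ℝ) = n - ((k : ℝ) - 1) := by
    rw [Nat.cast_sub (by omega), Nat.cast_sub (by omega), Nat.cast_one]
  have hk2 : (2 : ℝ) ≤ k := by exact_mod_cast hk
  have hkn' : (k : ℝ) ≤ n := by exact_mod_cast hkn
  have h1 := mul_log_le_add (N := n) (c := (k : ℝ) - 1) (q := n) (C := 1 + Real.log 6) (C' := 0) hn0
    (by linarith) (by linarith) (by linarith) (by linarith)
  have h6 : Real.log 6 ≤ 2 := by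
    rw [Real.log_le_iff_le_exp (by norm_num)]
    have h := Real.exp_one_gt_d9
    have : Real.exp 2 = Real.exp 1 * Real.exp 1 := by rw [← Real.exp_add]; norm_num
    nlinarith
  have h60 : 0 ≤ Real.log 6 := Real.log_nonneg (by norm_num)
  have hlogn : Real.log n ≤ n := (Real.log_le_sub_one_of_pos hn0).trans (by linarith)
  have hlog8 : (n : ℝ) ^ ((7 : ℝ) / 8) * Real.log n ≤ 8 * n := by
    have h := Real.log_le_rpow_div hn0.le (ε := 1 / 8) (by norm_num)
    have h2 : (n : ℝ) ^ ((7 : ℝ) / 8) * (n : ℝ) ^ (1 / 8 : ℝ) = n := by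
      rw [← Real.rpow_add hn0]; norm_num
    have h3 := mul_le_mul_of_nonneg_left h (by positivity : 0 ≤ (n : ℝ) ^ ((7 : ℝ) / 8))
    rw [mul_div_assoc', h2] at h3
    linarith
  have hτn : (τ : ℝ) * Real.log τ ≤ 4 * n := by
    rcases Nat.eq_zero_or_pos τ with rfl | hτ0
    · simp only [Nat.cast_zero, zero_mul]; positivity
    · have h2 : (n : ℝ) ^ ((7 : ℝ) / 8) ≤ n :=
        (Real.rpow_le_rpow_of_exponent_le hn1 (by norm_num)).trans (Real.rpow_one _).le
      have h3 : Real.log τ ≤ Real.log n :=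
        Real.log_le_log (by exact_mod_cast hτ0) (by linarith)
      calc (τ : ℝ) * Real.log τ ≤ (n : ℝ) ^ ((7 : ℝ) / 8) / 2 * Real.log n :=
            mul_le_mul hτ h3 (Real.log_natCast_nonneg τ) (by positivity)
        _ ≤ _ := by linarith
  rw [hcast]
  have h7 : ((k : ℝ) - 1) * Real.log n ≤ ((k : ℝ) - 1) * n := by gcongr; linarith
  have h8 : (1 + Real.log 6) * ((k : ℝ) - 1) ≤ 3 * ((k - 1) * n) := by
    have : ((k : ℝ) - 1) * 1 ≤ (k - 1) * n := by gcongr; linarith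
    nlinarith
  have h9 : 0 ≤ C * ((k : ℝ) - 1) := mul_nonneg hC (by linarith)
  nlinarith

lemma eventually_large (M : ℝ) :
    ∃ n₀ : ℕ, ∀ n ≥ n₀, M ≤ n ∧ M ≤ (n : ℝ) ^ ((7 : ℝ) / 8) := by
  have h1 := tendsto_natCast_atTop_atTop (R := ℝ)
  have h2 := (tendsto_rpow_atTop (show (0 : ℝ) < 7 / 8 by norm_num)).comp h1
  exact Filter.eventually_atTop.1
    ((h1.eventually_ge_atTop M).and (h2.eventually_ge_atTop M))

end Main

/-- Lemma 6.1: every `(n,k,γ)`-graph (for `n` large) contains at least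
`exp(n ln n − c n)` tight paths of length at least `n − n^{7/8}`. -/
theorem stmt_18 :
    ∀ k : ℕ, 2 ≤ k → ∀ γ : ℝ, 0 < γ →
    ∃ c : ℝ, 0 < c ∧ ∃ n₀ : ℕ, ∀ n : ℕ, n₀ ≤ n →
    ∀ E : Finset (Finset (Fin n)),
      (∀ e ∈ E, e.card = k) →
      (∀ S : Finset (Fin n), S.card = k - 1 →
        (1/2 + γ) * (n : ℝ) ≤ ((E.filter (fun e => S ⊆ e)).card : ℝ)) →
      Real.exp ((n : ℝ) * Real.log n - c * n) ≤ ((longTightPaths n k E).card : ℝ) := by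
  intro k hk γ₀ hγ₀
  set γ := min γ₀ 1
  have hγ : 0 < γ := lt_min hγ₀ one_pos
  obtain ⟨τ₀, C, hC, hmain⟩ := exists_many_tight_lists k hk hγ (min_le_right _ _)
  have hlogk : 0 ≤ Real.log k := Real.log_natCast_nonneg k
  obtain ⟨n₀, hn₀⟩ := eventually_large (2 * τ₀ + 4 * k + 2 + 2 * k / γ)
  refine ⟨C + 4 * k + 2 * Real.log k + 6, by positivity, n₀, fun n hn E hE hdeg => ?_⟩
  obtain ⟨hnM, hnM'⟩ := hn₀ n hn
  have hkγ : (0 : ℝ) ≤ 2 * k / γ := by positivity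
  have hτ0 : (0 : ℝ) ≤ τ₀ := Nat.cast_nonneg _
  have hk0 : (2 : ℝ) ≤ k := by exact_mod_cast hk
  have hn0 : (0 : ℝ) < n := by linarith
  have hkn : 4 * k ≤ n := by
    have : (4 * k : ℝ) ≤ n := by linarith
    exact_mod_cast this
  have hkγn : 2 * (k : ℝ) ≤ γ * n := by
    have : 2 * (k : ℝ) / γ ≤ n := by linarith
    rwa [div_le_iff₀ hγ, mul_comm (n : ℝ)] at this
  set τ := ⌊(n : ℝ) ^ ((7 : ℝ) / 8) / 2⌋₊ with hτdef
  have hτ : (τ : ℝ) ≤ (n : ℝ) ^ ((7 : ℝ) / 8) / 2 := Nat.floor_le (by positivity)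
  obtain ⟨S₀, -, hS₀⟩ := Finset.exists_subset_card_eq
    (s := (Finset.univ : Finset (Fin n))) (n := k - 1) (by simp; omega)
  set W := Finset.univ \ S₀ with hW
  have hWc : W.card = n - (k - 1) := by
    rw [hW, Finset.card_sdiff_of_subset (Finset.subset_univ _), hS₀, Finset.card_univ,
      Fintype.card_fin]
  obtain ⟨R, hR, hRl⟩ := hmain τ (Nat.le_floor (by linarith)) E hE (n - (k - 1)) ∅ W S₀.toList
    (Finset.disjoint_empty_left _) (by simp [hWc]) (by simp; positivity) S₀.nodup_toList
    (by simp [hS₀]) (fun v hv h => by simp [hW] at hv h; exact h hv) (fun S _ hSc => by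
      have h1 : typicalCodegree (γ / 2) (γ / 8) W.card ≤ 1 / 2 + γ / 2 := by
        have : 0 ≤ γ / 8 * (W.card : ℝ) ^ (-(1 / 4 : ℝ)) := by positivity
        simp only [typicalCodegree]; linarith
      have h2 : (W.card : ℝ) ≤ n := by exact_mod_cast (by omega : W.card ≤ n)
      have h3 := linkIn_card_union_le (E := E) W S₀ S
      rw [hW, Finset.sdiff_union_of_subset (Finset.subset_univ _), ← hW] at h3
      have h4 : (linkIn E S₀ S).card ≤ k - 1 :=
        (Finset.card_le_card (Finset.filter_subset _ _)).trans hS₀.le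
      have h5 := card_filter_subset_le_linkIn (by omega) hE hSc
      have h6 : ((E.filter (S ⊆ ·)).card : ℝ) ≤ (linkIn E W S).card + k := by
        exact_mod_cast (by omega : (E.filter (S ⊆ ·)).card ≤ (linkIn E W S).card + k)
      have h7 := hdeg S hSc
      have h8 : (1 / 2 + γ) * (n : ℝ) ≤ (1 / 2 + γ₀) * n := by
        have : γ ≤ γ₀ := min_le_left _ _
        gcongr
      have h9 : typicalCodegree (γ / 2) (γ / 8) W.card * W.card ≤ (1 / 2 + γ / 2) * n := by
        gcongr
      linarith)
  have hlen : ∀ l ∈ R, (n : ℝ) - (n : ℝ) ^ ((7 : ℝ) / 8) ≤ (l.length : ℝ) - ((k : ℝ) - 1) := by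
    intro l hl
    have h1 : n ≤ l.length + τ + (k - 1) := by have := (hRl l hl).2.2.2; omega
    have h2 : (n : ℝ) ≤ l.length + τ + k := by exact_mod_cast h1.trans (by omega)
    linarith
  have hRk : ∀ l ∈ R, l.Nodup ∧ k ≤ l.length := fun l hl => by
    refine ⟨(hRl l hl).1, ?_⟩
    have h1 : (n : ℝ) ^ ((7 : ℝ) / 8) ≤ n :=
      (Real.rpow_le_rpow_of_exponent_le (by linarith) (by norm_num)).trans (Real.rpow_one _).le
    have h2 : n ≤ l.length + τ + (k - 1) := by have := (hRl l hl).2.2.2; omega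
    have h3 : (n : ℝ) ≤ l.length + τ + k := by exact_mod_cast h2.trans (by omega)
    have : (k : ℝ) ≤ l.length := by linarith
    exact_mod_cast this
  have hsub : R.image (windows k) ⊆ longTightPaths n k E := fun P hP => by
    obtain ⟨l, hl, rfl⟩ := Finset.mem_image.1 hP
    exact windows_mem_longTightPaths (by omega) (hRl l hl).1
      ((hRl l hl).2.2.1.of_infix (List.suffix_append _ _).isInfix) (hlen l hl)
  have hcard := (card_le_card_image_windows hk R hRk).trans
    (Nat.mul_le_mul_left _ (Finset.card_le_card hsub))
  rw [Fintype.card_fin] at hcard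
  have hcard' : (R.card : ℝ) ≤ Real.exp (2 * Real.log n + 2 * Real.log k * n) *
      (longTightPaths n k E).card := by
    have h1 : ((n * (n * (k * k) ^ n) : ℕ) : ℝ) =
        Real.exp (2 * Real.log n + 2 * Real.log k * n) := by
      have h2 : 2 * Real.log n + 2 * Real.log k * n =
          Real.log n + (Real.log n + n * (Real.log k + Real.log k)) := by ring
      rw [h2, Real.exp_add, Real.exp_add, Real.exp_nat_mul, Real.exp_add, Real.exp_log hn0,
        Real.exp_log (by linarith)]
      push_cast; rfl
    rw [← h1]
    exact_mod_cast hcard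
  have hfin := (Real.exp_le_exp.2 (mul_log_natCast_le hC hk (by omega) hτ)).trans (hR.trans hcard')
  rw [Real.exp_add, mul_comm] at hfin
  exact le_of_mul_le_mul_left hfin (Real.exp_pos _)
end
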